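/- Suppose: (D1) a = σσᵀ where σ : ℝ^N × [0,T] → N×N matrices is Lipschitz continuous on compact subsets, and there is μ > 0 with ξᵀ a(x,t) ξ ≥ μ|ξ|² for all ξ and (x,t); (D2) i, h, f are continuous and there is a sequence L_n > 0 such that for each ζ ∈ {f, h, i}, all δ ∈ D, η ∈ Γ, and all (x,t),(x̄,t̄) with |x|,|x̄| ≤ n, one has |ζ(x,t,δ,η) − ζ(x̄,t̄,δ,η)| ≤ L_n(|x − x̄| + |t − t̄|); (D3) β : ℝ^N → ℝ is Lipschitz continuous on compact subsets; (D4) there are A, B > 0 such that for all δ, η and (x,t): either |h(x,t,δ,η)| ≤ B(1+|x|) or h(x,t,δ,η) ≤ B; |f(x,t,δ,η)| + |β(x)| ≤ B e^{A|x|}; |i(x,t,δ,η)| ≤ B(1+|x|); and |σ(x,t)| ≤ B. Then the Isaacs terminal-value problem admits a classical solution u (continuous on ℝ^N × [0,T], with continuous D_x u, D²_x u, u_t on ℝ^N × [0,T), satisfying the equation pointwise and u(x,T) = β(x)). -/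

import Mathlib

open scoped BigOperators
open MeasureTheory Set Matrix

noncomputable section

abbrev Euc (N : ℕ) : Type := EuclideanSpace ℝ (Fin N)

/-- The Isaacs Hamiltonian
`max_{δ∈D} min_{η∈Γ} ( i(x,t,δ,η)·p + h(x,t,δ,η) u + f(x,t,δ,η) )`. -/
def isaacsHam (N k m : ℕ) (Dset : Set (Fin k → ℝ)) (Γset : Set (Fin m → ℝ))
    (iv : Euc N → ℝ → (Fin k → ℝ) → (Fin m → ℝ) → Euc N)
    (h f : Euc N → ℝ → (Fin k → ℝ) → (Fin m → ℝ) → ℝ)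
    (p : Euc N) (u : ℝ) (x : Euc N) (t : ℝ) : ℝ :=
  ⨆ δ : Dset, ⨅ η : Γset,
    ((∑ i, iv x t δ.1 η.1 i * p i) + h x t δ.1 η.1 * u + f x t δ.1 η.1)

/-- A classical solution of the terminal-value problem
`u_t + (1/2)·Tr(a(x,t) D²_x u) + H(D_x u, u, x, t) = 0` on `ℝ^N × [0,T)`,
`u(x,T) = β(x)`. -/
def IsClassicalSolution (N : ℕ) (T : ℝ)
    (a : Euc N → ℝ → Matrix (Fin N) (Fin N) ℝ)
    (H : Euc N → ℝ → Euc N → ℝ → ℝ)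
    (β : Euc N → ℝ)
    (u : Euc N → ℝ → ℝ) (Du : Euc N → ℝ → Euc N)
    (D2u : Euc N → ℝ → (Euc N →L[ℝ] Euc N)) (ut : Euc N → ℝ → ℝ) : Prop :=
  ContinuousOn (fun q : Euc N × ℝ => u q.1 q.2) (Set.univ ×ˢ Set.Icc 0 T)
  ∧ (∀ x t, t ∈ Set.Ico 0 T → HasGradientAt (fun y => u y t) (Du x t) x)
  ∧ (∀ x t, t ∈ Set.Ico 0 T → HasFDerivAt (fun y => Du y t) (D2u x t) x)
  ∧ (∀ x t, t ∈ Set.Ico 0 T →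
        HasDerivWithinAt (fun s => u x s) (ut x t) (Set.Ico 0 T) t)
  ∧ ContinuousOn (fun q : Euc N × ℝ => Du q.1 q.2) (Set.univ ×ˢ Set.Ico 0 T)
  ∧ ContinuousOn (fun q : Euc N × ℝ => D2u q.1 q.2) (Set.univ ×ˢ Set.Ico 0 T)
  ∧ ContinuousOn (fun q : Euc N × ℝ => ut q.1 q.2) (Set.univ ×ˢ Set.Ico 0 T)
  ∧ (∀ x t, t ∈ Set.Ico 0 T →
      ut x t
        + (1/2) * (∑ i, ∑ j, a x t i j * (D2u x t (EuclideanSpace.single j 1)) i)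
        + H (Du x t) (u x t) x t = 0)
  ∧ (∀ x, u x T = β x)

/-! ### Gaussian-dominated kernels -/

section GaussianKernels

variable {N : ℕ} {F : Type*} [NormedAddCommGroup F] [NormedSpace ℝ F]

theorem integrable_gauss {κ : ℝ} (hκ : 0 < κ) :
    Integrable (fun z : Euc N => Real.exp (-κ * ‖z‖ ^ 2)) := by
  apply MeasureTheory.Integrable.of_integral_ne_zero
  have h := GaussianFourier.integral_rexp_neg_mul_sq_norm (V := Euc N) hκ
  rw [h]
  positivity

theorem integrable_gauss_shift {κ : ℝ} (hκ : 0 < κ) (C : ℝ) (x : Euc N) :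
    Integrable (fun z : Euc N => C * Real.exp (-κ * ‖z - x‖ ^ 2)) :=
  ((integrable_gauss hκ).comp_sub_right x).const_mul C

/-- Shifting the centre of a Gaussian by a unit vector costs half of the decay rate. -/
theorem gauss_shift_le {κ : ℝ} (hκ : 0 < κ) (x x₀ y : Euc N) (hx : ‖x - x₀‖ ≤ 1) :
    Real.exp (-κ * ‖y - x‖ ^ 2) ≤ Real.exp κ * Real.exp (-(κ / 2) * ‖y - x₀‖ ^ 2) := by
  rw [← Real.exp_add]
  apply Real.exp_le_exp.2
  have h1 : ‖y - x₀‖ ≤ ‖y - x‖ + ‖x - x₀‖ := norm_sub_le_norm_sub_add_norm_sub _ _ _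
  have h2 : ‖y - x₀‖ ^ 2 ≤ 2 * ‖y - x‖ ^ 2 + 2 := by
    have h0 := norm_nonneg (y - x₀)
    have h3 := norm_nonneg (y - x)
    have h4 := norm_nonneg (x - x₀)
    nlinarith [sq_nonneg (‖y - x‖ - ‖x - x₀‖)]
  nlinarith

theorem continuous_integral_gauss {X : Type*} [TopologicalSpace X] [FirstCountableTopology X]
    {φ : X → Euc N → F} (hφ : Continuous (fun p : X × Euc N => φ p.1 p.2)) {C κ : ℝ}
    (hκ : 0 < κ) (hb : ∀ x z, ‖φ x z‖ ≤ C * Real.exp (-κ * ‖z‖ ^ 2)) :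
    Continuous (fun x => ∫ z, φ x z) := by
  refine continuous_of_dominated (bound := fun z => C * Real.exp (-κ * ‖z‖ ^ 2)) ?_ ?_ ?_ ?_
  · intro x
    exact (hφ.comp (Continuous.prodMk_right x)).aestronglyMeasurable
  · intro x
    exact Filter.Eventually.of_forall (hb x)
  · exact (integrable_gauss hκ).const_mul C
  · exact Filter.Eventually.of_forall fun z => hφ.comp (Continuous.prodMk_left z)

theorem integrable_of_gauss {φ : Euc N → F} (hφ : Continuous φ) {C κ : ℝ}
    (hκ : 0 < κ) (hb : ∀ z, ‖φ z‖ ≤ C * Real.exp (-κ * ‖z‖ ^ 2)) : Integrable φ :=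
  ((integrable_gauss hκ).const_mul C).mono' hφ.aestronglyMeasurable
    (Filter.Eventually.of_forall hb)

theorem norm_integral_gauss_le {φ : Euc N → F} {C κ : ℝ}
    (hκ : 0 < κ) (hb : ∀ z, ‖φ z‖ ≤ C * Real.exp (-κ * ‖z‖ ^ 2)) :
    ‖∫ z, φ z‖ ≤ C * ∫ z : Euc N, Real.exp (-κ * ‖z‖ ^ 2) := by
  rw [← integral_const_mul]
  exact norm_integral_le_of_norm_le ((integrable_gauss hκ).const_mul C)
    (Filter.Eventually.of_forall hb)

theorem integral_scaled_kernel (k : Euc N → Euc N → F) (x : Euc N) {h : ℝ} (hh : 0 < h) :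
    ∫ z, k (x + h • z) z = (h ^ N)⁻¹ • ∫ y, k y (h⁻¹ • (y - x)) := by
  have h1 := Measure.integral_comp_smul (volume : Measure (Euc N))
    (fun w => k (x + w) (h⁻¹ • w)) h
  have h2 : ∫ w : Euc N, k (x + w) (h⁻¹ • w) = ∫ y, k y (h⁻¹ • (y - x)) := by
    rw [← integral_add_left_eq_self (μ := (volume : Measure (Euc N)))
      (fun y => k y (h⁻¹ • (y - x))) x]
    simp
  rw [h2] at h1
  rw [finrank_euclideanSpace_fin, abs_of_pos (by positivity)] at h1
  rw [← h1]
  congr 1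
  ext z
  rw [smul_smul, inv_mul_cancel₀ hh.ne', one_smul]

theorem hasFDerivAt_scaled_kernel {k : Euc N → Euc N → F} {k' : Euc N → Euc N → Euc N →L[ℝ] F}
    (hk : Continuous (fun p : Euc N × Euc N => k p.1 p.2))
    (hk' : Continuous (fun p : Euc N × Euc N => k' p.1 p.2))
    (hd : ∀ y z, HasFDerivAt (k y) (k' y z) z) {C κ : ℝ} (hκ : 0 < κ)
    (hb : ∀ y z, ‖k y z‖ ≤ C * Real.exp (-κ * ‖z‖ ^ 2))
    (hb' : ∀ y z, ‖k' y z‖ ≤ C * Real.exp (-κ * ‖z‖ ^ 2))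
    (x : Euc N) {h : ℝ} (hh : 0 < h) :
    HasFDerivAt (fun x => ∫ z, k (x + h • z) z) (-(h⁻¹ • ∫ z, k' (x + h • z) z)) x := by
  have e1 : (fun x => ∫ z, k (x + h • z) z)
      = fun x => (h ^ N)⁻¹ • ∫ y, k y (h⁻¹ • (y - x)) := by
    ext x; exact integral_scaled_kernel k x hh
  rw [e1, integral_scaled_kernel k' x hh]
  have hC : 0 ≤ C := by
    have := (norm_nonneg _).trans (hb 0 0)
    simpa using this
  have hκ' : 0 < κ * (h⁻¹) ^ 2 := by positivity
  have key : HasFDerivAt (fun x => ∫ y, k y (h⁻¹ • (y - x)))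
      (∫ y, (-h⁻¹) • k' y (h⁻¹ • (y - x))) x := by
    refine hasFDerivAt_integral_of_dominated_of_fderiv_le (𝕜 := ℝ)
      (F := fun x y => k y (h⁻¹ • (y - x)))
      (F' := fun x y => (-h⁻¹) • k' y (h⁻¹ • (y - x)))
      (bound := fun y => (h⁻¹ * C * Real.exp (κ * (h⁻¹) ^ 2)) *
        Real.exp (-(κ * (h⁻¹) ^ 2 / 2) * ‖y - x‖ ^ 2))
      (Metric.ball_mem_nhds x one_pos) ?_ ?_ ?_ ?_ ?_ ?_
    · refine Filter.Eventually.of_forall fun x => ?_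
      have : Continuous fun y => k y (h⁻¹ • (y - x)) :=
        hk.comp (by fun_prop : Continuous fun y : Euc N => (y, h⁻¹ • (y - x)))
      exact this.aestronglyMeasurable
    · have : Continuous fun y => k y (h⁻¹ • (y - x)) :=
        hk.comp (by fun_prop : Continuous fun y : Euc N => (y, h⁻¹ • (y - x)))
      refine (integrable_gauss_shift hκ' C x).mono' this.aestronglyMeasurable
        (Filter.Eventually.of_forall fun y => ?_)
      refine (hb _ _).trans (le_of_eq ?_)
      rw [norm_smul, Real.norm_of_nonneg (by positivity)]
      ring_nf
    · have : Continuous fun y => k' y (h⁻¹ • (y - x)) :=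
        hk'.comp (by fun_prop : Continuous fun y : Euc N => (y, h⁻¹ • (y - x)))
      exact (this.const_smul (-h⁻¹)).aestronglyMeasurable
    · refine Filter.Eventually.of_forall fun y x' hx' => ?_
      rw [norm_smul, norm_neg, Real.norm_of_nonneg (by positivity : 0 ≤ h⁻¹), mul_assoc, mul_assoc]
      refine mul_le_mul_of_nonneg_left ((hb' _ _).trans ?_) (by positivity)
      refine mul_le_mul_of_nonneg_left ?_ hC
      have := gauss_shift_le hκ' x' x y (by
        rw [← dist_eq_norm]; exact (Metric.mem_ball.1 hx').le)
      refine le_trans (le_of_eq ?_) this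
      rw [norm_smul, Real.norm_of_nonneg (by positivity)]
      ring_nf
    · exact integrable_gauss_shift (by positivity) _ x
    · refine Filter.Eventually.of_forall fun y x' _ => ?_
      have h1 : HasFDerivAt (fun x' : Euc N => h⁻¹ • (y - x'))
          (h⁻¹ • (-(ContinuousLinearMap.id ℝ (Euc N)))) x' :=
        ((hasFDerivAt_id x').const_sub y).const_smul h⁻¹
      have h2 := (hd y (h⁻¹ • (y - x'))).comp x' h1
      refine HasFDerivAt.congr_fderiv h2 ?_
      ext v
      simp
  have := key.const_smul ((h ^ N)⁻¹)
  refine HasFDerivAt.congr_fderiv this ?_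
  rw [integral_smul, smul_comm, neg_smul]

theorem hasDerivAt_scaled_kernel {k : Euc N → Euc N → F} {k' : Euc N → Euc N → Euc N →L[ℝ] F}
    (hk : Continuous (fun p : Euc N × Euc N => k p.1 p.2))
    (hk' : Continuous (fun p : Euc N × Euc N => k' p.1 p.2))
    (hd : ∀ y z, HasFDerivAt (k y) (k' y z) z) {C κ : ℝ} (hκ : 0 < κ)
    (hb : ∀ y z, ‖k y z‖ ≤ C * Real.exp (-κ * ‖z‖ ^ 2))
    (hb' : ∀ y z, ‖k' y z z‖ ≤ C * Real.exp (-κ * ‖z‖ ^ 2))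
    (x : Euc N) {h : ℝ} (hh : 0 < h) :
    HasDerivAt (fun h : ℝ => ∫ z, k (x + h • z) z)
      (-(h⁻¹ • ∫ z, ((N : ℝ) • k (x + h • z) z + k' (x + h • z) z z))) h := by
  have hC : 0 ≤ C := by
    have := (norm_nonneg _).trans (hb 0 0)
    simpa using this
  have e1 : (fun h : ℝ => ∫ z, k (x + h • z) z)
      =ᶠ[nhds h] fun h => (h ^ N)⁻¹ • ∫ y, k y (h⁻¹ • (y - x)) := by
    filter_upwards [lt_mem_nhds hh] with h hh
    exact integral_scaled_kernel k x hh
  refine HasDerivAt.congr_of_eventuallyEq ?_ e1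
  have e2 := integral_scaled_kernel (fun y z => (N : ℝ) • k y z + k' y z z) x hh
  rw [e2]
  have hcont : ∀ h : ℝ, Continuous fun y => k y (h⁻¹ • (y - x)) := fun h =>
    hk.comp (by fun_prop : Continuous fun y : Euc N => (y, h⁻¹ • (y - x)))
  have hcont' : ∀ h : ℝ, Continuous fun y => k' y (h⁻¹ • (y - x)) (h⁻¹ • (y - x)) := fun h =>
    (hk'.comp (by fun_prop : Continuous fun y : Euc N => (y, h⁻¹ • (y - x)))).clm_apply
      (by fun_prop)
  have hκ' : 0 < κ * (h⁻¹) ^ 2 := by positivity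
  have hkint : Integrable fun y => k y (h⁻¹ • (y - x)) := by
    refine (integrable_gauss_shift hκ' C x).mono' (hcont h).aestronglyMeasurable
        (Filter.Eventually.of_forall fun y => ?_)
    refine (hb _ _).trans (le_of_eq ?_)
    rw [norm_smul, Real.norm_of_nonneg (by positivity)]
    ring_nf
  have hkint' : Integrable fun y => k' y (h⁻¹ • (y - x)) (h⁻¹ • (y - x)) := by
    refine (integrable_gauss_shift hκ' C x).mono' (hcont' h).aestronglyMeasurable
        (Filter.Eventually.of_forall fun y => ?_)
    refine (hb' _ _).trans (le_of_eq ?_)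
    rw [norm_smul, Real.norm_of_nonneg (by positivity)]
    ring_nf
  have key : HasDerivAt (fun h : ℝ => ∫ y, k y (h⁻¹ • (y - x)))
      (∫ y, (-h⁻¹) • k' y (h⁻¹ • (y - x)) (h⁻¹ • (y - x))) h := by
    refine (hasDerivAt_integral_of_dominated_loc_of_deriv_le (𝕜 := ℝ)
      (s := Ioo (h / 2) (2 * h))
      (F := fun (h : ℝ) y => k y (h⁻¹ • (y - x)))
      (F' := fun (h : ℝ) y => (-h⁻¹) • k' y (h⁻¹ • (y - x)) (h⁻¹ • (y - x)))
      (bound := fun y => (2 * h⁻¹ * C) *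
        Real.exp (-(κ * (h⁻¹) ^ 2 / 4) * ‖y - x‖ ^ 2))
      (Ioo_mem_nhds (by linarith) (by linarith)) ?_ ?_ ?_ ?_ ?_ ?_).2
    · exact Filter.Eventually.of_forall fun h => (hcont h).aestronglyMeasurable
    · exact hkint
    · exact ((hcont' h).const_smul (-h⁻¹)).aestronglyMeasurable
    · refine Filter.Eventually.of_forall fun y h' hh' => ?_
      have hp : 0 < h' := by linarith [hh'.1]
      rw [norm_smul, norm_neg, Real.norm_of_nonneg (by positivity : 0 ≤ h'⁻¹), mul_assoc]
      have i1 : h'⁻¹ ≤ 2 * h⁻¹ := by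
        rw [inv_le_iff_one_le_mul₀ hp]
        have : h⁻¹ * h = 1 := inv_mul_cancel₀ hh.ne'
        have : 0 < h⁻¹ := by positivity
        nlinarith [hh'.1]
      have i2 : h⁻¹ / 2 ≤ h'⁻¹ := by
        rw [le_inv_comm₀ (by positivity) hp]
        have : (h⁻¹ / 2)⁻¹ = 2 * h := by field_simp
        rw [this]; exact hh'.2.le
      rw [mul_assoc]
      have i3 : ‖(k' y (h'⁻¹ • (y - x))) (h'⁻¹ • (y - x))‖ ≤
          C * Real.exp (-(κ * h⁻¹ ^ 2 / 4) * ‖y - x‖ ^ 2) := by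
        refine (hb' _ _).trans (mul_le_mul_of_nonneg_left ?_ hC)
        apply Real.exp_le_exp.2
        rw [norm_smul, Real.norm_of_nonneg (by positivity)]
        have h5 : (h⁻¹ / 2) ^ 2 ≤ h'⁻¹ ^ 2 := by gcongr
        have h6 : 0 ≤ κ * ‖y - x‖ ^ 2 := by positivity
        nlinarith [mul_le_mul_of_nonneg_left h5 h6]
      calc h'⁻¹ * _ ≤ (2 * h⁻¹) * _ := mul_le_mul i1 i3 (norm_nonneg _) (by positivity)
        _ = _ := by ring
    · exact integrable_gauss_shift (by positivity) _ x
    · refine Filter.Eventually.of_forall fun y h' hh' => ?_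
      have hp : 0 < h' := by linarith [hh'.1]
      have h1 : HasDerivAt (fun h' : ℝ => h'⁻¹ • (y - x)) ((-(h' ^ 2)⁻¹) • (y - x)) h' :=
        (hasDerivAt_inv hp.ne').smul_const (y - x)
      have h2 := (hd y (h'⁻¹ • (y - x))).comp_hasDerivAt h' h1
      refine HasDerivAt.congr_deriv h2 ?_
      rw [map_smul, map_smul, smul_smul]
      congr 1
      field_simp
  have h3 : HasDerivAt (fun h : ℝ => (h ^ N)⁻¹) (-(N : ℝ) * h⁻¹ * (h ^ N)⁻¹) h := by
    have := (hasDerivAt_pow N h).inv (pow_ne_zero N hh.ne')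
    refine HasDerivAt.congr_deriv this ?_
    rcases N with _ | n
    · simp
    · simp only [Nat.add_sub_cancel]
      field_simp
      ring
  have := h3.smul key
  refine HasDerivAt.congr_deriv this ?_
  have e3 : ∫ y, ((N : ℝ) • k y (h⁻¹ • (y - x)) + k' y (h⁻¹ • (y - x)) (h⁻¹ • (y - x)))
      = (N : ℝ) • (∫ y, k y (h⁻¹ • (y - x))) + ∫ y, k' y (h⁻¹ • (y - x)) (h⁻¹ • (y - x)) := by
    rw [← integral_smul]
    exact integral_add (hkint.smul (N : ℝ)) hkint'
  rw [integral_smul, e3]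
  simp only [smul_add, smul_smul, neg_smul, neg_add_rev, smul_neg]
  congr 2
  · ring_nf
  · rw [← neg_smul]
    ring_nf

theorem integral_fderiv_kernel_eq_zero {k : Euc N → F} {k' : Euc N → Euc N →L[ℝ] F}
    (hk : Continuous k) (hk' : Continuous k')
    (hd : ∀ z, HasFDerivAt k (k' z) z) {C κ : ℝ} (hκ : 0 < κ)
    (hb : ∀ z, ‖k z‖ ≤ C * Real.exp (-κ * ‖z‖ ^ 2))
    (hb' : ∀ z, ‖k' z‖ ≤ C * Real.exp (-κ * ‖z‖ ^ 2)) : ∫ z, k' z = 0 := by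
  have h1 := hasFDerivAt_scaled_kernel (k := fun _ => k) (k' := fun _ => k')
    (hk.comp continuous_snd) (hk'.comp continuous_snd) (fun _ => hd) hκ (fun _ => hb)
    (fun _ => hb') 0 one_pos
  have h2 := h1.unique (hasFDerivAt_const (∫ z, k z) (0 : Euc N))
  simpa using h2

end GaussianKernels

/-! ### Coefficients and their Gaussian kernels -/

/-- A uniformly elliptic, bounded, Lipschitz family of second-order coefficients on space-time,
given by the trace functional `M ↦ Tr (a q M)` together with the inverse matrix `Q q` of `a q`. -/
structure Coef (N : ℕ) where
  Q : Euc N × ℝ → Euc N →L[ℝ] Euc N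
  tr : Euc N × ℝ → (Euc N →L[ℝ] Euc N) →L[ℝ] ℝ
  ν : ℝ
  Λ : ℝ
  ν_pos : 0 < ν
  Λ_pos : 0 < Λ
  Q_symm : ∀ q z w, inner ℝ (Q q z) w = inner ℝ z (Q q w)
  Q_pos : ∀ q z, ν * ‖z‖ ^ 2 ≤ inner ℝ z (Q q z)
  Q_le : ∀ q, ‖Q q‖ ≤ Λ
  Q_lip : ∀ q q', ‖Q q - Q q'‖ ≤ Λ * ‖q - q'‖
  tr_le : ∀ q, ‖tr q‖ ≤ Λ
  tr_lip : ∀ q q', ‖tr q - tr q'‖ ≤ Λ * ‖q - q'‖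
  tr_Q : ∀ q, tr q (Q q) = N
  tr_rankOne : ∀ q z, tr q (InnerProductSpace.rankOne ℝ (Q q z) (Q q z)) = inner ℝ z (Q q z)
  tr_nonpos : ∀ q M, (∀ v, inner ℝ v (M v) ≤ 0) → tr q M ≤ 0

/-- A continuous kernel with Gaussian decay which is Lipschitz in both arguments. -/
structure IsGaussKernel {N : ℕ} {F : Type*} [NormedAddCommGroup F] (κ M : ℝ)
    (k : Euc N × ℝ → Euc N → F) : Prop where
  cont : Continuous (fun p : (Euc N × ℝ) × Euc N => k p.1 p.2)
  bound : ∀ q z, (1 + ‖z‖) ^ 2 * ‖k q z‖ ≤ M * Real.exp (-κ * ‖z‖ ^ 2)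
  lip : ∀ q q' z w, ‖w‖ ≤ 1 → (1 + ‖z‖) ^ 2 * ‖k q (z + w) - k q' z‖ ≤
    M * (‖q - q'‖ + ‖w‖) * Real.exp (-κ * ‖z‖ ^ 2)

theorem one_add_pow_mul_gauss_le (m : ℕ) {κ : ℝ} (hκ : 0 < κ) {r : ℝ} (hr : 0 ≤ r) :
    (1 + r) ^ m * Real.exp (-(2 * κ) * r ^ 2) ≤
      Real.exp ((m : ℝ) ^ 2 / (4 * κ)) * Real.exp (-κ * r ^ 2) := by
  have h1 : (1 + r) ^ m ≤ Real.exp (m * r) := by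
    rw [Real.exp_nat_mul]
    have := Real.add_one_le_exp r
    exact pow_le_pow_left₀ (by positivity) (by linarith) m
  calc _ ≤ Real.exp (m * r) * Real.exp (-(2 * κ) * r ^ 2) := by gcongr
    _ = Real.exp (m * r - 2 * κ * r ^ 2) := by rw [← Real.exp_add]; ring_nf
    _ ≤ Real.exp ((m : ℝ) ^ 2 / (4 * κ) - κ * r ^ 2) := by
      apply Real.exp_le_exp.2
      have : (m : ℝ) ^ 2 / (4 * κ) - κ * r ^ 2 - (m * r - 2 * κ * r ^ 2)
        = (m - 2 * κ * r) ^ 2 / (4 * κ) := by field_simp; ring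
      have h3 : 0 ≤ ((m : ℝ) - 2 * κ * r) ^ 2 / (4 * κ) := by positivity
      linarith
    _ = _ := by rw [← Real.exp_add]; ring_nf

/-- A kernel that is polynomially bounded against a Gaussian is a Gaussian kernel with a smaller
rate. -/
theorem IsGaussKernel.of_poly {N : ℕ} {F : Type*} [NormedAddCommGroup F] {κ : ℝ} (hκ : 0 < κ)
    {k : Euc N × ℝ → Euc N → F}
    (hc : Continuous (fun p : (Euc N × ℝ) × Euc N => k p.1 p.2)) {m : ℕ} {C : ℝ} (hC : 0 ≤ C)
    (hb : ∀ q z, ‖k q z‖ ≤ C * (1 + ‖z‖) ^ m * Real.exp (-(2 * κ) * ‖z‖ ^ 2))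
    (hl : ∀ q q' z w, ‖w‖ ≤ 1 → ‖k q (z + w) - k q' z‖ ≤
      C * (‖q - q'‖ + ‖w‖) * (1 + ‖z‖) ^ m * Real.exp (-(2 * κ) * ‖z‖ ^ 2)) :
    ∃ M, IsGaussKernel κ M k := by
  refine ⟨C * Real.exp (((m + 2 : ℕ) : ℝ) ^ 2 / (4 * κ)), hc, fun q z => ?_, fun q q' z w hw => ?_⟩
  · have h1 := one_add_pow_mul_gauss_le (m + 2) hκ (norm_nonneg z)
    calc _ ≤ (1 + ‖z‖) ^ 2 * (C * (1 + ‖z‖) ^ m * Real.exp (-(2 * κ) * ‖z‖ ^ 2)) := by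
          gcongr; exact hb q z
      _ = C * ((1 + ‖z‖) ^ (m + 2) * Real.exp (-(2 * κ) * ‖z‖ ^ 2)) := by ring
      _ ≤ C * _ := mul_le_mul_of_nonneg_left h1 hC
      _ = _ := by ring
  · have h1 := one_add_pow_mul_gauss_le (m + 2) hκ (norm_nonneg z)
    calc _ ≤ (1 + ‖z‖) ^ 2 * (C * (‖q - q'‖ + ‖w‖) * (1 + ‖z‖) ^ m *
            Real.exp (-(2 * κ) * ‖z‖ ^ 2)) := by
          gcongr; exact hl q q' z w hw
      _ = (C * (‖q - q'‖ + ‖w‖)) * ((1 + ‖z‖) ^ (m + 2) * Real.exp (-(2 * κ) * ‖z‖ ^ 2)) := by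
          ring
      _ ≤ (C * (‖q - q'‖ + ‖w‖)) * _ := mul_le_mul_of_nonneg_left h1 (by positivity)
      _ = _ := by ring

theorem abs_exp_neg_sub_exp_neg_le {α β m : ℝ} (hα : m ≤ α) (hβ : m ≤ β) :
    |Real.exp (-α) - Real.exp (-β)| ≤ |α - β| * Real.exp (-m) := by
  wlog h : α ≤ β generalizing α β
  · rw [abs_sub_comm, abs_sub_comm α]
    exact this hβ hα (le_of_not_ge h)
  have h1 : Real.exp (-β) = Real.exp (-α) * Real.exp (α - β) := by
    rw [← Real.exp_add]; ring_nf
  have h2 := Real.add_one_le_exp (α - β)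
  have h3 : Real.exp (-α) ≤ Real.exp (-m) := Real.exp_le_exp.2 (by linarith)
  have h4 : Real.exp (-β) ≤ Real.exp (-α) := Real.exp_le_exp.2 (by linarith)
  rw [abs_of_nonneg (by linarith), abs_of_nonpos (by linarith), h1]
  calc _ = Real.exp (-α) * (1 - Real.exp (α - β)) := by ring
    _ ≤ Real.exp (-α) * (-(α - β)) := by gcongr; linarith
    _ ≤ _ := by rw [mul_comm]; gcongr; linarith

namespace Coef

variable {N : ℕ} (C : Coef N)

theorem continuous_Q : Continuous C.Q := by
  have h : LipschitzWith C.Λ.toNNReal C.Q := by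
    refine LipschitzWith.of_dist_le_mul fun q q' => ?_
    rw [dist_eq_norm, dist_eq_norm, Real.coe_toNNReal _ C.Λ_pos.le]
    exact C.Q_lip q q'
  exact h.continuous

theorem continuous_tr : Continuous C.tr := by
  have h : LipschitzWith C.Λ.toNNReal C.tr := by
    refine LipschitzWith.of_dist_le_mul fun q q' => ?_
    rw [dist_eq_norm, dist_eq_norm, Real.coe_toNNReal _ C.Λ_pos.le]
    exact C.tr_lip q q'
  exact h.continuous

/-- The unnormalised Gaussian with inverse covariance `Q q`. -/
def ph (q : Euc N × ℝ) (z : Euc N) : ℝ := Real.exp (-(inner ℝ z (C.Q q z) / 2))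

/-- The decay rate of all kernels. -/
def κ : ℝ := C.ν / 8

theorem κ_pos : 0 < C.κ := by have := C.ν_pos; unfold κ; linarith

theorem continuous_ph : Continuous (fun p : (Euc N × ℝ) × Euc N => C.ph p.1 p.2) := by
  have := C.continuous_Q
  unfold ph
  fun_prop

theorem ph_pos (q z) : 0 < C.ph q z := Real.exp_pos _

theorem ph_le (q : Euc N × ℝ) (z : Euc N) : C.ph q z ≤ Real.exp (-(2 * C.κ) * ‖z‖ ^ 2) := by
  apply Real.exp_le_exp.2
  have := C.Q_pos q z
  have := C.ν_pos
  unfold κ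
  nlinarith [sq_nonneg ‖z‖]

theorem le_ph (q : Euc N × ℝ) (z : Euc N) : Real.exp (-C.Λ * ‖z‖ ^ 2) ≤ C.ph q z := by
  apply Real.exp_le_exp.2
  have h1 : inner ℝ z (C.Q q z) ≤ ‖z‖ * (C.Λ * ‖z‖) :=
    (real_inner_le_norm _ _).trans (mul_le_mul_of_nonneg_left
      ((C.Q q).le_of_opNorm_le (C.Q_le q) z) (norm_nonneg z))
  have := C.Λ_pos
  nlinarith [mul_nonneg this.le (sq_nonneg ‖z‖)]

theorem norm_Q_apply_le (q : Euc N × ℝ) (z : Euc N) : ‖C.Q q z‖ ≤ C.Λ * ‖z‖ :=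
  (C.Q q).le_of_opNorm_le (C.Q_le q) z

theorem norm_Q_sub_le (q q' : Euc N × ℝ) (z w : Euc N) :
    ‖C.Q q (z + w) - C.Q q' z‖ ≤ C.Λ * (‖q - q'‖ + ‖w‖) * (1 + ‖z‖) := by
  have h1 : C.Q q (z + w) - C.Q q' z = (C.Q q - C.Q q') z + C.Q q w := by
    simp; abel
  rw [h1]
  have h2 := (C.Q q - C.Q q').le_of_opNorm_le (C.Q_lip q q') z
  have h3 := C.norm_Q_apply_le q w
  have := C.Λ_pos
  calc _ ≤ C.Λ * ‖q - q'‖ * ‖z‖ + C.Λ * ‖w‖ := (norm_add_le _ _).trans (add_le_add h2 h3)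
    _ ≤ _ := by
      have : 0 ≤ C.Λ * ‖q - q'‖ := by positivity
      have : 0 ≤ C.Λ * ‖w‖ * ‖z‖ := by positivity
      nlinarith

theorem abs_ph_sub_le (q q' : Euc N × ℝ) (z w : Euc N) (hw : ‖w‖ ≤ 1) :
    |C.ph q (z + w) - C.ph q' z| ≤
      (2 * C.Λ * Real.exp C.ν) * (‖q - q'‖ + ‖w‖) * (1 + ‖z‖) ^ 2 *
        Real.exp (-(2 * C.κ) * ‖z‖ ^ 2) := by
  have hΛ := C.Λ_pos
  have hν := C.ν_pos
  have hz : ‖z‖ ≤ ‖z + w‖ + ‖w‖ := by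
    have := norm_sub_le (z + w) w
    simpa using this
  have hz' : ‖z + w‖ ≤ ‖z‖ + ‖w‖ := norm_add_le z w
  have h0 := norm_nonneg z
  have h0' := norm_nonneg w
  have h1 : 2 * C.κ * ‖z‖ ^ 2 - C.ν ≤ inner ℝ (z + w) (C.Q q (z + w)) / 2 := by
    have h2 := C.Q_pos q (z + w)
    have h3 : ‖z‖ ^ 2 ≤ 2 * ‖z + w‖ ^ 2 + 2 := by
      nlinarith [sq_nonneg (‖z + w‖ - ‖w‖), norm_nonneg (z + w)]
    unfold κ
    nlinarith
  have h2 : 2 * C.κ * ‖z‖ ^ 2 - C.ν ≤ inner ℝ z (C.Q q' z) / 2 := by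
    have h2 := C.Q_pos q' z
    unfold κ
    nlinarith [sq_nonneg ‖z‖, mul_nonneg hν.le (sq_nonneg ‖z‖)]
  have h3 := abs_exp_neg_sub_exp_neg_le h1 h2
  have h4 : inner ℝ (z + w) (C.Q q (z + w)) - inner ℝ z (C.Q q' z) =
      inner ℝ (z + w) (C.Q q (z + w) - C.Q q' z) + inner ℝ w (C.Q q' z) := by
    rw [inner_sub_right, inner_add_left, inner_add_left]; ring
  have h5 : |inner ℝ (z + w) (C.Q q (z + w)) - inner ℝ z (C.Q q' z)| ≤
      4 * C.Λ * (‖q - q'‖ + ‖w‖) * (1 + ‖z‖) ^ 2 := by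
    rw [h4]
    have e1 := abs_real_inner_le_norm (z + w) (C.Q q (z + w) - C.Q q' z)
    have e2 := abs_real_inner_le_norm w (C.Q q' z)
    have e3 := C.norm_Q_sub_le q q' z w
    have e4 := C.norm_Q_apply_le q' z
    calc _ ≤ ‖z + w‖ * ‖C.Q q (z + w) - C.Q q' z‖ + ‖w‖ * ‖C.Q q' z‖ :=
          (abs_add_le _ _).trans (add_le_add e1 e2)
      _ ≤ (1 + ‖z‖) * (C.Λ * (‖q - q'‖ + ‖w‖) * (1 + ‖z‖)) + ‖w‖ * (C.Λ * ‖z‖) := by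
          gcongr; linarith
      _ ≤ _ := by
          have : 0 ≤ C.Λ * ‖q - q'‖ := by positivity
          have : 0 ≤ C.Λ * ‖w‖ := by positivity
          nlinarith [mul_nonneg this h0, mul_nonneg this (sq_nonneg ‖z‖)
            , mul_nonneg ‹0 ≤ C.Λ * ‖q - q'‖› (sq_nonneg (1 + ‖z‖))]
  calc _ ≤ _ := h3
    _ = |inner ℝ (z + w) (C.Q q (z + w)) - inner ℝ z (C.Q q' z)| / 2 *
        (Real.exp C.ν * Real.exp (-(2 * C.κ) * ‖z‖ ^ 2)) := by
        rw [← Real.exp_add, ← sub_div, abs_div, abs_two]; ring_nf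
    _ ≤ (4 * C.Λ * (‖q - q'‖ + ‖w‖) * (1 + ‖z‖) ^ 2) / 2 *
        (Real.exp C.ν * Real.exp (-(2 * C.κ) * ‖z‖ ^ 2)) := by gcongr
    _ = _ := by ring

/-- The normalising constant of the Gaussian `ph`. -/
def c (q : Euc N × ℝ) : ℝ := (∫ z, C.ph q z)⁻¹

theorem integrable_ph (q : Euc N × ℝ) : Integrable (C.ph q) := by
  have h1 : Continuous (C.ph q) := by
    unfold ph
    fun_prop
  have h2 : 0 < 2 * C.κ := by linarith [C.κ_pos]
  refine (integrable_gauss h2).mono' h1.aestronglyMeasurable (Filter.Eventually.of_forall fun z => ?_)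
  rw [Real.norm_of_nonneg (C.ph_pos q z).le]
  exact C.ph_le q z

theorem exists_c_bounds : ∃ M, 0 ≤ M ∧ (∀ q, 0 < C.c q) ∧ (∀ q, C.c q ≤ M) ∧
    ∀ q q', |C.c q - C.c q'| ≤ M * ‖q - q'‖ := by
  set m := ∫ z : Euc N, Real.exp (-C.Λ * ‖z‖ ^ 2) with hm
  have hm0 : 0 < m := by
    rw [hm, GaussianFourier.integral_rexp_neg_mul_sq_norm C.Λ_pos]
    have := C.Λ_pos
    positivity
  have h1 : ∀ q, m ≤ ∫ z, C.ph q z := fun q =>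
    integral_mono (integrable_gauss C.Λ_pos) (C.integrable_ph q) (C.le_ph q)
  set G := ∫ z : Euc N, Real.exp (-C.κ * ‖z‖ ^ 2)
  have hG : 0 ≤ G := integral_nonneg fun z => (Real.exp_pos _).le
  set D := (2 * C.Λ * Real.exp C.ν) * Real.exp (((2 : ℕ) : ℝ) ^ 2 / (4 * C.κ)) * G with hD
  have hD0 : 0 ≤ D := by have := C.Λ_pos; positivity
  have h2 : ∀ q q', |(∫ z, C.ph q z) - ∫ z, C.ph q' z| ≤ D * ‖q - q'‖ := by
    intro q q'
    rw [← integral_sub (C.integrable_ph q) (C.integrable_ph q')]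
    have := norm_integral_gauss_le (φ := fun z => C.ph q z - C.ph q' z)
      (C := (2 * C.Λ * Real.exp C.ν) * ‖q - q'‖ * Real.exp (((2 : ℕ) : ℝ) ^ 2 / (4 * C.κ)))
      C.κ_pos (fun z => by
        have := C.abs_ph_sub_le q q' z 0 (by simp)
        simp only [add_zero, norm_zero] at this
        refine this.trans ?_
        have h3 := one_add_pow_mul_gauss_le 2 C.κ_pos (norm_nonneg z)
        have h4 : 0 ≤ 2 * C.Λ * Real.exp C.ν * ‖q - q'‖ := by have := C.Λ_pos; positivity
        have := mul_le_mul_of_nonneg_left h3 h4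
        linarith)
    refine this.trans (le_of_eq ?_)
    rw [hD]; ring
  refine ⟨max m⁻¹ (D / m ^ 2), by positivity, fun q => inv_pos.2 (hm0.trans_le (h1 q)),
    fun q => (inv_anti₀ hm0 (h1 q)).trans (le_max_left _ _), fun q q' => ?_⟩
  have a1 := hm0.trans_le (h1 q)
  have a2 := hm0.trans_le (h1 q')
  have : C.c q - C.c q' = ((∫ z, C.ph q' z) - ∫ z, C.ph q z) /
      ((∫ z, C.ph q z) * ∫ z, C.ph q' z) := by
    unfold c; field_simp
  rw [this, abs_div, abs_of_pos (mul_pos a1 a2)]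
  calc _ ≤ D * ‖q - q'‖ / (m * m) := by
        gcongr
        · rw [norm_sub_rev]; exact h2 q' q
        · exact h1 q
        · exact h1 q'
    _ = D / m ^ 2 * ‖q - q'‖ := by ring
    _ ≤ _ := by gcongr; exact le_max_right _ _

/-- The normalised Gaussian kernel. -/
def p0 (q : Euc N × ℝ) (z : Euc N) : ℝ := C.c q * C.ph q z

/-- Minus the gradient of `p0`. -/
def p1 (q : Euc N × ℝ) (z : Euc N) : Euc N := C.p0 q z • C.Q q z

/-- The Hessian of `p0`. -/
def p2 (q : Euc N × ℝ) (z : Euc N) : Euc N →L[ℝ] Euc N :=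
  C.p0 q z • (InnerProductSpace.rankOne ℝ (C.Q q z) (C.Q q z) - C.Q q)

theorem continuous_c : Continuous C.c := by
  obtain ⟨M, hM, -, -, h⟩ := C.exists_c_bounds
  have h : LipschitzWith M.toNNReal C.c := by
    refine LipschitzWith.of_dist_le_mul fun q q' => ?_
    rw [dist_eq_norm, dist_eq_norm, Real.coe_toNNReal _ hM]
    exact h q q'
  exact h.continuous

theorem continuous_p0 : Continuous (fun p : (Euc N × ℝ) × Euc N => C.p0 p.1 p.2) := by
  have := C.continuous_ph
  have := C.continuous_c
  unfold p0
  fun_prop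

theorem continuous_p1 : Continuous (fun p : (Euc N × ℝ) × Euc N => C.p1 p.1 p.2) := by
  have := C.continuous_p0
  have := C.continuous_Q
  unfold p1
  fun_prop

theorem continuous_p2 : Continuous (fun p : (Euc N × ℝ) × Euc N => C.p2 p.1 p.2) := by
  have := C.continuous_p0
  have hQ := C.continuous_Q
  have h1 : Continuous (fun p : (Euc N × ℝ) × Euc N => C.Q p.1 p.2) := by fun_prop
  have : Continuous (fun p : (Euc N × ℝ) × Euc N =>
      InnerProductSpace.rankOne ℝ (C.Q p.1 p.2) (C.Q p.1 p.2)) :=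
    ((InnerProductSpace.rankOne ℝ).continuous.comp h1).clm_apply h1
  unfold p2
  fun_prop

theorem continuous_p0_comp {X : Type*} [TopologicalSpace X] {a : X → Euc N × ℝ} {b : X → Euc N}
    (ha : Continuous a) (hb : Continuous b) : Continuous fun x => C.p0 (a x) (b x) :=
  Continuous.comp (g := fun p : (Euc N × ℝ) × Euc N => C.p0 p.1 p.2) (f := fun x => (a x, b x))
    C.continuous_p0 (ha.prodMk hb)

theorem continuous_p1_comp {X : Type*} [TopologicalSpace X] {a : X → Euc N × ℝ} {b : X → Euc N}
    (ha : Continuous a) (hb : Continuous b) : Continuous fun x => C.p1 (a x) (b x) :=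
  Continuous.comp (g := fun p : (Euc N × ℝ) × Euc N => C.p1 p.1 p.2) (f := fun x => (a x, b x))
    C.continuous_p1 (ha.prodMk hb)

theorem continuous_p2_comp {X : Type*} [TopologicalSpace X] {a : X → Euc N × ℝ} {b : X → Euc N}
    (ha : Continuous a) (hb : Continuous b) : Continuous fun x => C.p2 (a x) (b x) :=
  Continuous.comp (g := fun p : (Euc N × ℝ) × Euc N => C.p2 p.1 p.2) (f := fun x => (a x, b x))
    C.continuous_p2 (ha.prodMk hb)

end Coef

/-- Products of a scalar kernel of polynomial-Gaussian type with a polynomially growing factor. -/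
theorem norm_smul_sub_smul_le {F : Type*} [NormedAddCommGroup F] [NormedSpace ℝ F]
    {p p' : ℝ} {v v' : F} {A B d r E : ℝ} {m n : ℕ} (hA : 0 ≤ A) (hr : 0 ≤ r)
    (hd : 0 ≤ d) (hE : 0 ≤ E)
    (hp' : |p'| ≤ A * (1 + r) ^ m * E) (hv : ‖v‖ ≤ B * (1 + r) ^ n)
    (hp : |p - p'| ≤ A * d * (1 + r) ^ m * E) (hvv : ‖v - v'‖ ≤ B * d * (1 + r) ^ n) :
    ‖p • v - p' • v'‖ ≤ 2 * A * B * d * (1 + r) ^ (m + n) * E := by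
  have h1 : p • v - p' • v' = (p - p') • v + p' • (v - v') := by
    rw [sub_smul, smul_sub]; abel
  rw [h1]
  refine (norm_add_le _ _).trans ?_
  rw [norm_smul, norm_smul, Real.norm_eq_abs, Real.norm_eq_abs]
  calc _ ≤ (A * d * (1 + r) ^ m * E) * (B * (1 + r) ^ n) +
        (A * (1 + r) ^ m * E) * (B * d * (1 + r) ^ n) := by gcongr
    _ = _ := by ring

namespace Coef

variable {N : ℕ} (C : Coef N)

theorem exists_p0_poly : ∃ A, 0 ≤ A ∧
    (∀ q z, |C.p0 q z| ≤ A * (1 + ‖z‖) ^ 2 * Real.exp (-(2 * C.κ) * ‖z‖ ^ 2)) ∧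
    (∀ q q' z w, ‖w‖ ≤ 1 → |C.p0 q (z + w) - C.p0 q' z| ≤
      A * (‖q - q'‖ + ‖w‖) * (1 + ‖z‖) ^ 2 * Real.exp (-(2 * C.κ) * ‖z‖ ^ 2)) := by
  obtain ⟨M, hM, h0, hM1, hM2⟩ := C.exists_c_bounds
  have hΛ := C.Λ_pos
  set D := 2 * C.Λ * Real.exp C.ν with hD
  have hD0 : 0 ≤ D := by positivity
  have h1 : ∀ q z, |C.p0 q z| ≤ M * Real.exp (-(2 * C.κ) * ‖z‖ ^ 2) := by
    intro q z
    unfold p0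
    rw [abs_mul, abs_of_pos (h0 q), abs_of_pos (C.ph_pos q z)]
    exact mul_le_mul (hM1 q) (C.ph_le q z) (C.ph_pos q z).le hM
  have hone : ∀ z : Euc N, 1 ≤ (1 + ‖z‖) ^ 2 := fun z => by
    have := norm_nonneg z; nlinarith
  refine ⟨M * D + M, by positivity, fun q z => (h1 q z).trans ?_, fun q q' z w hw => ?_⟩
  · gcongr
    have := mul_nonneg hM hD0
    nlinarith [hone z]
  · have e1 : C.p0 q (z + w) - C.p0 q' z =
        C.c q * (C.ph q (z + w) - C.ph q' z) + (C.c q - C.c q') * C.ph q' z := by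
      unfold p0; ring
    rw [e1]
    refine (abs_add_le _ _).trans ?_
    rw [abs_mul, abs_mul, abs_of_pos (h0 q), abs_of_pos (C.ph_pos q' z)]
    have e2 := C.abs_ph_sub_le q q' z w hw
    have e3 := C.ph_le q' z
    calc _ ≤ M * (D * (‖q - q'‖ + ‖w‖) * (1 + ‖z‖) ^ 2 * Real.exp (-(2 * C.κ) * ‖z‖ ^ 2)) +
          (M * ‖q - q'‖) * Real.exp (-(2 * C.κ) * ‖z‖ ^ 2) := by
          gcongr
          · exact hM1 q
          · exact (C.ph_pos q' z).le
          · exact hM2 q q'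
      _ ≤ M * (D * (‖q - q'‖ + ‖w‖) * (1 + ‖z‖) ^ 2 * Real.exp (-(2 * C.κ) * ‖z‖ ^ 2)) +
          (M * ((‖q - q'‖ + ‖w‖) * (1 + ‖z‖) ^ 2)) * Real.exp (-(2 * C.κ) * ‖z‖ ^ 2) := by
          gcongr
          have := norm_nonneg w
          have := norm_nonneg (q - q')
          nlinarith [hone z]
      _ = _ := by ring

theorem exists_isGaussKernel : ∃ M, 0 ≤ M ∧ IsGaussKernel C.κ M C.p0 ∧
    IsGaussKernel C.κ M C.p1 ∧ IsGaussKernel C.κ M C.p2 := by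
  obtain ⟨A, hA, h1, h2⟩ := C.exists_p0_poly
  have hΛ := C.Λ_pos
  have hz : ∀ z w : Euc N, ‖w‖ ≤ 1 → ‖z + w‖ ≤ 1 + ‖z‖ := fun z w hw => by
    linarith [norm_add_le z w]
  have hone : ∀ z : Euc N, 1 ≤ (1 + ‖z‖) ^ 2 := fun z => by
    have := norm_nonneg z; nlinarith
  have k0 := IsGaussKernel.of_poly C.κ_pos C.continuous_p0 (m := 2) hA h1 h2
  have hb1 : ∀ q z w, ‖w‖ ≤ 1 → ‖C.Q q (z + w)‖ ≤ C.Λ * (1 + ‖z‖) ^ 1 := fun q z w hw => by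
    rw [pow_one]
    exact (C.norm_Q_apply_le q _).trans (by gcongr; exact hz z w hw)
  have k1 : ∃ M, IsGaussKernel C.κ M C.p1 := by
    refine IsGaussKernel.of_poly C.κ_pos C.continuous_p1 (m := 2 + 1) (C := 2 * A * C.Λ)
      (by positivity) (fun q z => ?_) (fun q q' z w hw => ?_)
    · unfold p1
      rw [norm_smul, Real.norm_eq_abs]
      have e1 := hb1 q z 0 (by simp)
      rw [add_zero] at e1
      calc _ ≤ (A * (1 + ‖z‖) ^ 2 * Real.exp (-(2 * C.κ) * ‖z‖ ^ 2)) * (C.Λ * (1 + ‖z‖) ^ 1) :=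
            mul_le_mul (h1 q z) e1 (norm_nonneg _) (by positivity)
        _ = 1 * A * C.Λ * (1 + ‖z‖) ^ (2 + 1) * Real.exp (-(2 * C.κ) * ‖z‖ ^ 2) := by ring
        _ ≤ _ := by gcongr; norm_num
    · refine norm_smul_sub_smul_le hA (norm_nonneg z) (by positivity) (Real.exp_pos _).le
        (h1 q' z) (hb1 q z w hw) (h2 q q' z w hw) ?_
      rw [pow_one]
      exact C.norm_Q_sub_le q q' z w
  have hb2 : ∀ q z w, ‖w‖ ≤ 1 → ‖InnerProductSpace.rankOne ℝ (C.Q q (z + w)) (C.Q q (z + w)) -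
      C.Q q‖ ≤ (2 * C.Λ ^ 2 + C.Λ) * (1 + ‖z‖) ^ 2 := fun q z w hw => by
    refine (norm_sub_le _ _).trans ?_
    rw [InnerProductSpace.norm_rankOne]
    have e1 := hb1 q z w hw
    rw [pow_one] at e1
    calc _ ≤ (C.Λ * (1 + ‖z‖)) * (C.Λ * (1 + ‖z‖)) + C.Λ :=
          add_le_add (mul_le_mul e1 e1 (norm_nonneg _) (by positivity)) (C.Q_le q)
      _ ≤ _ := by nlinarith [hone z, mul_nonneg (sq_nonneg C.Λ) (sq_nonneg (1 + ‖z‖))]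
  have hl2 : ∀ q q' z w, ‖w‖ ≤ 1 →
      ‖(InnerProductSpace.rankOne ℝ (C.Q q (z + w)) (C.Q q (z + w)) - C.Q q) -
        (InnerProductSpace.rankOne ℝ (C.Q q' z) (C.Q q' z) - C.Q q')‖ ≤
      (2 * C.Λ ^ 2 + C.Λ) * (‖q - q'‖ + ‖w‖) * (1 + ‖z‖) ^ 2 := fun q q' z w hw => by
    have e0 : (InnerProductSpace.rankOne ℝ (C.Q q (z + w)) (C.Q q (z + w)) - C.Q q) -
        (InnerProductSpace.rankOne ℝ (C.Q q' z) (C.Q q' z) - C.Q q') =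
        InnerProductSpace.rankOne ℝ (C.Q q (z + w) - C.Q q' z) (C.Q q (z + w)) +
        InnerProductSpace.rankOne ℝ (C.Q q' z) (C.Q q (z + w) - C.Q q' z) -
        (C.Q q - C.Q q') := by
      ext1 v
      simp only [_root_.add_apply, _root_.sub_apply, InnerProductSpace.rankOne_apply,
        inner_sub_left, sub_smul, smul_sub]
      abel
    rw [e0]
    have e1 := hb1 q z w hw
    have e2 := hb1 q' z 0 (by simp)
    rw [add_zero] at e2
    rw [pow_one] at e1 e2
    have e3 := C.norm_Q_sub_le q q' z w
    refine (norm_sub_le _ _).trans ?_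
    refine (add_le_add (norm_add_le _ _) (C.Q_lip q q')).trans ?_
    rw [InnerProductSpace.norm_rankOne, InnerProductSpace.norm_rankOne]
    have hd : 0 ≤ ‖q - q'‖ + ‖w‖ := by positivity
    calc _ ≤ (C.Λ * (‖q - q'‖ + ‖w‖) * (1 + ‖z‖)) * (C.Λ * (1 + ‖z‖)) +
          (C.Λ * (1 + ‖z‖)) * (C.Λ * (‖q - q'‖ + ‖w‖) * (1 + ‖z‖)) +
          C.Λ * (‖q - q'‖ + ‖w‖) := by
          gcongr
          linarith [norm_nonneg w]
      _ ≤ _ := by nlinarith [mul_nonneg (mul_nonneg hΛ.le hd) (sub_nonneg.2 (hone z))]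
  have k2 : ∃ M, IsGaussKernel C.κ M C.p2 := by
    refine IsGaussKernel.of_poly C.κ_pos C.continuous_p2 (m := 2 + 2)
      (C := 2 * A * (2 * C.Λ ^ 2 + C.Λ))
      (by positivity) (fun q z => ?_) (fun q q' z w hw => ?_)
    · unfold p2
      rw [norm_smul, Real.norm_eq_abs]
      have e1 := hb2 q z 0 (by simp)
      rw [add_zero] at e1
      calc _ ≤ (A * (1 + ‖z‖) ^ 2 * Real.exp (-(2 * C.κ) * ‖z‖ ^ 2)) *
            ((2 * C.Λ ^ 2 + C.Λ) * (1 + ‖z‖) ^ 2) :=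
            mul_le_mul (h1 q z) e1 (norm_nonneg _) (by positivity)
        _ = 1 * A * (2 * C.Λ ^ 2 + C.Λ) * (1 + ‖z‖) ^ (2 + 2) *
            Real.exp (-(2 * C.κ) * ‖z‖ ^ 2) := by ring
        _ ≤ _ := by gcongr; norm_num
    · exact norm_smul_sub_smul_le hA (norm_nonneg z) (by positivity) (Real.exp_pos _).le
        (h1 q' z) (hb2 q z w hw) (h2 q q' z w hw) (hl2 q q' z w hw)
  obtain ⟨M0, k0⟩ := k0
  obtain ⟨M1, k1⟩ := k1
  obtain ⟨M2, k2⟩ := k2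
  have mono : ∀ {F : Type} [NormedAddCommGroup F] {k : Euc N × ℝ → Euc N → F} {M M' : ℝ},
      IsGaussKernel C.κ M k → M ≤ M' → IsGaussKernel C.κ M' k := by
    intro F _ k M M' hk hM
    exact ⟨hk.cont, fun q z => (hk.bound q z).trans (by gcongr),
      fun q q' z w hw => (hk.lip q q' z w hw).trans (by gcongr)⟩
  refine ⟨max 0 (max M0 (max M1 M2)), le_max_left _ _, mono k0 ?_, mono k1 ?_, mono k2 ?_⟩ <;> simp

/-- A common constant for the three kernels. -/
def M : ℝ := C.exists_isGaussKernel.choose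

theorem M_nonneg : 0 ≤ C.M := C.exists_isGaussKernel.choose_spec.1

theorem gk0 : IsGaussKernel C.κ C.M C.p0 := C.exists_isGaussKernel.choose_spec.2.1

theorem gk1 : IsGaussKernel C.κ C.M C.p1 := C.exists_isGaussKernel.choose_spec.2.2.1

theorem gk2 : IsGaussKernel C.κ C.M C.p2 := C.exists_isGaussKernel.choose_spec.2.2.2

theorem integral_p0 (q : Euc N × ℝ) : ∫ z, C.p0 q z = 1 := by
  obtain ⟨M, hM, h0, -, -⟩ := C.exists_c_bounds
  unfold p0
  rw [integral_const_mul]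
  have := h0 q
  unfold c at this ⊢
  exact inv_mul_cancel₀ (inv_pos.1 this).ne'

theorem hasFDerivAt_p0 (q : Euc N × ℝ) (z : Euc N) :
    HasFDerivAt (C.p0 q) (-(innerSL ℝ (C.p1 q z))) z := by
  have h1 : HasFDerivAt (fun z => inner ℝ z (C.Q q z)) _ z :=
    (hasFDerivAt_id z).inner ℝ (C.Q q).hasFDerivAt
  have h2 := (((h1.const_mul (1 / 2)).neg.exp).const_mul (C.c q))
  have e : C.p0 q = fun z => C.c q * Real.exp (-(1 / 2 * inner ℝ z (C.Q q z))) := by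
    ext z; simp only [p0, ph]; ring_nf
  rw [e]
  refine HasFDerivAt.congr_fderiv h2 ?_
  ext v
  have := C.Q_symm q z v
  have h3 : inner ℝ v (C.Q q z) = inner ℝ z (C.Q q v) := by rw [← this, real_inner_comm]
  simp [p1, e, h3, this]
  ring

theorem hasFDerivAt_p1 (q : Euc N × ℝ) (z : Euc N) :
    HasFDerivAt (C.p1 q) (-(C.p2 q z)) z := by
  have h2 := (C.hasFDerivAt_p0 q z).smul (C.Q q).hasFDerivAt
  refine HasFDerivAt.congr_fderiv h2 ?_
  ext1 v
  simp [p1, p2, smul_smul, sub_eq_add_neg]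

theorem tr_p2 (q : Euc N × ℝ) (z : Euc N) :
    C.tr q (C.p2 q z) = C.p0 q z * (inner ℝ z (C.Q q z) - N) := by
  simp [p2, C.tr_rankOne, C.tr_Q]

end Coef

/-! ### Spatial integrals against Gaussian kernels -/

/-- The space-time point reached from `q` after time `τ` with normalised displacement `z`. -/
def shiftPt {N : ℕ} (q : Euc N × ℝ) (τ : ℝ) (z : Euc N) : Euc N × ℝ := (q.1 + √τ • z, q.2 + τ)

/-- The integral of `f` against the rescaled kernel `k`. -/
def gint {N : ℕ} {F : Type*} [NormedAddCommGroup F] [NormedSpace ℝ F]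
    (k : Euc N × ℝ → Euc N → F) (f : Euc N × ℝ → ℝ) (q : Euc N × ℝ) (τ : ℝ) : F :=
  ∫ z, f (shiftPt q τ z) • k (shiftPt q τ z) z

/-- The total mass of the reference Gaussian. -/
def gaussMass (N : ℕ) (κ : ℝ) : ℝ := ∫ z : Euc N, Real.exp (-κ * ‖z‖ ^ 2)

theorem gaussMass_nonneg (N : ℕ) (κ : ℝ) : 0 ≤ gaussMass N κ :=
  integral_nonneg fun _ => (Real.exp_pos _).le

section Gint

variable {N : ℕ} {F : Type*} [NormedAddCommGroup F] [NormedSpace ℝ F]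
  {κ M B : ℝ} {k : Euc N × ℝ → Euc N → F} {f : Euc N × ℝ → ℝ}

theorem continuous_shiftPt :
    Continuous (fun p : ((Euc N × ℝ) × ℝ) × Euc N => shiftPt p.1.1 p.1.2 p.2) := by
  unfold shiftPt
  fun_prop

theorem IsGaussKernel.norm_le (hk : IsGaussKernel κ M k) (q z) :
    ‖k q z‖ ≤ M * Real.exp (-κ * ‖z‖ ^ 2) := by
  have h1 := hk.bound q z
  have h2 := norm_nonneg z
  have h3 := norm_nonneg (k q z)
  nlinarith [mul_nonneg h2 h3, mul_nonneg (sq_nonneg ‖z‖) h3]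

theorem IsGaussKernel.nonneg (hk : IsGaussKernel κ M k) : 0 ≤ M := by
  have := (norm_nonneg _).trans (hk.norm_le 0 0)
  simpa using this

theorem continuous_gint_integrand (hk : Continuous (fun p : (Euc N × ℝ) × Euc N => k p.1 p.2))
    (hf : Continuous f) : Continuous (fun p : ((Euc N × ℝ) × ℝ) × Euc N =>
      f (shiftPt p.1.1 p.1.2 p.2) • k (shiftPt p.1.1 p.1.2 p.2) p.2) :=
  (hf.comp continuous_shiftPt).smul (hk.comp (continuous_shiftPt.prodMk continuous_snd))

theorem IsGaussKernel.norm_smul_le (hk : IsGaussKernel κ M k) (hb : ∀ q, |f q| ≤ B)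
    (q z) : ‖f q • k q z‖ ≤ (B * M) * Real.exp (-κ * ‖z‖ ^ 2) := by
  rw [norm_smul, mul_assoc]
  have := hk.norm_le q z
  exact mul_le_mul (hb q) this (norm_nonneg _) ((abs_nonneg _).trans (hb q))

theorem continuous_gint (hk : IsGaussKernel κ M k) (hκ : 0 < κ) (hf : Continuous f)
    (hb : ∀ q, |f q| ≤ B) : Continuous (fun p : (Euc N × ℝ) × ℝ => gint k f p.1 p.2) :=
  continuous_integral_gauss
    (φ := fun (p : (Euc N × ℝ) × ℝ) z => f (shiftPt p.1 p.2 z) • k (shiftPt p.1 p.2 z) z)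
    (continuous_gint_integrand hk.cont hf) hκ (fun p z => hk.norm_smul_le hb _ z)

theorem norm_gint_le (hk : IsGaussKernel κ M k) (hκ : 0 < κ)
    (hb : ∀ q, |f q| ≤ B) (q : Euc N × ℝ) (τ : ℝ) : ‖gint k f q τ‖ ≤ B * M * gaussMass N κ :=
  norm_integral_gauss_le hκ (fun z => hk.norm_smul_le hb _ z)

theorem integrable_gint (hk : IsGaussKernel κ M k) (hκ : 0 < κ) (hf : Continuous f)
    (hb : ∀ q, |f q| ≤ B) (q : Euc N × ℝ) (τ : ℝ) :
    Integrable (fun z => f (shiftPt q τ z) • k (shiftPt q τ z) z) :=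
  integrable_of_gauss ((continuous_gint_integrand hk.cont hf).comp
    (Continuous.prodMk_right (q, τ))) hκ (fun z => hk.norm_smul_le hb _ z)

theorem gint_sub (hk : IsGaussKernel κ M k) (hκ : 0 < κ) {g : Euc N × ℝ → ℝ} (hf : Continuous f)
    (hg : Continuous g) {B' : ℝ} (hb : ∀ q, |f q| ≤ B) (hb' : ∀ q, |g q| ≤ B') (q τ) :
    gint k (fun q => f q - g q) q τ = gint k f q τ - gint k g q τ := by
  unfold gint
  rw [← integral_sub (integrable_gint hk hκ hf hb q τ) (integrable_gint hk hκ hg hb' q τ)]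
  simp only [sub_smul]

theorem shiftPt_add (x x' : Euc N) (t : ℝ) {τ : ℝ} (hτ : 0 < τ) (z : Euc N) :
    shiftPt (x, t) τ (z + (√τ)⁻¹ • (x' - x)) = shiftPt (x', t) τ z := by
  have : √τ ≠ 0 := (Real.sqrt_pos.2 hτ).ne'
  simp only [shiftPt, smul_add, smul_smul, mul_inv_cancel₀ this, one_smul, Prod.mk.injEq, and_true]
  abel

theorem gint_eq_shift (x x' : Euc N) (t : ℝ) {τ : ℝ} (hτ : 0 < τ) :
    gint k f (x, t) τ = ∫ z, f (shiftPt (x', t) τ z) •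
      k (shiftPt (x', t) τ z) (z + (√τ)⁻¹ • (x' - x)) := by
  unfold gint
  rw [← integral_add_right_eq_self _ ((√τ)⁻¹ • (x' - x))]
  simp only [shiftPt_add x x' t hτ]

theorem IsGaussKernel.norm_shift_le (hk : IsGaussKernel κ M k) (q z) {w : Euc N} (hw : ‖w‖ ≤ 1) :
    (1 + ‖z‖) ^ 2 * ‖k q (z + w)‖ ≤ 2 * M * Real.exp (-κ * ‖z‖ ^ 2) := by
  have h1 := hk.lip q q z w hw
  have h2 := hk.bound q z
  have h3 : ‖k q (z + w)‖ ≤ ‖k q (z + w) - k q z‖ + ‖k q z‖ := by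
    simpa using norm_add_le (k q (z + w) - k q z) (k q z)
  rw [sub_self, norm_zero, zero_add] at h1
  have hM := hk.nonneg
  calc _ ≤ (1 + ‖z‖) ^ 2 * (‖k q (z + w) - k q z‖ + ‖k q z‖) := by gcongr
    _ ≤ M * ‖w‖ * Real.exp (-κ * ‖z‖ ^ 2) + M * Real.exp (-κ * ‖z‖ ^ 2) := by
        rw [mul_add]; exact add_le_add h1 h2
    _ ≤ M * 1 * Real.exp (-κ * ‖z‖ ^ 2) + M * Real.exp (-κ * ‖z‖ ^ 2) := by gcongr
    _ = _ := by ring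

theorem norm_inv_sqrt_smul (x x' : Euc N) {τ : ℝ} :
    ‖(√τ)⁻¹ • (x' - x)‖ = ‖x - x'‖ / √τ := by
  rw [norm_smul, Real.norm_of_nonneg (by positivity), norm_sub_rev]; field_simp

theorem integrable_shift (hk : IsGaussKernel κ M k) (hκ : 0 < κ) (hf : Continuous f)
    (hb : ∀ q, |f q| ≤ B) (q : Euc N × ℝ) (τ : ℝ) {w : Euc N} (hw : ‖w‖ ≤ 1) :
    Integrable (fun z => f (shiftPt q τ z) • k (shiftPt q τ z) (z + w)) := by
  have h1 : Continuous fun z => shiftPt q τ z :=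
    continuous_shiftPt.comp (Continuous.prodMk_right (q, τ))
  have h2 : Continuous fun z => k (shiftPt q τ z) (z + w) :=
    hk.cont.comp (h1.prodMk (by fun_prop))
  refine integrable_of_gauss ((hf.comp h1).smul h2) hκ (C := B * (2 * M)) fun z => ?_
  rw [norm_smul, mul_assoc]
  refine mul_le_mul (hb _) ?_ (norm_nonneg _) ((abs_nonneg _).trans (hb 0))
  refine le_trans ?_ (hk.norm_shift_le (shiftPt q τ z) z hw)
  have := norm_nonneg (k (shiftPt q τ z) (z + w))
  have := norm_nonneg z
  nlinarith [mul_nonneg this ‹0 ≤ ‖k (shiftPt q τ z) (z + w)‖›, sq_nonneg ‖z‖,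
    mul_nonneg (sq_nonneg ‖z‖) ‹0 ≤ ‖k (shiftPt q τ z) (z + w)‖›]

theorem norm_gint_sub_le (hk : IsGaussKernel κ M k) (hκ : 0 < κ) (hf : Continuous f)
    (hb : ∀ q, |f q| ≤ B) (x x' : Euc N) (t : ℝ) {τ : ℝ} (hτ : 0 < τ) (hx : ‖x - x'‖ ≤ √τ) :
    ‖gint k f (x, t) τ - gint k f (x', t) τ‖ ≤ B * M * gaussMass N κ * (‖x - x'‖ / √τ) := by
  have hw : ‖(√τ)⁻¹ • (x' - x)‖ ≤ 1 := by
    rw [norm_inv_sqrt_smul]; exact div_le_one_of_le₀ hx (Real.sqrt_nonneg _)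
  rw [gint_eq_shift x x' t hτ]
  unfold gint
  rw [← integral_sub (integrable_shift hk hκ hf hb _ τ hw) (integrable_gint hk hκ hf hb _ τ)]
  refine (norm_integral_gauss_le hκ (C := B * M * (‖x - x'‖ / √τ)) fun z => ?_).trans
    (le_of_eq (by unfold gaussMass; ring))
  rw [← smul_sub, norm_smul]
  have h1 := hk.lip (shiftPt (x', t) τ z) (shiftPt (x', t) τ z) z _ hw
  rw [sub_self, norm_zero, zero_add, norm_inv_sqrt_smul] at h1
  have hB := (abs_nonneg _).trans (hb 0)
  calc _ ≤ B * (M * (‖x - x'‖ / √τ) * Real.exp (-κ * ‖z‖ ^ 2)) := by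
        refine mul_le_mul (hb _) (le_trans ?_ h1) (norm_nonneg _) hB
        refine le_mul_of_one_le_left (norm_nonneg _) ?_
        have := norm_nonneg z
        nlinarith
    _ = _ := by ring

theorem le_sqrt_self_of_le_one {r : ℝ} (h0 : 0 ≤ r) (h1 : r ≤ 1) : r ≤ √r := by
  apply Real.le_sqrt_of_sq_le
  nlinarith

theorem norm_gint_sub_le_sqrt (hk : IsGaussKernel κ M k) (hκ : 0 < κ) (hf : Continuous f)
    (hb : ∀ q, |f q| ≤ B) (x x' : Euc N) (t : ℝ) {τ : ℝ} (hτ : 0 < τ) :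
    ‖gint k f (x, t) τ - gint k f (x', t) τ‖ ≤
      2 * (B * M * gaussMass N κ) * √(‖x - x'‖ / √τ) := by
  have hs : 0 < √τ := Real.sqrt_pos.2 hτ
  have hA : 0 ≤ B * M * gaussMass N κ :=
    mul_nonneg (mul_nonneg ((abs_nonneg _).trans (hb 0)) hk.nonneg) (gaussMass_nonneg _ _)
  rcases le_total ‖x - x'‖ √τ with h | h
  · have h1 := norm_gint_sub_le hk hκ hf hb x x' t hτ h
    have h2 := le_sqrt_self_of_le_one (div_nonneg (norm_nonneg (x - x')) hs.le)
      (div_le_one_of_le₀ h hs.le)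
    nlinarith [mul_le_mul_of_nonneg_left h2 hA, Real.sqrt_nonneg (‖x - x'‖ / √τ)]
  · have h1 : ‖gint k f (x, t) τ - gint k f (x', t) τ‖ ≤ 2 * (B * M * gaussMass N κ) :=
      (norm_sub_le _ _).trans (by
        linarith [norm_gint_le hk hκ hb (x, t) τ, norm_gint_le hk hκ hb (x', t) τ])
    have h2 : 1 ≤ √(‖x - x'‖ / √τ) := by
      rw [Real.one_le_sqrt]; exact (one_le_div hs).2 h
    nlinarith

end Gint

namespace Coef

variable {N : ℕ} (C : Coef N) {B : ℝ} {f : Euc N × ℝ → ℝ}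

/-- The trace of the Hessian kernel. -/
def p3 (q : Euc N × ℝ) (z : Euc N) : ℝ := C.tr q (C.p2 q z)

theorem gk3 : IsGaussKernel C.κ (2 * C.Λ * C.M) C.p3 := by
  have h2 := C.gk2
  have hΛ := C.Λ_pos
  have hM := C.M_nonneg
  have e : ∀ q (A : Euc N →L[ℝ] Euc N), |C.tr q A| ≤ C.Λ * ‖A‖ := fun q A =>
    (C.tr q).le_of_opNorm_le (C.tr_le q) A
  refine ⟨(C.continuous_tr.comp continuous_fst).clm_apply C.continuous_p2, fun q z => ?_,
    fun q q' z w hw => ?_⟩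
  · have h3 := h2.bound q z
    calc _ ≤ (1 + ‖z‖) ^ 2 * (C.Λ * ‖C.p2 q z‖) := by
          gcongr; exact e q _
      _ = C.Λ * ((1 + ‖z‖) ^ 2 * ‖C.p2 q z‖) := by ring
      _ ≤ C.Λ * (C.M * Real.exp (-C.κ * ‖z‖ ^ 2)) := by gcongr
      _ ≤ _ := by
          have : 0 ≤ C.Λ * C.M * Real.exp (-C.κ * ‖z‖ ^ 2) := by positivity
          linarith
  · have h3 := h2.lip q q' z w hw
    have h4 := h2.bound q' z
    have e1 : C.p3 q (z + w) - C.p3 q' z =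
        C.tr q (C.p2 q (z + w) - C.p2 q' z) + (C.tr q - C.tr q') (C.p2 q' z) := by
      simp [p3]
    rw [e1]
    calc _ ≤ (1 + ‖z‖) ^ 2 * (C.Λ * ‖C.p2 q (z + w) - C.p2 q' z‖ +
          C.Λ * ‖q - q'‖ * ‖C.p2 q' z‖) := by
          gcongr
          exact (norm_add_le _ _).trans (add_le_add (e q _)
            ((C.tr q - C.tr q').le_of_opNorm_le (C.tr_lip q q') _))
      _ = C.Λ * ((1 + ‖z‖) ^ 2 * ‖C.p2 q (z + w) - C.p2 q' z‖) +
          C.Λ * ‖q - q'‖ * ((1 + ‖z‖) ^ 2 * ‖C.p2 q' z‖) := by ring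
      _ ≤ C.Λ * (C.M * (‖q - q'‖ + ‖w‖) * Real.exp (-C.κ * ‖z‖ ^ 2)) +
          C.Λ * ‖q - q'‖ * (C.M * Real.exp (-C.κ * ‖z‖ ^ 2)) := by gcongr
      _ ≤ _ := by
          have : 0 ≤ C.Λ * C.M * ‖w‖ * Real.exp (-C.κ * ‖z‖ ^ 2) := by positivity
          linarith

/-- The error kernel of the parametrix. -/
def gK (f : Euc N × ℝ → ℝ) (q : Euc N × ℝ) (τ : ℝ) : ℝ :=
  C.tr q (gint C.p2 f q τ) - gint C.p3 f q τ

/-- A bound for all Gaussian averages. -/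
def G : ℝ := C.M * gaussMass N C.κ

theorem G_nonneg : 0 ≤ C.G := mul_nonneg C.M_nonneg (gaussMass_nonneg _ _)

theorem norm_tr_sub_shiftPt_le (q : Euc N × ℝ) {τ : ℝ} (hτ : 0 ≤ τ) (z : Euc N) :
    ‖C.tr q - C.tr (shiftPt q τ z)‖ ≤ 2 * C.Λ * √τ * (1 + ‖z‖) := by
  have hΛ := C.Λ_pos
  have hs := Real.sqrt_nonneg τ
  have hz := norm_nonneg z
  rcases le_total 1 √τ with h | h
  · have h0 := (norm_sub_le (C.tr q) (C.tr (shiftPt q τ z))).trans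
      (add_le_add (C.tr_le _) (C.tr_le _))
    have h1 : 1 * 1 ≤ √τ * (1 + ‖z‖) := mul_le_mul h (by linarith) zero_le_one hs
    nlinarith
  · refine (C.tr_lip _ _).trans ?_
    have h1 : ‖q - shiftPt q τ z‖ ≤ √τ * (1 + ‖z‖) := by
      rw [Prod.norm_def]
      simp only [shiftPt, Prod.fst_sub, Prod.snd_sub, sub_add_cancel_left, norm_neg, norm_smul,
        Real.norm_of_nonneg hs, Real.norm_of_nonneg hτ]
      refine max_le (by nlinarith) ?_
      calc τ = √τ * √τ := (Real.mul_self_sqrt hτ).symm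
        _ ≤ √τ * (1 + ‖z‖) := by gcongr; linarith
    calc _ ≤ C.Λ * (√τ * (1 + ‖z‖)) := by gcongr
      _ ≤ _ := by nlinarith [mul_nonneg hΛ.le (mul_nonneg hs (by linarith : 0 ≤ 1 + ‖z‖))]

theorem gK_eq (hf : Continuous f) (hb : ∀ q, |f q| ≤ B) (q : Euc N × ℝ) (τ : ℝ) :
    C.gK f q τ = ∫ z, f (shiftPt q τ z) •
      (C.tr q - C.tr (shiftPt q τ z)) (C.p2 (shiftPt q τ z) z) := by
  unfold gK gint
  rw [← ContinuousLinearMap.integral_comp_comm _ (integrable_gint C.gk2 C.κ_pos hf hb q τ),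
    ← integral_sub ((C.tr q).integrable_comp (integrable_gint C.gk2 C.κ_pos hf hb q τ))
      (integrable_gint C.gk3 C.κ_pos hf hb q τ)]
  congr 1
  ext z
  simp [p3, mul_sub]

theorem abs_gK_le (hf : Continuous f) (hb : ∀ q, |f q| ≤ B) (q : Euc N × ℝ) {τ : ℝ} (hτ : 0 ≤ τ) :
    |C.gK f q τ| ≤ 2 * C.Λ * B * C.G * √τ := by
  rw [C.gK_eq hf hb, ← Real.norm_eq_abs]
  refine (norm_integral_gauss_le C.κ_pos (C := 2 * C.Λ * B * C.M * √τ) fun z => ?_).trans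
    (le_of_eq (by unfold G gaussMass; ring))
  have h1 := (C.tr q - C.tr (shiftPt q τ z)).le_of_opNorm_le (C.norm_tr_sub_shiftPt_le q hτ z)
    (C.p2 (shiftPt q τ z) z)
  have h2 := C.gk2.bound (shiftPt q τ z) z
  have hB := (abs_nonneg _).trans (hb 0)
  have hΛ := C.Λ_pos
  rw [norm_smul]
  calc _ ≤ B * (2 * C.Λ * √τ * (1 + ‖z‖) * ‖C.p2 (shiftPt q τ z) z‖) :=
        mul_le_mul (hb _) h1 (norm_nonneg _) hB
    _ ≤ B * (2 * C.Λ * √τ * ((1 + ‖z‖) ^ 2 * ‖C.p2 (shiftPt q τ z) z‖)) := by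
        rw [mul_assoc (2 * C.Λ * √τ)]
        gcongr
        nlinarith [norm_nonneg z]
    _ ≤ B * (2 * C.Λ * √τ * (C.M * Real.exp (-C.κ * ‖z‖ ^ 2))) := by gcongr
    _ = _ := by ring

theorem abs_gK_sub_le (hf : Continuous f) (hb : ∀ q, |f q| ≤ B) (x x' : Euc N) (t : ℝ) {τ : ℝ}
    (hτ : 0 < τ) (hx : ‖x - x'‖ ≤ √τ) :
    |C.gK f (x, t) τ - C.gK f (x', t) τ| ≤ 3 * C.Λ * B * C.G * ‖x - x'‖ := by
  have hw : ‖(√τ)⁻¹ • (x' - x)‖ ≤ 1 := by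
    rw [norm_inv_sqrt_smul]; exact div_le_one_of_le₀ hx (Real.sqrt_nonneg _)
  have hs : 0 < √τ := Real.sqrt_pos.2 hτ
  have hB := (abs_nonneg _).trans (hb 0)
  have hΛ := C.Λ_pos
  set w := (√τ)⁻¹ • (x' - x) with hwdef
  set y := shiftPt (x', t) τ with hy
  have e1 : C.gK f (x, t) τ - C.gK f (x', t) τ =
      (C.tr (x, t) - C.tr (x', t)) (gint C.p2 f (x, t) τ) +
      ∫ z, f (y z) • (C.tr (x', t) - C.tr (y z)) (C.p2 (y z) (z + w) - C.p2 (y z) z) := by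
    have i1 := integrable_shift C.gk2 C.κ_pos hf hb (x', t) τ hw
    have i2 := integrable_shift C.gk3 C.κ_pos hf hb (x', t) τ hw
    have i3 := integrable_gint C.gk2 C.κ_pos hf hb (x', t) τ
    have i4 := integrable_gint C.gk3 C.κ_pos hf hb (x', t) τ
    have e2 : ∫ z, f (y z) • (C.tr (x', t) - C.tr (y z)) (C.p2 (y z) (z + w) - C.p2 (y z) z) =
        (C.tr (x', t) (gint C.p2 f (x, t) τ) - gint C.p3 f (x, t) τ) -
        (C.tr (x', t) (gint C.p2 f (x', t) τ) - gint C.p3 f (x', t) τ) := by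
      rw [gint_eq_shift (k := C.p2) x x' t hτ, gint_eq_shift (k := C.p3) x x' t hτ]
      unfold gint
      rw [← ContinuousLinearMap.integral_comp_comm _ i1, ← ContinuousLinearMap.integral_comp_comm _ i3,
        ← integral_sub ((C.tr (x', t)).integrable_comp i1) i2,
        ← integral_sub ((C.tr (x', t)).integrable_comp i3) i4, ← integral_sub]
      · congr 1
        ext z
        simp [p3, mul_sub, hy]
        ring
      · exact ((C.tr (x', t)).integrable_comp i1).sub i2
      · exact ((C.tr (x', t)).integrable_comp i3).sub i4
    rw [e2]
    simp [gK]
    ring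
  rw [e1]
  have h1 : |(C.tr (x, t) - C.tr (x', t)) (gint C.p2 f (x, t) τ)| ≤ C.Λ * ‖x - x'‖ * (B * C.G) := by
    refine ((C.tr (x, t) - C.tr (x', t)).le_of_opNorm_le (C.tr_lip _ _) _).trans ?_
    have e3 : ‖((x, t) : Euc N × ℝ) - (x', t)‖ = ‖x - x'‖ := by
      simp [Prod.norm_def]
    rw [e3]
    have := norm_gint_le C.gk2 C.κ_pos hb (x, t) τ
    gcongr
    exact this.trans (le_of_eq (by unfold G; ring))
  have h2 : |∫ z, f (y z) • (C.tr (x', t) - C.tr (y z)) (C.p2 (y z) (z + w) - C.p2 (y z) z)| ≤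
      2 * C.Λ * B * C.G * ‖x - x'‖ := by
    rw [← Real.norm_eq_abs]
    refine (norm_integral_gauss_le C.κ_pos (C := 2 * C.Λ * B * C.M * ‖x - x'‖) fun z => ?_).trans
      (le_of_eq (by unfold G gaussMass; ring))
    have h1 := (C.tr (x', t) - C.tr (y z)).le_of_opNorm_le
      (C.norm_tr_sub_shiftPt_le (x', t) hτ.le z) (C.p2 (y z) (z + w) - C.p2 (y z) z)
    have h2 := C.gk2.lip (y z) (y z) z w hw
    rw [sub_self, norm_zero, zero_add, hwdef, norm_inv_sqrt_smul, ← hwdef] at h2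
    rw [norm_smul]
    calc _ ≤ B * (2 * C.Λ * √τ * (1 + ‖z‖) * ‖C.p2 (y z) (z + w) - C.p2 (y z) z‖) :=
          mul_le_mul (hb _) h1 (norm_nonneg _) hB
      _ ≤ B * (2 * C.Λ * √τ * ((1 + ‖z‖) ^ 2 * ‖C.p2 (y z) (z + w) - C.p2 (y z) z‖)) := by
          rw [mul_assoc (2 * C.Λ * √τ)]
          gcongr
          nlinarith [norm_nonneg z]
      _ ≤ B * (2 * C.Λ * √τ * (C.M * (‖x - x'‖ / √τ) * Real.exp (-C.κ * ‖z‖ ^ 2))) := by gcongr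
      _ = _ := by field_simp
  refine (abs_add_le _ _).trans ((add_le_add h1 h2).trans (le_of_eq (by ring)))

theorem abs_gK_sub_le_sqrt (hf : Continuous f) (hb : ∀ q, |f q| ≤ B) (x x' : Euc N) (t : ℝ) {τ : ℝ}
    (hτ : 0 < τ) :
    |C.gK f (x, t) τ - C.gK f (x', t) τ| ≤ 4 * C.Λ * B * C.G * (√τ * √(‖x - x'‖ / √τ)) := by
  have hs : 0 < √τ := Real.sqrt_pos.2 hτ
  have hB := (abs_nonneg _).trans (hb 0)
  have hΛ := C.Λ_pos
  have hG := C.G_nonneg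
  have hA : 0 ≤ C.Λ * B * C.G := by positivity
  rcases le_total ‖x - x'‖ √τ with h | h
  · have h1 := C.abs_gK_sub_le hf hb x x' t hτ h
    have h2 := le_sqrt_self_of_le_one (div_nonneg (norm_nonneg (x - x')) hs.le)
      (div_le_one_of_le₀ h hs.le)
    have h3 : ‖x - x'‖ = √τ * (‖x - x'‖ / √τ) := by field_simp
    calc _ ≤ 3 * C.Λ * B * C.G * ‖x - x'‖ := h1
      _ = 3 * C.Λ * B * C.G * (√τ * (‖x - x'‖ / √τ)) := by rw [← h3]
      _ ≤ 4 * C.Λ * B * C.G * (√τ * √(‖x - x'‖ / √τ)) := by gcongr; norm_num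
  · have h2 : 1 ≤ √(‖x - x'‖ / √τ) := by
      rw [Real.one_le_sqrt]; exact (one_le_div hs).2 h
    have h1 : |C.gK f (x, t) τ - C.gK f (x', t) τ| ≤ 4 * C.Λ * B * C.G * √τ := by
      refine (abs_sub _ _).trans ?_
      linarith [C.abs_gK_le hf hb (x, t) hτ.le, C.abs_gK_le hf hb (x', t) hτ.le]
    refine h1.trans ?_
    have : √τ ≤ √τ * √(‖x - x'‖ / √τ) := le_mul_of_one_le_right hs.le h2
    gcongr

theorem smul_sub_smul_eq {F : Type*} [AddCommGroup F] [Module ℝ F] (a b : ℝ) (v w : F) :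
    a • v - b • w = (a - b) • v + b • (v - w) := by
  rw [sub_smul, smul_sub]; abel

theorem integral_sub_smul {X F : Type*} [MeasurableSpace X] {μ : Measure X} [NormedAddCommGroup F]
    [NormedSpace ℝ F] {φ ψ : X → F} (b : ℝ) (hφ : Integrable φ μ) (hψ : Integrable ψ μ) :
    ∫ z, (φ z - b • ψ z) ∂μ = ∫ z, φ z ∂μ - b • ∫ z, ψ z ∂μ := by
  rw [← integral_smul]
  exact integral_sub hφ (hψ.smul b)

theorem integral_p2 (q : Euc N × ℝ) : ∫ z, C.p2 q z = 0 := by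
  have h := integral_fderiv_kernel_eq_zero (k := C.p1 q) (k' := fun z => -C.p2 q z)
    (C.continuous_p1_comp continuous_const continuous_id)
    (C.continuous_p2_comp continuous_const continuous_id).neg (C.hasFDerivAt_p1 q) C.κ_pos
    (C.gk1.norm_le q) (fun z => by rw [norm_neg]; exact C.gk2.norm_le q z)
  rw [integral_neg, neg_eq_zero] at h
  exact h

/-- For Hölder continuous densities the Hessian average is small at small times. -/
theorem norm_gint_p2_le (hf : Continuous f) (hb : ∀ q, |f q| ≤ B)
    (hh : ∀ x x' t, |f (x, t) - f (x', t)| ≤ B * √‖x - x'‖) (q : Euc N × ℝ) {τ : ℝ} (hτ : 0 < τ) :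
    ‖gint C.p2 f q τ‖ ≤ 2 * B * C.G * √√τ := by
  have hs : 0 < √τ := Real.sqrt_pos.2 hτ
  have hB := (abs_nonneg _).trans (hb 0)
  have hG := C.G_nonneg
  rcases le_total 1 √τ with h | h
  · have h1 : 1 ≤ √√τ := Real.one_le_sqrt.2 h
    have h2 := norm_gint_le C.gk2 C.κ_pos hb q τ
    have h3 : B * C.M * gaussMass N C.κ = B * C.G := by unfold G; ring
    rw [h3] at h2
    have h4 : 0 ≤ B * C.G := by positivity
    nlinarith
  · set y := shiftPt q τ with hy
    set q' : Euc N × ℝ := (q.1, q.2 + τ) with hq'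
    have hyq : ∀ z, ‖y z - q'‖ = √τ * ‖z‖ := fun z => by
      simp [hy, hq', shiftPt, Prod.norm_def, norm_smul, abs_of_pos hs]
      positivity
    have i1 := integrable_gint C.gk2 C.κ_pos hf hb q τ
    have i2 : Integrable (C.p2 q') :=
      integrable_of_gauss (C.continuous_p2_comp continuous_const continuous_id) C.κ_pos
        (C.gk2.norm_le q')
    have e1 : gint C.p2 f q τ = ∫ z, (f (y z) • C.p2 (y z) z - f q' • C.p2 q' z) := by
      have := integral_sub_smul (f q') i1 i2
      rw [C.integral_p2, smul_zero, sub_zero] at this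
      exact this.symm
    rw [e1]
    refine (norm_integral_gauss_le C.κ_pos (C := 2 * B * C.M * √√τ) fun z => ?_).trans
      (le_of_eq (by unfold G gaussMass; ring))
    have hz := norm_nonneg z
    have h1 := C.gk2.lip (y z) q' z 0 (by simp)
    have h2 := C.gk2.bound (y z) z
    rw [add_zero, norm_zero, add_zero, hyq] at h1
    have h3 : |f (y z) - f q'| ≤ B * √(√τ * ‖z‖) := by
      have := hh (y z).1 q'.1 (q.2 + τ)
      refine this.trans (le_of_eq ?_)
      simp [hy, hq', shiftPt, norm_smul, abs_of_pos hs]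
    have h4 : √(√τ * ‖z‖) ≤ √√τ * (1 + ‖z‖) ^ 2 := by
      rw [Real.sqrt_mul hs.le]
      gcongr
      rw [Real.sqrt_le_left (by positivity)]
      nlinarith [sq_nonneg (‖z‖ ^ 2), sq_nonneg ‖z‖, mul_nonneg hz (sq_nonneg ‖z‖)]
    have h5 : √τ ≤ √√τ := le_sqrt_self_of_le_one hs.le h
    have hE := Real.exp_pos (-C.κ * ‖z‖ ^ 2)
    have hM := C.M_nonneg
    have e2 : f (y z) • C.p2 (y z) z - f q' • C.p2 q' z =
        (f (y z) - f q') • C.p2 (y z) z + f q' • (C.p2 (y z) z - C.p2 q' z) :=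
      smul_sub_smul_eq _ _ _ _
    have h6 : ‖C.p2 (y z) z - C.p2 q' z‖ ≤ C.M * √τ * Real.exp (-C.κ * ‖z‖ ^ 2) := by
      have h7 : (1 + ‖z‖) ^ 2 * ‖C.p2 (y z) z - C.p2 q' z‖ ≤
          (1 + ‖z‖) ^ 2 * (C.M * √τ * Real.exp (-C.κ * ‖z‖ ^ 2)) := by
        refine h1.trans ?_
        have : ‖z‖ ≤ (1 + ‖z‖) ^ 2 := by nlinarith
        have h8 : 0 ≤ C.M * √τ * Real.exp (-C.κ * ‖z‖ ^ 2) := by positivity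
        nlinarith
      exact le_of_mul_le_mul_left h7 (by positivity)
    rw [e2]
    refine (norm_add_le _ _).trans ?_
    rw [norm_smul, norm_smul, Real.norm_eq_abs, Real.norm_eq_abs]
    calc _ ≤ (B * (√√τ * (1 + ‖z‖) ^ 2)) * ‖C.p2 (y z) z‖ +
          B * (C.M * √√τ * Real.exp (-C.κ * ‖z‖ ^ 2)) := by
          gcongr
          · exact h3.trans (by gcongr)
          · exact hb _
          · exact h6.trans (by gcongr)
      _ = (B * √√τ) * ((1 + ‖z‖) ^ 2 * ‖C.p2 (y z) z‖) +
          B * (C.M * √√τ * Real.exp (-C.κ * ‖z‖ ^ 2)) := by ring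
      _ ≤ (B * √√τ) * (C.M * Real.exp (-C.κ * ‖z‖ ^ 2)) +
          B * (C.M * √√τ * Real.exp (-C.κ * ‖z‖ ^ 2)) := by gcongr
      _ = _ := by ring

theorem hasFDerivAt_gint_p0 (hf : Continuous f) (hb : ∀ q, |f q| ≤ B) (x : Euc N) (t : ℝ) {τ : ℝ}
    (hτ : 0 < τ) :
    HasFDerivAt (fun x => gint C.p0 f (x, t) τ)
      (innerSL ℝ ((√τ)⁻¹ • gint C.p1 f (x, t) τ)) x := by
  have hs : 0 < √τ := Real.sqrt_pos.2 hτ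
  have hfc : Continuous fun p : Euc N × Euc N => f (p.1, t + τ) := by fun_prop
  have hpc : Continuous fun p : Euc N × Euc N => ((p.1, t + τ) : Euc N × ℝ) := by fun_prop
  have h := hasFDerivAt_scaled_kernel
    (k := fun y z => f (y, t + τ) • C.p0 (y, t + τ) z)
    (k' := fun y z => f (y, t + τ) • (-(innerSL ℝ (C.p1 (y, t + τ) z))))
    (hfc.smul (C.continuous_p0_comp hpc continuous_snd))
    (hfc.smul ((innerSL ℝ).continuous.comp (C.continuous_p1_comp hpc continuous_snd)).neg)
    (fun y z => (C.hasFDerivAt_p0 _ z).fun_const_smul _) C.κ_pos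
    (fun y z => C.gk0.norm_smul_le hb _ z)
    (fun y z => by
      rw [norm_smul, norm_neg, innerSL_apply_norm, ← norm_smul]
      exact C.gk1.norm_smul_le hb _ z) x hs
  refine HasFDerivAt.congr_fderiv h ?_
  rw [map_smul]
  unfold gint
  rw [← ContinuousLinearMap.integral_comp_comm _ (integrable_gint C.gk1 C.κ_pos hf hb (x, t) τ),
    ← smul_neg, ← integral_neg]
  congr 2
  ext1 z
  simp [shiftPt]

theorem hasFDerivAt_gint_p1 (hf : Continuous f) (hb : ∀ q, |f q| ≤ B) (x : Euc N) (t : ℝ) {τ : ℝ}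
    (hτ : 0 < τ) :
    HasFDerivAt (fun x => gint C.p1 f (x, t) τ) ((√τ)⁻¹ • gint C.p2 f (x, t) τ) x := by
  have hs : 0 < √τ := Real.sqrt_pos.2 hτ
  have hfc : Continuous fun p : Euc N × Euc N => f (p.1, t + τ) := by fun_prop
  have hpc : Continuous fun p : Euc N × Euc N => ((p.1, t + τ) : Euc N × ℝ) := by fun_prop
  have h := hasFDerivAt_scaled_kernel
    (k := fun y z => f (y, t + τ) • C.p1 (y, t + τ) z)
    (k' := fun y z => f (y, t + τ) • (-(C.p2 (y, t + τ) z)))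
    (hfc.smul (C.continuous_p1_comp hpc continuous_snd))
    (hfc.smul (C.continuous_p2_comp hpc continuous_snd).neg)
    (fun y z => (C.hasFDerivAt_p1 _ z).fun_const_smul _) C.κ_pos
    (fun y z => C.gk1.norm_smul_le hb _ z)
    (fun y z => by
      rw [norm_smul, norm_neg, ← norm_smul]
      exact C.gk2.norm_smul_le hb _ z) x hs
  refine HasFDerivAt.congr_fderiv h ?_
  unfold gint
  rw [← smul_neg, ← integral_neg]
  congr 2
  ext1 z
  simp [shiftPt]

/-- Differentiation in the initial time with fixed final time `s`. -/
theorem hasDerivAt_gint_p0 (hf : Continuous f) (hb : ∀ q, |f q| ≤ B) (x : Euc N) {s t : ℝ}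
    (hst : t < s) :
    HasDerivAt (fun t => gint C.p0 f (x, t) (s - t))
      (-((2 * (s - t))⁻¹ * gint C.p3 f (x, t) (s - t))) t := by
  have hτ : 0 < s - t := sub_pos.2 hst
  have hs : 0 < √(s - t) := Real.sqrt_pos.2 hτ
  have hfc : Continuous fun p : Euc N × Euc N => f (p.1, s) := by fun_prop
  have hpc : Continuous fun p : Euc N × Euc N => ((p.1, s) : Euc N × ℝ) := by fun_prop
  have h := hasDerivAt_scaled_kernel
    (k := fun y z => f (y, s) • C.p0 (y, s) z)
    (k' := fun y z => f (y, s) • (-(innerSL ℝ (C.p1 (y, s) z))))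
    (hfc.smul (C.continuous_p0_comp hpc continuous_snd))
    (hfc.smul ((innerSL ℝ).continuous.comp (C.continuous_p1_comp hpc continuous_snd)).neg)
    (fun y z => (C.hasFDerivAt_p0 _ z).fun_const_smul _) (C := B * C.M) C.κ_pos
    (fun y z => C.gk0.norm_smul_le hb _ z)
    (fun y z => by
      have h1 := C.gk1.bound (y, s) z
      have h2 : |inner ℝ (C.p1 (y, s) z) z| ≤ C.M * Real.exp (-C.κ * ‖z‖ ^ 2) := by
        refine (abs_real_inner_le_norm _ _).trans (le_trans ?_ h1)
        nlinarith [norm_nonneg z, mul_nonneg (norm_nonneg z) (norm_nonneg (C.p1 (y, s) z)),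
          norm_nonneg (C.p1 (y, s) z),
          mul_nonneg (sq_nonneg ‖z‖) (norm_nonneg (C.p1 (y, s) z))]
      have h3 : (f (y, s) • (-(innerSL ℝ (C.p1 (y, s) z)))) z =
          -(f (y, s) * inner ℝ (C.p1 (y, s) z) z) := by simp
      rw [h3, norm_neg, norm_mul, mul_assoc]
      exact mul_le_mul (hb _) h2 (norm_nonneg _) ((abs_nonneg _).trans (hb 0))) x hs
  have hsq : HasDerivAt (fun t => √(s - t)) (-1 / (2 * √(s - t))) t :=
    ((hasDerivAt_id t).const_sub s).sqrt hτ.ne'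
  have h2 := h.scomp t hsq
  have e : (fun t => gint C.p0 f (x, t) (s - t)) =
      ((fun h => ∫ z, f (x + h • z, s) • C.p0 (x + h • z, s) z) ∘ fun t => √(s - t)) := by
    ext t; simp [gint, shiftPt]
  rw [e]
  refine HasDerivAt.congr_deriv h2 ?_
  have e2 : ∫ z, ((N : ℝ) • f (x + √(s - t) • z, s) • C.p0 (x + √(s - t) • z, s) z +
      (f (x + √(s - t) • z, s) • (-(innerSL ℝ (C.p1 (x + √(s - t) • z, s) z)))) z) =
      -gint C.p3 f (x, t) (s - t) := by
    unfold gint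
    rw [← integral_neg]
    congr 1
    ext z
    simp [shiftPt, p3, C.tr_p2, p1, inner_smul_left, C.Q_symm]
    ring
  rw [e2]
  have h5 : (√(s - t))⁻¹ * (√(s - t))⁻¹ = (s - t)⁻¹ := by
    rw [← mul_inv, Real.mul_self_sqrt hτ.le]
  simp only [smul_eq_mul]
  rw [mul_inv, ← h5]
  field_simp

end Coef

/-! ### Discounted time integrals -/

/-- The time integral of `Ψ` with discount rate `l`. -/
def tint {X F : Type*} [NormedAddCommGroup F] [NormedSpace ℝ F] (l : ℝ) (Ψ : X → ℝ → F) (q : X) :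
    F :=
  ∫ τ in Ioi (0 : ℝ), Real.exp (-(l * τ)) • Ψ q τ

/-- A family of time profiles, continuous for positive times, with an integrable singularity. -/
structure IsTimeKernel {X F : Type*} [TopologicalSpace X] [NormedAddCommGroup F]
    (Ψ : X → ℝ → F) (A s : ℝ) : Prop where
  cont : ContinuousOn (fun p : X × ℝ => Ψ p.1 p.2) (univ ×ˢ Ioi 0)
  bound : ∀ q τ, 0 < τ → ‖Ψ q τ‖ ≤ A * τ ^ (s - 1)

/-- The total mass of the discounted weight `τ ^ (s - 1)`. -/
def timeMass (l s : ℝ) : ℝ := (1 / l) ^ s * Real.Gamma s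

theorem integrableOn_timeWeight {l s : ℝ} (hl : 0 < l) (hs : 0 < s) :
    IntegrableOn (fun τ : ℝ => Real.exp (-(l * τ)) * τ ^ (s - 1)) (Ioi 0) := by
  have := integrableOn_rpow_mul_exp_neg_mul_rpow (p := 1) (s := s - 1) (b := l) (by linarith)
    one_pos hl
  refine this.congr_fun (fun τ _ => ?_) measurableSet_Ioi
  simp only [Real.rpow_one]
  rw [mul_comm, neg_mul]

theorem integral_timeWeight {l s : ℝ} (hl : 0 < l) (hs : 0 < s) :
    ∫ τ in Ioi (0 : ℝ), Real.exp (-(l * τ)) * τ ^ (s - 1) = timeMass l s := by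
  unfold timeMass
  rw [← Real.integral_rpow_mul_exp_neg_mul_Ioi hs hl]
  simp only [mul_comm]

section Tint

variable {X F : Type*} [TopologicalSpace X] [NormedAddCommGroup F] [NormedSpace ℝ F]
  {Ψ Ψ' : X → ℝ → F} {A A' s l : ℝ}

theorem IsTimeKernel.continuousOn_slice (h : IsTimeKernel Ψ A s) (q : X) :
    ContinuousOn (fun τ => Real.exp (-(l * τ)) • Ψ q τ) (Ioi 0) := by
  have h1 : ContinuousOn (fun τ : ℝ => Ψ q τ) (Ioi 0) :=
    ContinuousOn.comp (g := fun p : X × ℝ => Ψ p.1 p.2) (f := fun τ => (q, τ)) h.cont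
      (by fun_prop) (fun τ hτ => ⟨mem_univ _, hτ⟩)
  exact ContinuousOn.smul (by fun_prop) h1

theorem norm_exp_smul_le {v : F} {τ : ℝ} (hv : ‖v‖ ≤ A * τ ^ (s - 1)) :
    ‖Real.exp (-(l * τ)) • v‖ ≤ A * (Real.exp (-(l * τ)) * τ ^ (s - 1)) := by
  rw [norm_smul, Real.norm_of_nonneg (Real.exp_pos _).le]
  calc _ ≤ Real.exp (-(l * τ)) * (A * τ ^ (s - 1)) := by gcongr
    _ = _ := by ring

theorem IsTimeKernel.integrableOn (h : IsTimeKernel Ψ A s) (hs : 0 < s) (hl : 0 < l) (q : X) :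
    IntegrableOn (fun τ => Real.exp (-(l * τ)) • Ψ q τ) (Ioi 0) := by
  refine Integrable.mono' ((integrableOn_timeWeight hl hs).const_mul A)
    ((h.continuousOn_slice q).aestronglyMeasurable measurableSet_Ioi) ?_
  filter_upwards [ae_restrict_mem measurableSet_Ioi] with τ hτ
  exact norm_exp_smul_le (h.bound q τ hτ)

theorem norm_tint_le (h : ∀ q τ, 0 < τ → ‖Ψ q τ‖ ≤ A * τ ^ (s - 1)) (hs : 0 < s) (hl : 0 < l)
    (q : X) : ‖tint l Ψ q‖ ≤ A * timeMass l s := by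
  rw [← integral_timeWeight hl hs, ← integral_const_mul]
  refine norm_integral_le_of_norm_le ((integrableOn_timeWeight hl hs).const_mul A) ?_
  filter_upwards [ae_restrict_mem measurableSet_Ioi] with τ hτ
  exact norm_exp_smul_le (h q τ hτ)

theorem IsTimeKernel.continuous_tint [FirstCountableTopology X] (h : IsTimeKernel Ψ A s)
    (hs : 0 < s) (hl : 0 < l) : Continuous (tint l Ψ) := by
  refine continuous_of_dominated (bound := fun τ => A * (Real.exp (-(l * τ)) * τ ^ (s - 1)))
    (fun q => (h.continuousOn_slice q).aestronglyMeasurable measurableSet_Ioi) (fun q => ?_)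
    ((integrableOn_timeWeight hl hs).const_mul A) ?_
  · filter_upwards [ae_restrict_mem measurableSet_Ioi] with τ hτ
    exact norm_exp_smul_le (h.bound q τ hτ)
  · filter_upwards [ae_restrict_mem measurableSet_Ioi] with τ hτ
    refine Continuous.const_smul ?_ _
    exact ContinuousOn.comp_continuous (g := fun p : X × ℝ => Ψ p.1 p.2) (f := fun q => (q, τ))
      h.cont (by fun_prop) (fun q => ⟨mem_univ _, hτ⟩)

theorem tint_sub (h : IsTimeKernel Ψ A s) (h' : IsTimeKernel Ψ' A' s) (hs : 0 < s) (hl : 0 < l)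
    (q : X) : tint l (fun q τ => Ψ q τ - Ψ' q τ) q = tint l Ψ q - tint l Ψ' q := by
  unfold tint
  rw [← integral_sub (h.integrableOn hs hl q) (h'.integrableOn hs hl q)]
  simp only [smul_sub]

theorem norm_tint_sub_le (h : IsTimeKernel Ψ A s) (hs : 0 < s) (hl : 0 < l) {q q' : X}
    {D r : ℝ} (hr : 0 < r) (hd : ∀ τ, 0 < τ → ‖Ψ q τ - Ψ q' τ‖ ≤ D * τ ^ (r - 1)) :
    ‖tint l Ψ q - tint l Ψ q'‖ ≤ D * timeMass l r := by
  have : tint l Ψ q - tint l Ψ q' = tint l (fun (_ : Unit) τ => Ψ q τ - Ψ q' τ) () := by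
    unfold tint
    rw [← integral_sub (h.integrableOn hs hl q) (h.integrableOn hs hl q')]
    simp only [smul_sub]
  rw [this]
  exact norm_tint_le (fun _ τ hτ => hd τ hτ) hr hl ()

theorem hasFDerivAt_tint {E : Type*} [NormedAddCommGroup E] [NormedSpace ℝ E] {Ψ : E → ℝ → F}
    {Φ : E → ℝ → E →L[ℝ] F} {r : ℝ} (h : IsTimeKernel Ψ A s) (hs : 0 < s) (hl : 0 < l)
    (h' : IsTimeKernel Φ A' r) (hr : 0 < r)
    (hd : ∀ x τ, 0 < τ → HasFDerivAt (fun x => Ψ x τ) (Φ x τ) x) (x : E) :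
    HasFDerivAt (tint l Ψ) (tint l Φ x) x := by
  refine hasFDerivAt_integral_of_dominated_of_fderiv_le (s := univ)
    (F := fun x τ => Real.exp (-(l * τ)) • Ψ x τ) (F' := fun x τ => Real.exp (-(l * τ)) • Φ x τ)
    (bound := fun τ => A' * (Real.exp (-(l * τ)) * τ ^ (r - 1))) Filter.univ_mem
    (Filter.Eventually.of_forall fun x =>
      (h.continuousOn_slice x).aestronglyMeasurable measurableSet_Ioi)
    (h.integrableOn hs hl x) ((h'.continuousOn_slice x).aestronglyMeasurable measurableSet_Ioi) ?_
    ((integrableOn_timeWeight hl hr).const_mul A') ?_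
  · filter_upwards [ae_restrict_mem measurableSet_Ioi] with τ hτ x _
    exact norm_exp_smul_le (h'.bound x τ hτ)
  · filter_upwards [ae_restrict_mem measurableSet_Ioi] with τ hτ x _
    exact (hd x τ hτ).fun_const_smul _

end Tint

/-- Integrating a family of primitives over a moving half line: if each slice `t ↦ v t s` is
continuous with derivative `e^{-l(s-t)} Θ t (s-t)` for `t < s`, then the integral of `v t` over
`s > t` is a primitive of the integrated derivative minus the boundary value. -/
theorem integral_slices_sub {v Θ : ℝ → ℝ → ℝ} {A B s₀ l : ℝ} (hl : 0 < l) (hs₀ : 0 < s₀)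
    (hv : Continuous fun p : ℝ × ℝ => v p.1 p.2)
    (hvb : ∀ t s, t < s → |v t s| ≤ B * Real.exp (-(l * (s - t))))
    (hΘ : ContinuousOn (fun p : ℝ × ℝ => Θ p.1 p.2) (univ ×ˢ Ioi 0))
    (hΘb : ∀ t τ, 0 < τ → |Θ t τ| ≤ A * (1 + τ ^ (s₀ - 1)))
    (hd : ∀ t s, t < s → HasDerivAt (fun t => v t s) (Real.exp (-(l * (s - t))) * Θ t (s - t)) t)
    {t₁ t₂ : ℝ} (ht : t₁ ≤ t₂) :
    (∫ s in Ioi t₂, v t₂ s) - ∫ s in Ioi t₁, v t₁ s =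
      ∫ t in t₁..t₂, ((∫ τ in Ioi (0 : ℝ), Real.exp (-(l * τ)) * Θ t τ) - v t t) := by
  set W : ℝ → ℝ := fun τ => A * (Real.exp (-(l * τ)) * τ ^ ((1 : ℝ) - 1) +
    Real.exp (-(l * τ)) * τ ^ (s₀ - 1)) with hW
  have hWi : IntegrableOn W (Ioi 0) :=
    ((integrableOn_timeWeight hl one_pos).add (integrableOn_timeWeight hl hs₀)).const_mul A
  set h : ℝ × ℝ → ℝ := (Ioc t₁ t₂ ×ˢ Ioi (0 : ℝ)).indicator
    (fun p => Real.exp (-(l * p.2)) * Θ p.1 p.2) with hh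
  have hbW : ∀ t τ, 0 < τ → |Real.exp (-(l * τ)) * Θ t τ| ≤ W τ := fun t τ hτ => by
    rw [abs_mul, abs_of_pos (Real.exp_pos _)]
    calc _ ≤ Real.exp (-(l * τ)) * (A * (1 + τ ^ (s₀ - 1))) := by gcongr; exact hΘb t τ hτ
      _ = _ := by simp only [hW, sub_self, Real.rpow_zero]; ring
  have hcont : ContinuousOn (fun p : ℝ × ℝ => Real.exp (-(l * p.2)) * Θ p.1 p.2)
      (univ ×ˢ Ioi 0) := ContinuousOn.mul (by fun_prop) hΘ
  have hmeas : MeasurableSet (Ioc t₁ t₂ ×ˢ Ioi (0 : ℝ)) := measurableSet_Ioc.prod measurableSet_Ioi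
  have hkint : Integrable h := by
    rw [hh, integrable_indicator_iff hmeas]
    have e : (volume : Measure (ℝ × ℝ)).restrict (Ioc t₁ t₂ ×ˢ Ioi (0 : ℝ)) =
        (volume.restrict (Ioc t₁ t₂)).prod (volume.restrict (Ioi 0)) := by
      rw [Measure.prod_restrict]; rfl
    have h1 : Integrable (fun p : ℝ × ℝ => (1 : ℝ) * W p.2)
        ((volume.restrict (Ioc t₁ t₂)).prod (volume.restrict (Ioi 0))) :=
      Integrable.mul_prod (f := fun _ => (1 : ℝ)) (integrable_const _) hWi
    rw [← e] at h1
    refine Integrable.mono' h1 ((hcont.mono (prod_mono_left (subset_univ _))).aestronglyMeasurable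
      hmeas) ?_
    filter_upwards [ae_restrict_mem hmeas] with p hp
    rw [one_mul]
    exact hbW _ _ hp.2
  have hsh : Integrable (fun p : ℝ × ℝ => h (p.1, p.2 - p.1)) :=
    (measurePreserving_prod_sub (volume : Measure ℝ) (volume : Measure ℝ)).integrable_comp_of_integrable hkint
  have hswap : ∫ t, ∫ s, h (t, s - t) = ∫ s, ∫ t, h (t, s - t) :=
    integral_integral_swap (f := fun t s => h (t, s - t)) hsh
  have hval : ∀ t s, h (t, s - t) = (Ioc t₁ t₂ ∩ Iio s).indicator
      (fun t => Real.exp (-(l * (s - t))) * Θ t (s - t)) t := fun t s => by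
    simp only [hh, indicator, mem_prod, mem_Ioi, sub_pos, mem_inter_iff, mem_Iio]
  have hL : ∫ t, ∫ s, h (t, s - t) =
      ∫ t in t₁..t₂, ∫ τ in Ioi (0 : ℝ), Real.exp (-(l * τ)) * Θ t τ := by
    rw [intervalIntegral.integral_of_le ht, ← integral_indicator measurableSet_Ioc]
    congr 1
    ext t
    rw [integral_sub_right_eq_self (fun τ => h (t, τ)) t]
    by_cases htm : t ∈ Ioc t₁ t₂
    · rw [indicator_of_mem htm, ← integral_indicator measurableSet_Ioi]
      congr 1
      ext τ
      simp [hh, indicator, htm.1, htm.2]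
    · rw [indicator_of_notMem htm]
      have : ∀ τ, h (t, τ) = 0 := fun τ => indicator_of_notMem (fun hp => htm hp.1) _
      simp [this]
  have hslice : ∀ᵐ s, Integrable fun t => h (t, s - t) :=
    hsh.prod_left_ae
  have hR : ∀ᵐ s, ∫ t, h (t, s - t) = (Ioi t₁).indicator (fun s => v (min t₂ s) s - v t₁ s) s := by
    filter_upwards [hslice] with s hs
    by_cases hst : t₁ < s
    · have hab : t₁ ≤ min t₂ s := le_min ht hst.le
      rw [indicator_of_mem (show s ∈ Ioi t₁ from hst)]
      simp only [hval] at hs ⊢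
      have hms : MeasurableSet (Ioc t₁ t₂ ∩ Iio s) := measurableSet_Ioc.inter measurableSet_Iio
      rw [integrable_indicator_iff hms] at hs
      rw [integral_indicator hms]
      have hae : (Ioc t₁ t₂ ∩ Iio s : Set ℝ) =ᵐ[volume] Ioc t₁ (min t₂ s) := by
        have h1 : (Iio s : Set ℝ) =ᵐ[volume] Iic s := Iio_ae_eq_Iic
        have h2 : Ioc t₁ (min t₂ s) = Ioc t₁ t₂ ∩ Iic s := by
          ext t; simp only [mem_Ioc, mem_inter_iff, mem_Iic, le_min_iff]; tauto
        rw [h2]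
        exact (Filter.EventuallyEq.refl _ _).inter h1
      rw [setIntegral_congr_set hae, ← intervalIntegral.integral_of_le hab]
      refine intervalIntegral.integral_eq_sub_of_hasDerivAt_of_le hab
        (f := fun t => v t s) (by fun_prop) (fun t ht => hd t s (ht.2.trans_le (min_le_right _ _))) ?_
      rw [intervalIntegrable_iff_integrableOn_Ioc_of_le hab]
      exact (integrableOn_congr_set_ae hae).1 hs
    · rw [indicator_of_notMem (show s ∉ Ioi t₁ from hst)]
      have : ∀ t, h (t, s - t) = 0 := fun t => by
        rw [hval]
        exact indicator_of_notMem (fun hp => hst (hp.1.1.trans hp.2)) _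
      simp [this]
  have hvi : ∀ t, IntegrableOn (fun s => v t s) (Ioi t) := fun t => by
    have h1 : IntegrableOn (fun s => B * Real.exp (-(l * (s - t)))) (Ioi t) := by
      have h2 : ∀ s, B * Real.exp (-(l * (s - t))) = (B * Real.exp (l * t)) * Real.exp (-l * s) :=
        fun s => by rw [mul_assoc, ← Real.exp_add]; ring_nf
      simp only [h2]
      exact (integrableOn_exp_mul_Ioi (neg_lt_zero.2 hl) t).const_mul _
    refine Integrable.mono' h1 (Continuous.aestronglyMeasurable (by fun_prop)) ?_
    filter_upwards [ae_restrict_mem measurableSet_Ioi] with s hs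
    exact hvb t s hs
  have hsplit : Ioi t₁ = Ioc t₁ t₂ ∪ Ioi t₂ := (Ioc_union_Ioi_eq_Ioi ht).symm
  have hi1 : IntegrableOn (fun s => v (min t₂ s) s) (Ioc t₁ t₂) := by
    have : Continuous fun s => v (min t₂ s) s := by fun_prop
    exact this.integrableOn_Ioc
  have hi2 : IntegrableOn (fun s => v (min t₂ s) s) (Ioi t₂) :=
    (hvi t₂).congr_fun (fun s hs => by simp only [min_eq_left (le_of_lt (mem_Ioi.1 hs))])
      measurableSet_Ioi
  have hi12 : IntegrableOn (fun s => v (min t₂ s) s) (Ioi t₁) := by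
    rw [hsplit]; exact hi1.union hi2
  have e1 : ∫ s in Ioi t₁, v (min t₂ s) s = (∫ s in t₁..t₂, v s s) + ∫ s in Ioi t₂, v t₂ s := by
    have hdj : Disjoint (Ioc t₁ t₂) (Ioi t₂) :=
      Set.disjoint_left.2 fun s hs hs' => not_lt_of_ge hs.2 hs'
    rw [hsplit, setIntegral_union hdj measurableSet_Ioi hi1 hi2,
      intervalIntegral.integral_of_le ht]
    congr 1
    · exact setIntegral_congr_fun measurableSet_Ioc fun s hs => by simp only [min_eq_right hs.2]
    · exact setIntegral_congr_fun measurableSet_Ioi fun s hs => by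
        simp only [min_eq_left (le_of_lt (mem_Ioi.1 hs))]
  have e2 : ∫ s, ∫ t, h (t, s - t) = (∫ s in Ioi t₁, v (min t₂ s) s) - ∫ s in Ioi t₁, v t₁ s := by
    rw [integral_congr_ae hR, integral_indicator measurableSet_Ioi,
      integral_sub hi12 (hvi t₁)]
  have hUi : IntervalIntegrable (fun t => ∫ τ in Ioi (0 : ℝ), Real.exp (-(l * τ)) * Θ t τ)
      volume t₁ t₂ := by
    refine Continuous.intervalIntegrable ?_ _ _
    refine continuous_of_dominated (bound := W) (fun t => ?_) (fun t => ?_) hWi ?_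
    · refine ContinuousOn.aestronglyMeasurable ?_ measurableSet_Ioi
      exact ContinuousOn.comp (g := fun p : ℝ × ℝ => Real.exp (-(l * p.2)) * Θ p.1 p.2)
        (f := fun τ => (t, τ)) hcont (by fun_prop) (fun τ hτ => ⟨mem_univ _, hτ⟩)
    · filter_upwards [ae_restrict_mem measurableSet_Ioi] with τ hτ
      exact hbW t τ hτ
    · filter_upwards [ae_restrict_mem measurableSet_Ioi] with τ hτ
      exact ContinuousOn.comp_continuous (g := fun p : ℝ × ℝ => Real.exp (-(l * p.2)) * Θ p.1 p.2)
        (f := fun t => (t, τ)) hcont (by fun_prop) (fun q => ⟨mem_univ _, hτ⟩)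
  have hvd : IntervalIntegrable (fun t => v t t) volume t₁ t₂ :=
    Continuous.intervalIntegrable (by fun_prop) _ _
  rw [intervalIntegral.integral_sub hUi hvd, ← hL, hswap, e2, e1]
  ring

/-! ### Parabolic potentials -/

theorem inv_sqrt_eq_rpow {τ : ℝ} (hτ : 0 < τ) : (√τ)⁻¹ = τ ^ ((1 / 2 : ℝ) - 1) := by
  rw [Real.sqrt_eq_rpow, ← Real.rpow_neg hτ.le]; norm_num

theorem inv_mul_sqrt_sqrt {τ : ℝ} (hτ : 0 < τ) : τ⁻¹ * √√τ = τ ^ ((1 / 4 : ℝ) - 1) := by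
  rw [Real.sqrt_eq_rpow, Real.sqrt_eq_rpow, ← Real.rpow_mul hτ.le, ← Real.rpow_neg_one,
    ← Real.rpow_add hτ]
  norm_num

theorem inv_sqrt_mul_sqrt_div {τ d : ℝ} (hτ : 0 < τ) :
    (√τ)⁻¹ * √(d / √τ) = √d * τ ^ ((1 / 4 : ℝ) - 1) := by
  have h1 : √√τ ≠ 0 := (Real.sqrt_pos.2 (Real.sqrt_pos.2 hτ)).ne'
  have h2 : √√τ * √√τ = √τ := Real.mul_self_sqrt (Real.sqrt_nonneg _)
  have h3 : √τ * √τ = τ := Real.mul_self_sqrt hτ.le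
  rw [Real.sqrt_div' _ (Real.sqrt_nonneg _), ← inv_mul_sqrt_sqrt hτ]
  have h5 : τ⁻¹ = ((√√τ * √√τ) * (√√τ * √√τ))⁻¹ := by rw [h2, h3]
  have h6 : (√τ)⁻¹ = (√√τ * √√τ)⁻¹ := by rw [h2]
  rw [h5, h6]
  generalize √√τ = a at h1
  field_simp

theorem setIntegral_Ioi_sub_right (g : ℝ → ℝ) (t : ℝ) :
    ∫ s in Ioi t, g (s - t) = ∫ τ in Ioi (0 : ℝ), g τ := by
  rw [← integral_indicator measurableSet_Ioi, ← integral_indicator measurableSet_Ioi,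
    ← integral_sub_right_eq_self ((Ioi (0 : ℝ)).indicator g) t]
  congr 1
  ext s
  simp [indicator]

namespace Coef

variable {N : ℕ} (C : Coef N) {B l : ℝ} {f g : Euc N × ℝ → ℝ}

/-- The discounted Gaussian potential of `f`. -/
def Pot (l : ℝ) (f : Euc N × ℝ → ℝ) (q : Euc N × ℝ) : ℝ := tint l (gint C.p0 f) q

/-- The spatial gradient of the potential. -/
def DPot (l : ℝ) (f : Euc N × ℝ → ℝ) (q : Euc N × ℝ) : Euc N :=
  tint l (fun q τ => (√τ)⁻¹ • gint C.p1 f q τ) q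

/-- The spatial Hessian of the potential. -/
def D2Pot (l : ℝ) (f : Euc N × ℝ → ℝ) (q : Euc N × ℝ) : Euc N →L[ℝ] Euc N :=
  tint l (fun q τ => τ⁻¹ • gint C.p2 f q τ) q

/-- The parametrix error operator. -/
def KPot (l : ℝ) (f : Euc N × ℝ → ℝ) (q : Euc N × ℝ) : ℝ :=
  tint l (fun q τ => (2 * τ)⁻¹ * C.gK f q τ) q

theorem norm_gint_le_G {F : Type*} [NormedAddCommGroup F] [NormedSpace ℝ F]
    {k : Euc N × ℝ → Euc N → F} (hk : IsGaussKernel C.κ C.M k) (hb : ∀ q, |f q| ≤ B) (q τ) :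
    ‖gint k f q τ‖ ≤ B * C.G :=
  (norm_gint_le hk C.κ_pos hb q τ).trans (le_of_eq (by unfold G; ring))

theorem tk0 (hf : Continuous f) (hb : ∀ q, |f q| ≤ B) :
    IsTimeKernel (gint C.p0 f) (B * C.G) 1 := by
  refine ⟨(continuous_gint C.gk0 C.κ_pos hf hb).continuousOn, fun q τ hτ => ?_⟩
  rw [sub_self, Real.rpow_zero, mul_one]
  exact C.norm_gint_le_G C.gk0 hb q τ

theorem tk1 (hf : Continuous f) (hb : ∀ q, |f q| ≤ B) :
    IsTimeKernel (fun q τ => (√τ)⁻¹ • gint C.p1 f q τ) (B * C.G) (1 / 2) := by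
  refine ⟨ContinuousOn.fun_smul ?_ (continuous_gint C.gk1 C.κ_pos hf hb).continuousOn,
    fun q τ hτ => ?_⟩
  · refine ContinuousOn.inv₀ (by fun_prop) fun p hp => (Real.sqrt_pos.2 hp.2).ne'
  · rw [norm_smul, Real.norm_of_nonneg (by positivity), ← inv_sqrt_eq_rpow hτ, mul_comm]
    have := C.norm_gint_le_G C.gk1 hb q τ
    gcongr

theorem tk2 (hf : Continuous f) (hb : ∀ q, |f q| ≤ B)
    (hh : ∀ x x' t, |f (x, t) - f (x', t)| ≤ B * √‖x - x'‖) :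
    IsTimeKernel (fun q τ => τ⁻¹ • gint C.p2 f q τ) (2 * B * C.G) (1 / 4) := by
  refine ⟨ContinuousOn.fun_smul ?_ (continuous_gint C.gk2 C.κ_pos hf hb).continuousOn,
    fun q τ hτ => ?_⟩
  · refine ContinuousOn.inv₀ (by fun_prop) fun p hp => (mem_Ioi.1 hp.2).ne'
  · rw [norm_smul, Real.norm_of_nonneg (by positivity), ← inv_mul_sqrt_sqrt hτ]
    have := C.norm_gint_p2_le hf hb hh q hτ
    calc _ ≤ τ⁻¹ * (2 * B * C.G * √√τ) := by gcongr
      _ = _ := by ring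

theorem continuous_gK (hf : Continuous f) (hb : ∀ q, |f q| ≤ B) :
    Continuous fun p : (Euc N × ℝ) × ℝ => C.gK f p.1 p.2 := by
  have h1 := C.continuous_tr
  have h2 := continuous_gint C.gk2 C.κ_pos hf hb
  have h3 := continuous_gint C.gk3 C.κ_pos hf hb
  unfold gK
  exact ((h1.comp continuous_fst).clm_apply h2).sub h3

theorem tkK (hf : Continuous f) (hb : ∀ q, |f q| ≤ B) :
    IsTimeKernel (fun q τ => (2 * τ)⁻¹ * C.gK f q τ) (C.Λ * B * C.G) (1 / 2) := by
  refine ⟨ContinuousOn.mul ?_ (C.continuous_gK hf hb).continuousOn, fun q τ hτ => ?_⟩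
  · refine ContinuousOn.inv₀ (by fun_prop) fun p hp => ?_
    have := mem_Ioi.1 hp.2
    positivity
  · rw [norm_mul, Real.norm_of_nonneg (by positivity), ← inv_sqrt_eq_rpow hτ]
    have h1 := C.abs_gK_le hf hb q hτ.le
    have hs := Real.sqrt_pos.2 hτ
    have h2 : τ = √τ * √τ := (Real.mul_self_sqrt hτ.le).symm
    calc _ ≤ (2 * τ)⁻¹ * (2 * C.Λ * B * C.G * √τ) := by gcongr; exact h1
      _ = C.Λ * B * C.G * (τ⁻¹ * √τ) := by field_simp
      _ = _ := by
        congr 1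
        nth_rw 1 [h2]
        field_simp

theorem continuous_Pot (hl : 0 < l) (hf : Continuous f) (hb : ∀ q, |f q| ≤ B) :
    Continuous (C.Pot l f) := (C.tk0 hf hb).continuous_tint one_pos hl

theorem continuous_DPot (hl : 0 < l) (hf : Continuous f) (hb : ∀ q, |f q| ≤ B) :
    Continuous (C.DPot l f) := (C.tk1 hf hb).continuous_tint (by norm_num) hl

theorem continuous_KPot (hl : 0 < l) (hf : Continuous f) (hb : ∀ q, |f q| ≤ B) :
    Continuous (C.KPot l f) := (C.tkK hf hb).continuous_tint (by norm_num) hl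

theorem continuous_D2Pot (hl : 0 < l) (hf : Continuous f) (hb : ∀ q, |f q| ≤ B)
    (hh : ∀ x x' t, |f (x, t) - f (x', t)| ≤ B * √‖x - x'‖) :
    Continuous (C.D2Pot l f) := (C.tk2 hf hb hh).continuous_tint (by norm_num) hl

theorem Pot_sub (hl : 0 < l) (hf : Continuous f) (hb : ∀ q, |f q| ≤ B) (hg : Continuous g)
    {B' : ℝ} (hb' : ∀ q, |g q| ≤ B') (q) :
    C.Pot l (fun q => f q - g q) q = C.Pot l f q - C.Pot l g q := by
  unfold Pot
  rw [← tint_sub (C.tk0 hf hb) (C.tk0 hg hb') one_pos hl]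
  congr 1
  ext q τ
  exact gint_sub C.gk0 C.κ_pos hf hg hb hb' q τ

theorem DPot_sub (hl : 0 < l) (hf : Continuous f) (hb : ∀ q, |f q| ≤ B) (hg : Continuous g)
    {B' : ℝ} (hb' : ∀ q, |g q| ≤ B') (q) :
    C.DPot l (fun q => f q - g q) q = C.DPot l f q - C.DPot l g q := by
  unfold DPot
  rw [← tint_sub (C.tk1 hf hb) (C.tk1 hg hb') (by norm_num) hl]
  congr 1
  funext q τ
  rw [gint_sub C.gk1 C.κ_pos hf hg hb hb' q τ, smul_sub]

theorem KPot_sub (hl : 0 < l) (hf : Continuous f) (hb : ∀ q, |f q| ≤ B) (hg : Continuous g)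
    {B' : ℝ} (hb' : ∀ q, |g q| ≤ B') (q) :
    C.KPot l (fun q => f q - g q) q = C.KPot l f q - C.KPot l g q := by
  unfold KPot
  rw [← tint_sub (C.tkK hf hb) (C.tkK hg hb') (by norm_num) hl]
  congr 1
  funext q τ
  unfold gK
  rw [gint_sub C.gk2 C.κ_pos hf hg hb hb' q τ, gint_sub C.gk3 C.κ_pos hf hg hb hb' q τ, map_sub]
  ring

/-- A common constant for all potential estimates with discount rate at least one. -/
def c1 : ℝ := 2 * (1 + C.Λ) * C.G * (1 + Real.Gamma (1 / 2) + Real.Gamma (1 / 4))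

theorem c1_nonneg : 0 ≤ C.c1 := by
  have := C.Λ_pos
  have := C.G_nonneg
  have := Real.Gamma_pos_of_pos (s := 1 / 2) (by norm_num)
  have := Real.Gamma_pos_of_pos (s := 1 / 4) (by norm_num)
  unfold c1
  positivity

theorem mul_le_c1 {a : ℝ} {γ r : ℝ} (hB : 0 ≤ B) (hr : 0 ≤ r) (ha : a ≤ 2 * (1 + C.Λ))
    (hγ0 : 0 ≤ γ) (hγ : γ ≤ 1 + Real.Gamma (1 / 2) + Real.Gamma (1 / 4)) :
    a * B * C.G * (γ * r) ≤ B * C.c1 * r := by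
  have hΛ := C.Λ_pos
  have hG := C.G_nonneg
  have : a * γ ≤ 2 * (1 + C.Λ) * (1 + Real.Gamma (1 / 2) + Real.Gamma (1 / 4)) :=
    mul_le_mul ha hγ hγ0 (by positivity)
  calc _ = B * C.G * r * (a * γ) := by ring
    _ ≤ B * C.G * r * (2 * (1 + C.Λ) * (1 + Real.Gamma (1 / 2) + Real.Gamma (1 / 4))) := by gcongr
    _ = _ := by unfold c1; ring

theorem timeMass_one (hl : 0 < l) : timeMass l 1 = 1 * (1 / l) := by
  simp [timeMass]

theorem timeMass_half (hl : 0 < l) : timeMass l (1 / 2) = Real.Gamma (1 / 2) * (1 / √l) := by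
  unfold timeMass
  rw [Real.div_rpow zero_le_one hl.le, Real.one_rpow, Real.sqrt_eq_rpow]; ring

theorem timeMass_quarter_le (hl : 1 ≤ l) : timeMass l (1 / 4) ≤ Real.Gamma (1 / 4) := by
  unfold timeMass
  have := Real.Gamma_pos_of_pos (s := 1 / 4) (by norm_num)
  refine mul_le_of_le_one_left this.le (Real.rpow_le_one (by positivity) ?_ (by norm_num))
  rw [div_le_one (by linarith)]; exact hl

theorem abs_Pot_le (hl : 0 < l) (hf : Continuous f) (hb : ∀ q, |f q| ≤ B) (q) :
    |C.Pot l f q| ≤ B * C.c1 * (1 / l) := by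
  have h := norm_tint_le (C.tk0 hf hb).bound one_pos hl q
  have h1 := Real.Gamma_pos_of_pos (s := 1 / 2) (by norm_num)
  have h2 := Real.Gamma_pos_of_pos (s := 1 / 4) (by norm_num)
  rw [timeMass_one hl] at h
  have := C.Λ_pos
  have h3 := C.mul_le_c1 (a := 1) (γ := 1) ((abs_nonneg _).trans (hb 0))
    (by positivity : 0 ≤ 1 / l) (by linarith) zero_le_one (by linarith)
  rw [one_mul] at h3
  exact h.trans h3

theorem norm_DPot_le (hl : 0 < l) (hf : Continuous f) (hb : ∀ q, |f q| ≤ B) (q) :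
    ‖C.DPot l f q‖ ≤ B * C.c1 * (1 / √l) := by
  have h := norm_tint_le (C.tk1 hf hb).bound (by norm_num) hl q
  have h1 := Real.Gamma_pos_of_pos (s := 1 / 2) (by norm_num)
  have h2 := Real.Gamma_pos_of_pos (s := 1 / 4) (by norm_num)
  rw [timeMass_half hl] at h
  have := C.Λ_pos
  have h3 := C.mul_le_c1 (a := 1) ((abs_nonneg _).trans (hb 0))
    (by positivity : 0 ≤ 1 / √l) (by linarith) h1.le (by linarith)
  rw [one_mul] at h3
  exact h.trans h3

theorem abs_KPot_le (hl : 0 < l) (hf : Continuous f) (hb : ∀ q, |f q| ≤ B) (q) :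
    |C.KPot l f q| ≤ B * C.c1 * (1 / √l) := by
  have h := norm_tint_le (C.tkK hf hb).bound (by norm_num) hl q
  have h1 := Real.Gamma_pos_of_pos (s := 1 / 2) (by norm_num)
  have h2 := Real.Gamma_pos_of_pos (s := 1 / 4) (by norm_num)
  rw [timeMass_half hl] at h
  have := C.Λ_pos
  exact h.trans (C.mul_le_c1 ((abs_nonneg _).trans (hb 0))
    (by positivity : 0 ≤ 1 / √l) (by linarith) h1.le (by linarith))

theorem norm_DPot_sub_le (hl : 1 ≤ l) (hf : Continuous f) (hb : ∀ q, |f q| ≤ B) (x x' t) :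
    ‖C.DPot l f (x, t) - C.DPot l f (x', t)‖ ≤ B * C.c1 * √‖x - x'‖ := by
  have hB := (abs_nonneg _).trans (hb 0)
  have hG := C.G_nonneg
  have h1 := Real.Gamma_pos_of_pos (s := 1 / 2) (by norm_num)
  have h2 := Real.Gamma_pos_of_pos (s := 1 / 4) (by norm_num)
  have := C.Λ_pos
  have h := norm_tint_sub_le (C.tk1 hf hb) (by norm_num) (by linarith : 0 < l)
    (q := (x, t)) (q' := (x', t)) (D := 2 * B * C.G * √‖x - x'‖) (r := 1 / 4) (by norm_num)
    (fun τ hτ => by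
      rw [← smul_sub, norm_smul, Real.norm_of_nonneg (by positivity)]
      have h1 := norm_gint_sub_le_sqrt C.gk1 C.κ_pos hf hb x x' t hτ
      calc _ ≤ (√τ)⁻¹ * (2 * (B * C.M * gaussMass N C.κ) * √(‖x - x'‖ / √τ)) := by gcongr
        _ = 2 * B * C.G * ((√τ)⁻¹ * √(‖x - x'‖ / √τ)) := by unfold G; ring
        _ = _ := by rw [inv_sqrt_mul_sqrt_div hτ]; ring)
  refine h.trans ?_
  calc _ ≤ 2 * B * C.G * √‖x - x'‖ * Real.Gamma (1 / 4) := by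
        gcongr; exact timeMass_quarter_le hl
    _ = 2 * B * C.G * (Real.Gamma (1 / 4) * √‖x - x'‖) := by ring
    _ ≤ _ := C.mul_le_c1 hB (Real.sqrt_nonneg _) (by linarith) h2.le (by linarith)

theorem abs_KPot_sub_le (hl : 1 ≤ l) (hf : Continuous f) (hb : ∀ q, |f q| ≤ B) (x x' t) :
    |C.KPot l f (x, t) - C.KPot l f (x', t)| ≤ B * C.c1 * √‖x - x'‖ := by
  have hB := (abs_nonneg _).trans (hb 0)
  have hG := C.G_nonneg
  have h1 := Real.Gamma_pos_of_pos (s := 1 / 2) (by norm_num)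
  have h2 := Real.Gamma_pos_of_pos (s := 1 / 4) (by norm_num)
  have := C.Λ_pos
  have h := norm_tint_sub_le (C.tkK hf hb) (by norm_num) (by linarith : 0 < l)
    (q := (x, t)) (q' := (x', t)) (D := 2 * C.Λ * B * C.G * √‖x - x'‖) (r := 1 / 4) (by norm_num)
    (fun τ hτ => by
      rw [← mul_sub, norm_mul, Real.norm_of_nonneg (by positivity)]
      have h1 := C.abs_gK_sub_le_sqrt hf hb x x' t hτ
      have hs := Real.sqrt_pos.2 hτ
      have h2 : τ = √τ * √τ := (Real.mul_self_sqrt hτ.le).symm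
      calc _ ≤ (2 * τ)⁻¹ * (4 * C.Λ * B * C.G * (√τ * √(‖x - x'‖ / √τ))) := by
            gcongr; exact h1
        _ = 2 * C.Λ * B * C.G * (τ⁻¹ * √τ * √(‖x - x'‖ / √τ)) := by field_simp; ring
        _ = 2 * C.Λ * B * C.G * ((√τ)⁻¹ * √(‖x - x'‖ / √τ)) := by
            congr 2
            nth_rw 1 [h2]
            field_simp
        _ = _ := by rw [inv_sqrt_mul_sqrt_div hτ]; ring)
  refine h.trans ?_
  calc _ ≤ 2 * C.Λ * B * C.G * √‖x - x'‖ * Real.Gamma (1 / 4) := by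
        gcongr; exact timeMass_quarter_le hl
    _ = 2 * C.Λ * B * C.G * (Real.Gamma (1 / 4) * √‖x - x'‖) := by ring
    _ ≤ _ := C.mul_le_c1 hB (Real.sqrt_nonneg _) (by linarith) h2.le (by linarith)

theorem isTimeKernel_slice {F : Type*} [NormedAddCommGroup F] {Ψ : Euc N × ℝ → ℝ → F} {A s : ℝ}
    (h : IsTimeKernel Ψ A s) (t : ℝ) : IsTimeKernel (fun x τ => Ψ (x, t) τ) A s := by
  refine ⟨?_, fun q τ hτ => h.bound _ τ hτ⟩
  exact ContinuousOn.comp (g := fun p : (Euc N × ℝ) × ℝ => Ψ p.1 p.2)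
    (f := fun p : Euc N × ℝ => ((p.1, t), p.2)) h.cont (by fun_prop) (fun p hp => ⟨mem_univ _, hp.2⟩)

theorem hasFDerivAt_Pot (hl : 0 < l) (hf : Continuous f) (hb : ∀ q, |f q| ≤ B) (x t) :
    HasFDerivAt (fun x => C.Pot l f (x, t)) (innerSL ℝ (C.DPot l f (x, t))) x := by
  have k0 := isTimeKernel_slice (C.tk0 hf hb) t
  have k1 := isTimeKernel_slice (C.tk1 hf hb) t
  have k1' : IsTimeKernel (fun x τ => innerSL ℝ ((√τ)⁻¹ • gint C.p1 f (x, t) τ)) (B * C.G)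
      (1 / 2) :=
    ⟨(innerSL ℝ).continuous.comp_continuousOn k1.cont, fun q τ hτ => by
      rw [innerSL_apply_norm]; exact k1.bound q τ hτ⟩
  have h := hasFDerivAt_tint k0 one_pos hl k1' (by norm_num)
    (fun x τ hτ => C.hasFDerivAt_gint_p0 hf hb x t hτ) x
  refine HasFDerivAt.congr_fderiv h ?_
  have h2 := ContinuousLinearMap.integral_comp_comm (innerSL ℝ (E := Euc N))
    (k1.integrableOn (by norm_num) hl x)
  simp only [map_smul] at h2
  unfold DPot tint
  simp only [map_smul]
  exact h2

theorem hasFDerivAt_DPot (hl : 0 < l) (hf : Continuous f) (hb : ∀ q, |f q| ≤ B)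
    (hh : ∀ x x' t, |f (x, t) - f (x', t)| ≤ B * √‖x - x'‖) (x t) :
    HasFDerivAt (fun x => C.DPot l f (x, t)) (C.D2Pot l f (x, t)) x := by
  have k1 := isTimeKernel_slice (C.tk1 hf hb) t
  have k2 := isTimeKernel_slice (C.tk2 hf hb hh) t
  refine hasFDerivAt_tint k1 (by norm_num) hl k2 (by norm_num) (fun x τ hτ => ?_) x
  have h := (C.hasFDerivAt_gint_p1 hf hb x t hτ).fun_const_smul (√τ)⁻¹
  refine HasFDerivAt.congr_fderiv h ?_
  rw [smul_smul, ← mul_inv, Real.mul_self_sqrt hτ.le]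

theorem gint_p0_zero (q) : gint C.p0 f q 0 = f q := by
  have : ∀ z, shiftPt q 0 z = q := fun z => by simp [shiftPt]
  simp [gint, this, integral_const_mul, C.integral_p0]

theorem hasDerivAt_Pot (hl : 0 < l) (hf : Continuous f) (hb : ∀ q, |f q| ≤ B)
    (hh : ∀ x x' t, |f (x, t) - f (x', t)| ≤ B * √‖x - x'‖) (x t) :
    HasDerivAt (fun t => C.Pot l f (x, t))
      (l * C.Pot l f (x, t) - 1 / 2 * C.tr (x, t) (C.D2Pot l f (x, t)) + C.KPot l f (x, t) -
        f (x, t)) t := by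
  have hB := (abs_nonneg _).trans (hb 0)
  have hG := C.G_nonneg
  have hΛ := C.Λ_pos
  have k0 := C.tk0 hf hb
  have k2 := C.tk2 hf hb hh
  have kK := C.tkK hf hb
  have c0 := continuous_gint C.gk0 C.κ_pos hf hb
  set v : ℝ → ℝ → ℝ := fun t s => Real.exp (-(l * (s - t))) * gint C.p0 f (x, t) (s - t) with hv
  set Θ : ℝ → ℝ → ℝ := fun t τ => l * gint C.p0 f (x, t) τ -
    1 / 2 * C.tr (x, t) (τ⁻¹ • gint C.p2 f (x, t) τ) + (2 * τ)⁻¹ * C.gK f (x, t) τ with hΘ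
  have hpt : ContinuousOn (fun p : ℝ × ℝ => (((x, p.1), p.2) : (Euc N × ℝ) × ℝ))
    (univ ×ˢ Ioi 0) := by fun_prop
  have hpm : MapsTo (fun p : ℝ × ℝ => (((x, p.1), p.2) : (Euc N × ℝ) × ℝ)) (univ ×ˢ Ioi 0)
    (univ ×ˢ Ioi 0) := fun p hp => ⟨mem_univ _, hp.2⟩
  have hU : ∀ t, ∫ τ in Ioi (0 : ℝ), Real.exp (-(l * τ)) * Θ t τ =
      l * C.Pot l f (x, t) - 1 / 2 * C.tr (x, t) (C.D2Pot l f (x, t)) + C.KPot l f (x, t) := by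
    intro t
    have i0 := k0.integrableOn one_pos hl (x, t)
    have i2 := k2.integrableOn (by norm_num) hl (x, t)
    have i2' := (C.tr (x, t)).integrable_comp i2
    have iK := kK.integrableOn (by norm_num) hl (x, t)
    have e2 : C.tr (x, t) (C.D2Pot l f (x, t)) =
        ∫ τ in Ioi (0 : ℝ), C.tr (x, t) (Real.exp (-(l * τ)) • τ⁻¹ • gint C.p2 f (x, t) τ) :=
      (ContinuousLinearMap.integral_comp_comm _ i2).symm
    rw [e2]
    unfold Pot KPot tint
    have i02 := (i0.const_mul l).sub (i2'.const_mul (1 / 2))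
    have hadd := integral_add i02 iK
    have hsub := integral_sub (i0.const_mul l) (i2'.const_mul (1 / 2))
    rw [← integral_const_mul, ← integral_const_mul, ← hsub]
    refine Eq.trans ?_ hadd
    congr 1
    ext τ
    simp only [hΘ, map_smul, smul_eq_mul, Pi.sub_apply]
    ring
  have key : ∀ t₁ t₂, t₁ ≤ t₂ → C.Pot l f (x, t₂) - C.Pot l f (x, t₁) = ∫ t in t₁..t₂,
      (l * C.Pot l f (x, t) - 1 / 2 * C.tr (x, t) (C.D2Pot l f (x, t)) + C.KPot l f (x, t) -
        f (x, t)) := by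
    intro t₁ t₂ ht
    have hvP : ∀ t, ∫ s in Ioi t, v t s = C.Pot l f (x, t) := fun t =>
      setIntegral_Ioi_sub_right (fun τ => Real.exp (-(l * τ)) * gint C.p0 f (x, t) τ) t
    have h := integral_slices_sub (v := v) (Θ := Θ) (A := B * C.G * (l + 2 * C.Λ + 1))
      (B := B * C.G) (s₀ := 1 / 4) hl (by norm_num) ?_ ?_ ?_ ?_ ?_ ht
    · rw [hvP, hvP] at h
      rw [h]
      congr 1
      ext t
      rw [hU]
      congr 1
      simp [hv, C.gint_p0_zero]
    · exact Continuous.mul (by fun_prop) (Continuous.comp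
        (g := fun p : (Euc N × ℝ) × ℝ => gint C.p0 f p.1 p.2)
        (f := fun p : ℝ × ℝ => ((x, p.1), p.2 - p.1)) c0 (by fun_prop))
    · intro t s _
      rw [abs_mul, abs_of_pos (Real.exp_pos _), mul_comm]
      have := C.norm_gint_le_G C.gk0 hb (x, t) (s - t)
      gcongr
      exact this
    · have a0 := k0.cont.comp hpt hpm
      have a2 := k2.cont.comp hpt hpm
      have aK := kK.cont.comp hpt hpm
      have at' : ContinuousOn (fun p : ℝ × ℝ => C.tr (x, p.1)) (univ ×ˢ Ioi 0) :=
        (C.continuous_tr.comp (by fun_prop : Continuous fun p : ℝ × ℝ => (x, p.1))).continuousOn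
      exact ((a0.const_mul l).sub ((at'.clm_apply a2).const_mul _)).add aK
    · intro t τ hτ
      have b0 := C.norm_gint_le_G C.gk0 hb (x, t) τ
      have b2 := (C.tr (x, t)).le_of_opNorm_le (C.tr_le _) (τ⁻¹ • gint C.p2 f (x, t) τ)
      have b2' := k2.bound (x, t) τ hτ
      have bK := kK.bound (x, t) τ hτ
      have hw : τ ^ ((1 / 2 : ℝ) - 1) ≤ 1 + τ ^ ((1 / 4 : ℝ) - 1) := by
        have p1 := Real.rpow_pos_of_pos hτ ((1 / 2 : ℝ) - 1)
        have p2 := Real.rpow_pos_of_pos hτ ((1 / 4 : ℝ) - 1)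
        rcases le_total 1 τ with h | h
        · have := Real.rpow_le_one_of_one_le_of_nonpos h (by norm_num : (1 / 2 : ℝ) - 1 ≤ 0)
          linarith
        · have := Real.rpow_le_rpow_of_exponent_ge hτ h
            (by norm_num : (1 / 4 : ℝ) - 1 ≤ (1 / 2 : ℝ) - 1)
          linarith
      rw [Real.norm_eq_abs] at b0 b2 bK
      have p2 := Real.rpow_pos_of_pos hτ ((1 / 4 : ℝ) - 1)
      calc |Θ t τ| ≤ l * (B * C.G) + 1 / 2 * (C.Λ * (2 * B * C.G * τ ^ ((1 / 4 : ℝ) - 1))) +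
            C.Λ * B * C.G * (1 + τ ^ ((1 / 4 : ℝ) - 1)) := by
            refine (abs_add_le _ _).trans (add_le_add ((abs_sub _ _).trans (add_le_add ?_ ?_)) ?_)
            · rw [abs_mul, abs_of_pos hl]; gcongr
            · rw [abs_mul, abs_of_pos (by norm_num : (0 : ℝ) < 1 / 2)]
              gcongr
              exact b2.trans (by gcongr)
            · exact bK.trans (by gcongr)
        _ ≤ _ := by
            have h1 : 0 ≤ B * C.G := by positivity
            have h2 : 0 ≤ B * C.G * C.Λ := by positivity
            have h3 := mul_nonneg h1 p2.le
            have h4 := mul_nonneg h3 hl.le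
            nlinarith
    · intro t s hst
      have h1 : HasDerivAt (fun t => Real.exp (-(l * (s - t))))
          (Real.exp (-(l * (s - t))) * l) t := by
        have := (((hasDerivAt_id t).const_sub s).const_mul l).neg.exp
        refine HasDerivAt.congr_deriv this ?_
        simp
      have h2 := h1.mul (C.hasDerivAt_gint_p0 hf hb x hst)
      refine HasDerivAt.congr_deriv h2 ?_
      have hne : s - t ≠ 0 := (sub_pos.2 hst).ne'
      simp only [hΘ, gK, map_smul, smul_eq_mul]
      field_simp
      ring
  have hcont : Continuous fun t => l * C.Pot l f (x, t) -
      1 / 2 * C.tr (x, t) (C.D2Pot l f (x, t)) + C.KPot l f (x, t) - f (x, t) := by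
    have c0 := C.continuous_Pot hl hf hb
    have c2 := C.continuous_D2Pot hl hf hb hh
    have cK := C.continuous_KPot hl hf hb
    have ct := C.continuous_tr
    fun_prop
  have hd := intervalIntegral.integral_hasDerivAt_right (a := t - 1) (b := t)
    (hcont.intervalIntegrable _ _) (hcont.stronglyMeasurableAtFilter _ _) hcont.continuousAt
  have hd2 := hd.const_add (C.Pot l f (x, t - 1))
  refine HasDerivAt.congr_of_eventuallyEq hd2 ?_
  filter_upwards [Ioi_mem_nhds (by linarith : t - 1 < t)] with s hs
  rw [← key (t - 1) s (le_of_lt hs)]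
  ring

end Coef

/-! ### Hölder functions and the semilinear equation -/

/-- Boundedness and `1/2`-Hölder continuity in the space variable on `U`. -/
def Hol {N : ℕ} {F : Type*} [NormedAddCommGroup F] (U : Set (Euc N × ℝ)) (φ : Euc N × ℝ → F) :
    Prop :=
  ∃ K, (∀ q ∈ U, ‖φ q‖ ≤ K) ∧
    ∀ x x' t, (x, t) ∈ U → (x', t) ∈ U → ‖φ (x, t) - φ (x', t)‖ ≤ K * √‖x - x'‖

section Hol

variable {N : ℕ} {F G H : Type*} [NormedAddCommGroup F] [NormedAddCommGroup G]
  [NormedAddCommGroup H] {U V : Set (Euc N × ℝ)} {φ ψ : Euc N × ℝ → F}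

theorem le_two_mul_sqrt {d b r : ℝ} (hb : 0 ≤ b) (hr : 0 ≤ r) (h1 : d ≤ 2 * b) (h2 : d ≤ b * r) :
    d ≤ 2 * b * √r := by
  have h0 := Real.sqrt_nonneg r
  have hs := Real.mul_self_sqrt hr
  rcases le_total (√r) 1 with h | h
  · have : r ≤ √r := by nlinarith
    nlinarith [mul_le_mul_of_nonneg_left this hb, mul_nonneg hb h0]
  · nlinarith [mul_le_mul_of_nonneg_left h hb]

theorem Hol.of_bounds {K₁ K₂ : ℝ} (h1 : ∀ q ∈ U, ‖φ q‖ ≤ K₁)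
    (h2 : ∀ x x' t, (x, t) ∈ U → (x', t) ∈ U → ‖φ (x, t) - φ (x', t)‖ ≤ K₂ * √‖x - x'‖) :
    Hol U φ := by
  refine ⟨max K₁ K₂, fun q hq => (h1 q hq).trans (le_max_left _ _), fun x x' t hx hx' => ?_⟩
  refine (h2 x x' t hx hx').trans ?_
  gcongr
  exact le_max_right _ _

theorem Hol.of_lip {K₁ K₂ : ℝ} (h1 : ∀ q ∈ U, ‖φ q‖ ≤ K₁)
    (h2 : ∀ x x' t, (x, t) ∈ U → (x', t) ∈ U → ‖φ (x, t) - φ (x', t)‖ ≤ K₂ * ‖x - x'‖) :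
    Hol U φ := by
  refine Hol.of_bounds h1 (K₂ := 2 * max K₁ K₂) fun x x' t hx hx' => ?_
  have h0 : 0 ≤ K₁ := (norm_nonneg _).trans (h1 _ hx)
  refine le_two_mul_sqrt (h0.trans (le_max_left _ _)) (norm_nonneg _) ?_ ?_
  · have := norm_sub_le (φ (x, t)) (φ (x', t))
    have := h1 _ hx
    have := h1 _ hx'
    have := le_max_left K₁ K₂
    linarith
  · refine (h2 x x' t hx hx').trans ?_
    gcongr
    exact le_max_right _ _

theorem Hol.exists_nonneg (h : Hol U φ) : ∃ K, 0 ≤ K ∧ (∀ q ∈ U, ‖φ q‖ ≤ K) ∧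
    ∀ x x' t, (x, t) ∈ U → (x', t) ∈ U → ‖φ (x, t) - φ (x', t)‖ ≤ K * √‖x - x'‖ := by
  obtain ⟨K, h1, h2⟩ := h
  refine ⟨max K 0, le_max_right _ _, fun q hq => (h1 q hq).trans (le_max_left _ _),
    fun x x' t hx hx' => (h2 x x' t hx hx').trans ?_⟩
  gcongr
  exact le_max_left _ _

theorem Hol.mono (h : Hol U φ) (hVU : V ⊆ U) : Hol V φ := by
  obtain ⟨K, h1, h2⟩ := h
  exact ⟨K, fun q hq => h1 q (hVU hq), fun x x' t hx hx' => h2 x x' t (hVU hx) (hVU hx')⟩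

theorem Hol.congr (h : Hol U φ) (he : ∀ q ∈ U, ψ q = φ q) : Hol U ψ := by
  obtain ⟨K, h1, h2⟩ := h
  exact ⟨K, fun q hq => by rw [he q hq]; exact h1 q hq,
    fun x x' t hx hx' => by rw [he _ hx, he _ hx']; exact h2 x x' t hx hx'⟩

theorem Hol.const (c : F) : Hol U fun _ => c :=
  Hol.of_lip (K₁ := ‖c‖) (K₂ := 0) (fun _ _ => le_rfl) (by simp)

theorem Hol.add (hφ : Hol U φ) (hψ : Hol U ψ) : Hol U fun q => φ q + ψ q := by
  obtain ⟨K, h1, h2⟩ := hφ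
  obtain ⟨K', h1', h2'⟩ := hψ
  refine ⟨K + K', fun q hq => (norm_add_le _ _).trans (add_le_add (h1 q hq) (h1' q hq)),
    fun x x' t hx hx' => ?_⟩
  rw [add_sub_add_comm, add_mul]
  exact (norm_add_le _ _).trans (add_le_add (h2 x x' t hx hx') (h2' x x' t hx hx'))

theorem Hol.neg (hφ : Hol U φ) : Hol U fun q => -φ q := by
  obtain ⟨K, h1, h2⟩ := hφ
  refine ⟨K, fun q hq => by rw [norm_neg]; exact h1 q hq, fun x x' t hx hx' => ?_⟩
  rw [neg_sub_neg, norm_sub_rev]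
  exact h2 x x' t hx hx'

theorem Hol.sub (hφ : Hol U φ) (hψ : Hol U ψ) : Hol U fun q => φ q - ψ q :=
  (hφ.add hψ.neg).congr fun q _ => sub_eq_add_neg _ _

variable [NormedSpace ℝ F] [NormedSpace ℝ G] [NormedSpace ℝ H]

theorem norm_bilin_sub_le (b : F →L[ℝ] G →L[ℝ] H) (u u' : F) (v v' : G) :
    ‖b u v - b u' v'‖ ≤ ‖b‖ * ‖u - u'‖ * ‖v‖ + ‖b‖ * ‖u'‖ * ‖v - v'‖ := by
  have e : b u v - b u' v' = b (u - u') v + b u' (v - v') := by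
    simp only [map_sub, _root_.sub_apply]
    abel
  rw [e]
  exact (norm_add_le _ _).trans (add_le_add (b.le_opNorm₂ _ _) (b.le_opNorm₂ _ _))

theorem Hol.bilin (b : F →L[ℝ] G →L[ℝ] H) {ψ : Euc N × ℝ → G} (hφ : Hol U φ) (hψ : Hol U ψ) :
    Hol U fun q => b (φ q) (ψ q) := by
  obtain ⟨K, h0, h1, h2⟩ := hφ.exists_nonneg
  obtain ⟨K', h0', h1', h2'⟩ := hψ.exists_nonneg
  refine Hol.of_bounds (K₁ := ‖b‖ * K * K') (K₂ := ‖b‖ * K * K' + ‖b‖ * K * K')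
    (fun q hq => (b.le_opNorm₂ _ _).trans ?_) fun x x' t hx hx' => ?_
  · have := h1 q hq
    have := h1' q hq
    gcongr
  · refine (norm_bilin_sub_le b _ _ _ _).trans ?_
    have := h1 _ hx'
    have := h1' _ hx
    have := h2 x x' t hx hx'
    have := h2' x x' t hx hx'
    calc _ ≤ ‖b‖ * (K * √‖x - x'‖) * K' + ‖b‖ * K * (K' * √‖x - x'‖) := by gcongr
      _ = _ := by ring

/-- A Hölder cutoff makes a locally Hölder factor globally Hölder. -/
theorem Hol.bilin_cutoff (b : F →L[ℝ] G →L[ℝ] H) {ψ : Euc N × ℝ → G} (hφ : Hol univ φ)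
    (h0 : ∀ q, q ∉ U → φ q = 0) (hψ : Hol U ψ) : Hol univ fun q => b (φ q) (ψ q) := by
  obtain ⟨K, hK, h1, h2⟩ := hφ.exists_nonneg
  obtain ⟨K', hK', h1', h2'⟩ := hψ.exists_nonneg
  have key : ∀ q, ‖b (φ q) (ψ q)‖ ≤ ‖b‖ * ‖φ q‖ * K' := by
    intro q
    by_cases hq : q ∈ U
    · refine (b.le_opNorm₂ _ _).trans ?_
      have := h1' q hq
      gcongr
    · simp [h0 q hq]
  refine Hol.of_bounds (K₁ := ‖b‖ * K * K') (K₂ := ‖b‖ * K * K' + ‖b‖ * K * K')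
    (fun q _ => (key q).trans ?_) fun x x' t _ _ => ?_
  · have := h1 q (mem_univ _)
    gcongr
  have hs := h2 x x' t (mem_univ _) (mem_univ _)
  have hpos : 0 ≤ ‖b‖ * K * K' * √‖x - x'‖ := by positivity
  by_cases hx : (x, t) ∈ U
  · by_cases hx' : (x', t) ∈ U
    · refine (norm_bilin_sub_le b _ _ _ _).trans ?_
      have := h1 (x', t) (mem_univ _)
      have := h1' _ hx
      have := h2' x x' t hx hx'
      calc _ ≤ ‖b‖ * (K * √‖x - x'‖) * K' + ‖b‖ * K * (K' * √‖x - x'‖) := by gcongr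
        _ = _ := by ring
    · rw [h0 _ hx', sub_zero] at hs
      rw [h0 _ hx', map_zero, _root_.zero_apply, sub_zero]
      refine (key _).trans ?_
      calc _ ≤ ‖b‖ * (K * √‖x - x'‖) * K' := by gcongr
        _ = ‖b‖ * K * K' * √‖x - x'‖ := by ring
        _ ≤ _ := by linarith
  · rw [h0 _ hx, zero_sub, norm_neg] at hs
    rw [h0 _ hx, map_zero, _root_.zero_apply, zero_sub, norm_neg]
    refine (key _).trans ?_
    calc _ ≤ ‖b‖ * (K * √‖x - x'‖) * K' := by gcongr
      _ = ‖b‖ * K * K' * √‖x - x'‖ := by ring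
      _ ≤ _ := by linarith

end Hol

namespace Coef

variable {N : ℕ} (C : Coef N) {A B L l : ℝ} {f g : Euc N × ℝ → ℝ}

theorem pot_bounds (hl : 1 ≤ l) (hl2 : 2 * C.c1 * (1 + 2 * L) ≤ √l) (hL : 0 ≤ L)
    (hf : Continuous f) (hb : ∀ q, |f q| ≤ B) (q) :
    |C.KPot l f q| + L * (|C.Pot l f q| + ‖C.DPot l f q‖) ≤ 1 / 2 * B := by
  have hl0 : 0 < l := by linarith
  have hB : 0 ≤ B := (abs_nonneg _).trans (hb 0)
  have hs : 0 < √l := Real.sqrt_pos.2 hl0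
  have h1 := C.abs_Pot_le hl0 hf hb q
  have h2 := C.norm_DPot_le hl0 hf hb q
  have h3 := C.abs_KPot_le hl0 hf hb q
  have hc := C.c1_nonneg
  have h4 : 1 / l ≤ 1 / √l := by
    refine one_div_le_one_div_of_le hs ?_
    rw [Real.sqrt_le_left (by linarith)]
    nlinarith
  have h5 : B * C.c1 * (1 / l) ≤ B * C.c1 * (1 / √l) := by gcongr
  have h6 : C.c1 * (1 + 2 * L) * (1 / √l) ≤ 1 / 2 := by
    rw [mul_one_div, div_le_iff₀ hs]
    linarith
  calc _ ≤ B * C.c1 * (1 / √l) + L * (B * C.c1 * (1 / √l) + B * C.c1 * (1 / √l)) := by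
        gcongr
        exact h1.trans h5
    _ = B * (C.c1 * (1 + 2 * L) * (1 / √l)) := by ring
    _ ≤ B * (1 / 2) := by gcongr
    _ = _ := by ring

/-- Solvability of `f = K f + F(·, P f, D P f)` for a large discount rate. -/
theorem exists_fixed {F : Euc N × ℝ → ℝ → Euc N → ℝ}
    (hl : 1 ≤ l) (hl2 : 2 * C.c1 * (1 + 2 * L) ≤ √l) (hL : 0 ≤ L)
    (hF : Continuous fun p : (Euc N × ℝ) × ℝ × Euc N => F p.1 p.2.1 p.2.2)
    (hF0 : ∀ q, |F q 0 0| ≤ A)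
    (hFL : ∀ q u u' p p', |F q u p - F q u' p'| ≤ L * (|u - u'| + ‖p - p'‖)) :
    ∃ f : Euc N × ℝ → ℝ, Continuous f ∧ (∀ q, |f q| ≤ 2 * A) ∧
      ∀ q, f q = C.KPot l f q + F q (C.Pot l f q) (C.DPot l f q) := by
  have hl0 : 0 < l := by linarith
  let T0 : (Euc N × ℝ → ℝ) → Euc N × ℝ → ℝ := fun f q =>
    C.KPot l f q + F q (C.Pot l f q) (C.DPot l f q)
  have hTc : ∀ {f : Euc N × ℝ → ℝ} {B : ℝ}, Continuous f → (∀ q, |f q| ≤ B) →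
      Continuous (T0 f) := by
    intro f B hf hb
    refine (C.continuous_KPot hl0 hf hb).add ?_
    exact hF.comp (continuous_id.prodMk
      ((C.continuous_Pot hl0 hf hb).prodMk (C.continuous_DPot hl0 hf hb)))
  have hTb : ∀ {f : Euc N × ℝ → ℝ} {B : ℝ}, Continuous f → (∀ q, |f q| ≤ B) → ∀ q,
      |T0 f q| ≤ 1 / 2 * B + A := by
    intro f B hf hb q
    have h1 := C.pot_bounds hl hl2 hL hf hb q
    have h2 := hFL q (C.Pot l f q) 0 (C.DPot l f q) 0
    rw [sub_zero, sub_zero] at h2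
    have h3 := hF0 q
    have e : T0 f q = C.KPot l f q + (F q (C.Pot l f q) (C.DPot l f q) - F q 0 0) + F q 0 0 := by
      simp only [T0]
      ring
    rw [e]
    refine (abs_add_le _ _).trans (add_le_add ((abs_add_le _ _).trans ?_) h3)
    linarith
  have hTd : ∀ {f g : Euc N × ℝ → ℝ} {B B' D : ℝ}, Continuous f → (∀ q, |f q| ≤ B) →
      Continuous g → (∀ q, |g q| ≤ B') → (∀ q, |f q - g q| ≤ D) → ∀ q,
      |T0 f q - T0 g q| ≤ 1 / 2 * D := by
    intro f g B B' D hf hb hg hb' hd q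
    have h1 := C.pot_bounds (f := fun q => f q - g q) hl hl2 hL (hf.sub hg) hd q
    rw [C.Pot_sub hl0 hf hb hg hb', C.DPot_sub hl0 hf hb hg hb', C.KPot_sub hl0 hf hb hg hb'] at h1
    have h2 := hFL q (C.Pot l f q) (C.Pot l g q) (C.DPot l f q) (C.DPot l g q)
    have e : T0 f q - T0 g q = (C.KPot l f q - C.KPot l g q) +
        (F q (C.Pot l f q) (C.DPot l f q) - F q (C.Pot l g q) (C.DPot l g q)) := by
      simp only [T0]
      ring
    rw [e]
    refine (abs_add_le _ _).trans ?_
    linarith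
  have hbf : ∀ (f : BoundedContinuousFunction (Euc N × ℝ) ℝ) q, |f q| ≤ ‖f‖ :=
    fun f q => f.norm_coe_le_norm q
  let T : BoundedContinuousFunction (Euc N × ℝ) ℝ → BoundedContinuousFunction (Euc N × ℝ) ℝ :=
    fun f => BoundedContinuousFunction.ofNormedAddCommGroup (T0 f) (hTc f.continuous (hbf f))
      (1 / 2 * ‖f‖ + A) (hTb f.continuous (hbf f))
  have hlip : LipschitzWith (1 / 2) T := by
    refine LipschitzWith.of_dist_le_mul fun f g => ?_
    refine (BoundedContinuousFunction.dist_le (by positivity)).2 fun q => ?_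
    rw [Real.dist_eq]
    have := hTd f.continuous (hbf f) g.continuous (hbf g) (D := dist f g)
      (fun q => by rw [← Real.dist_eq]; exact BoundedContinuousFunction.dist_coe_le_dist q) q
    have h2 : |T f q - T g q| ≤ 1 / 2 * dist f g := this
    simpa using h2
  have hT : ContractingWith (1 / 2) T := ⟨by norm_num, hlip⟩
  have hfix : T hT.fixedPoint = hT.fixedPoint := hT.fixedPoint_isFixedPt
  set f := hT.fixedPoint with hfdef
  have hfq : ∀ q, T0 f q = f q := fun q => congrArg (fun h => h q) hfix
  refine ⟨f, f.continuous, ?_, fun q => (hfq q).symm⟩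
  have hA : 0 ≤ A := (abs_nonneg _).trans (hF0 0)
  have h1 : ‖f‖ ≤ 1 / 2 * ‖f‖ + A := by
    refine (BoundedContinuousFunction.norm_le (by positivity)).2 fun q => ?_
    rw [← hfq q]
    exact hTb f.continuous (hbf f) q
  intro q
  have := hbf f q
  linarith

/-- Linear equations `f = K f + g`. -/
theorem exists_resolvent (hl : 1 ≤ l) (hl2 : 2 * C.c1 ≤ √l) (hg : Continuous g)
    (hg0 : ∀ q, |g q| ≤ A) : ∃ f : Euc N × ℝ → ℝ, Continuous f ∧ (∀ q, |f q| ≤ 2 * A) ∧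
      ∀ q, f q = C.KPot l f q + g q :=
  C.exists_fixed (F := fun q _ _ => g q) (L := 0) hl (by linarith) le_rfl (by fun_prop) hg0
    (by simp)

theorem resolvent_bound (hl : 1 ≤ l) (hl2 : 2 * C.c1 ≤ √l) (hf : Continuous f)
    (hb : ∀ q, |f q| ≤ B) (hg0 : ∀ q, |g q| ≤ A) (hfg : ∀ q, f q = C.KPot l f q + g q) (q) :
    |f q| ≤ 2 * A := by
  have hA : 0 ≤ A := (abs_nonneg _).trans (hg0 0)
  let f' : BoundedContinuousFunction (Euc N × ℝ) ℝ :=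
    BoundedContinuousFunction.ofNormedAddCommGroup f hf B hb
  have h0 : ∀ q, |f q| ≤ ‖f'‖ := fun q => f'.norm_coe_le_norm q
  have h1 : ‖f'‖ ≤ 1 / 2 * ‖f'‖ + A := by
    refine (BoundedContinuousFunction.norm_le (by positivity)).2 fun q => ?_
    have h2 := C.pot_bounds (L := 0) hl (by linarith) le_rfl hf h0 q
    have h3 : f' q = C.KPot l f q + g q := hfg q
    rw [h3]
    refine (abs_add_le _ _).trans (add_le_add ?_ (hg0 q))
    linarith
  have := h0 q
  linarith

theorem hol_KPot (hl : 1 ≤ l) (hf : Continuous f) (hb : ∀ q, |f q| ≤ B) :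
    Hol univ (C.KPot l f) :=
  Hol.of_bounds (fun q _ => C.abs_KPot_le (by linarith) hf hb q)
    fun x x' t _ _ => C.abs_KPot_sub_le hl hf hb x x' t

theorem hol_DPot (hl : 1 ≤ l) (hf : Continuous f) (hb : ∀ q, |f q| ≤ B) :
    Hol univ (C.DPot l f) :=
  Hol.of_bounds (fun q _ => C.norm_DPot_le (by linarith) hf hb q)
    fun x x' t _ _ => C.norm_DPot_sub_le hl hf hb x x' t

theorem hol_Pot (hl : 1 ≤ l) (hf : Continuous f) (hb : ∀ q, |f q| ≤ B) :
    Hol univ (C.Pot l f) := by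
  have hl0 : 0 < l := by linarith
  refine Hol.of_lip (K₂ := B * C.c1 * (1 / √l)) (fun q _ => C.abs_Pot_le hl0 hf hb q)
    fun x x' t _ _ => ?_
  refine Convex.norm_image_sub_le_of_norm_hasFDerivWithin_le
    (f := fun y => C.Pot l f (y, t)) (s := univ)
    (fun y _ => (C.hasFDerivAt_Pot hl0 hf hb y t).hasFDerivWithinAt) (fun y _ => ?_)
    convex_univ (mem_univ _) (mem_univ _)
  rw [innerSL_apply_norm]
  exact C.norm_DPot_le hl0 hf hb _

theorem exists_holder_bound (hf : Hol univ f) : ∃ B, (∀ q, |f q| ≤ B) ∧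
    ∀ x x' t, |f (x, t) - f (x', t)| ≤ B * √‖x - x'‖ := by
  obtain ⟨K, h1, h2⟩ := hf
  exact ⟨K, fun q => h1 q (mem_univ _), fun x x' t => h2 x x' t (mem_univ _) (mem_univ _)⟩

end Coef

/-! ### Jets and the maximum principle -/

open Filter Topology

/-- A function together with candidates for its parabolic derivatives. -/
structure Jet (N : ℕ) where
  val : Euc N × ℝ → ℝ
  D : Euc N × ℝ → Euc N
  H : Euc N × ℝ → Euc N →L[ℝ] Euc N
  dt : Euc N × ℝ → ℝ

/-- The candidates are the actual derivatives at `q`. -/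
structure Jet.At {N : ℕ} (z : Jet N) (q : Euc N × ℝ) : Prop where
  hD : HasFDerivAt (fun y => z.val (y, q.2)) (innerSL ℝ (z.D q)) q.1
  hH : HasFDerivAt (fun y => z.D (y, q.2)) (z.H q) q.1
  ht : HasDerivAt (fun s => z.val (q.1, s)) (z.dt q) q.2

/-- The symmetrized tensor product of two vectors. -/
def symTensor (N : ℕ) : Euc N →L[ℝ] Euc N →L[ℝ] (Euc N →L[ℝ] Euc N) :=
  LinearMap.mkContinuous₂ (LinearMap.mk₂ ℝ
    (fun p p' => (innerSL ℝ p).smulRight p' + (innerSL ℝ p').smulRight p)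
    (fun p₁ p₂ p' => by ext v; simp [add_smul]; ring)
    (fun c p p' => by ext v; simp; ring)
    (fun p p₁' p₂' => by ext v; simp [add_smul]; ring)
    (fun c p p' => by ext v; simp; ring)) 2 (fun p p' => by
      refine (norm_add_le _ _).trans ?_
      simp only [ContinuousLinearMap.norm_smulRight_apply, innerSL_apply_norm]
      exact le_of_eq (by ring))

theorem symTensor_apply {N : ℕ} (p p' : Euc N) :
    symTensor N p p' = (innerSL ℝ p).smulRight p' + (innerSL ℝ p').smulRight p := rfl

theorem norm_symTensor_le {N : ℕ} (p p' : Euc N) : ‖symTensor N p p'‖ ≤ 2 * ‖p‖ * ‖p'‖ := by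
  rw [symTensor_apply]
  refine (norm_add_le _ _).trans ?_
  simp only [ContinuousLinearMap.norm_smulRight_apply, innerSL_apply_norm]
  exact le_of_eq (by ring)

namespace Jet

variable {N : ℕ} {z w : Jet N} {q : Euc N × ℝ}

/-- The jet of `z + c • w`. -/
def addSmul (z : Jet N) (c : ℝ) (w : Jet N) : Jet N where
  val q := z.val q + c * w.val q
  D q := z.D q + c • w.D q
  H q := z.H q + c • w.H q
  dt q := z.dt q + c * w.dt q

/-- The jet of a product. -/
def mul (z w : Jet N) : Jet N where
  val q := z.val q * w.val q
  D q := z.val q • w.D q + w.val q • z.D q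
  H q := z.val q • w.H q + w.val q • z.H q + symTensor N (z.D q) (w.D q)
  dt q := z.val q * w.dt q + w.val q * z.dt q

theorem At.addSmul (hz : z.At q) (c : ℝ) (hw : w.At q) : (z.addSmul c w).At q where
  hD := by
    have := hz.hD.fun_add (hw.hD.const_mul c)
    refine this.congr_fderiv ?_
    ext v
    simp [Jet.addSmul, inner_add_left, inner_smul_left]
  hH := hz.hH.fun_add (hw.hH.fun_const_smul c)
  ht := hz.ht.fun_add (hw.ht.const_mul c)

theorem At.mul (hz : z.At q) (hw : w.At q) : (z.mul w).At q where
  hD := by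
    have := hz.hD.fun_mul hw.hD
    refine this.congr_fderiv ?_
    ext v
    simp [Jet.mul, inner_add_left, inner_smul_left]
  hH := by
    have := (hz.hD.fun_smul hw.hH).fun_add (hw.hD.fun_smul hz.hH)
    refine this.congr_fderiv ?_
    simp only [Jet.mul, symTensor_apply]
    abel
  ht := by
    have := hz.ht.fun_mul hw.ht
    refine this.congr_deriv ?_
    simp only [Jet.mul]
    ring

theorem At.of_eventually_zero (h : ∀ᶠ p in 𝓝 q, z.val p = 0 ∧ z.D p = 0) (hH : z.H q = 0)
    (ht : z.dt q = 0) : z.At q := by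
  have h1 : ∀ᶠ y in 𝓝 q.1, z.val (y, q.2) = 0 ∧ z.D (y, q.2) = 0 := by
    have : Tendsto (fun y => (y, q.2)) (𝓝 q.1) (𝓝 q) :=
      (Continuous.prodMk_left q.2).tendsto' _ _ rfl
    exact this.eventually h
  have h2 : ∀ᶠ s in 𝓝 q.2, z.val (q.1, s) = 0 ∧ z.D (q.1, s) = 0 := by
    have : Tendsto (fun s => (q.1, s)) (𝓝 q.2) (𝓝 q) :=
      (Continuous.prodMk_right q.1).tendsto' _ _ rfl
    exact this.eventually h
  refine ⟨?_, ?_, ?_⟩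
  · rw [h.self_of_nhds.2, map_zero]
    exact (hasFDerivAt_const (0 : ℝ) q.1).congr_of_eventuallyEq (h1.mono fun y hy => hy.1)
  · rw [hH]
    exact (hasFDerivAt_const (0 : Euc N) q.1).congr_of_eventuallyEq (h1.mono fun y hy => hy.2)
  · rw [ht]
    exact (hasDerivAt_const q.2 (0 : ℝ)).congr_of_eventuallyEq (h2.mono fun y hy => hy.1)

theorem At.congr (hw : w.At q) (h : ∀ᶠ p in 𝓝 q, z.val p = w.val p ∧ z.D p = w.D p)
    (hH : z.H q = w.H q) (ht : z.dt q = w.dt q) : z.At q := by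
  have h1 : ∀ᶠ y in 𝓝 q.1, z.val (y, q.2) = w.val (y, q.2) ∧ z.D (y, q.2) = w.D (y, q.2) := by
    have : Tendsto (fun y => (y, q.2)) (𝓝 q.1) (𝓝 q) :=
      (Continuous.prodMk_left q.2).tendsto' _ _ rfl
    exact this.eventually h
  have h2 : ∀ᶠ s in 𝓝 q.2, z.val (q.1, s) = w.val (q.1, s) := by
    have : Tendsto (fun s => (q.1, s)) (𝓝 q.2) (𝓝 q) :=
      (Continuous.prodMk_right q.1).tendsto' _ _ rfl
    exact this.eventually (h.mono fun p hp => hp.1)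
  refine ⟨?_, ?_, ?_⟩
  · rw [h.self_of_nhds.2]
    exact hw.hD.congr_of_eventuallyEq (h1.mono fun y hy => hy.1)
  · rw [hH]
    exact hw.hH.congr_of_eventuallyEq (h1.mono fun y hy => hy.2)
  · rw [ht]
    exact hw.ht.congr_of_eventuallyEq h2

theorem D_eq_zero_of_max (hz : z.At q) (hm : IsLocalMax (fun y => z.val (y, q.2)) q.1) :
    z.D q = 0 := by
  have h := hm.hasFDerivAt_eq_zero hz.hD
  have : ‖innerSL ℝ (z.D q)‖ = 0 := by rw [h, norm_zero]
  rwa [innerSL_apply_norm, norm_eq_zero] at this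

theorem H_nonpos_of_max (hz : z.At q) (hev : ∀ᶠ y in 𝓝 q.1, z.At (y, q.2))
    (hm : IsLocalMax (fun y => z.val (y, q.2)) q.1) (v : Euc N) : inner ℝ v (z.H q v) ≤ 0 := by
  by_contra! hpos
  have hD0 := D_eq_zero_of_max hz hm
  have hline : ∀ s, HasDerivAt (fun s : ℝ => q.1 + s • v) v s := fun s => by
    have := ((hasDerivAt_id s).smul_const v).const_add q.1
    simpa using this
  have ht0 : Tendsto (fun s : ℝ => q.1 + s • v) (𝓝 0) (𝓝 q.1) := by
    have : Continuous fun s : ℝ => q.1 + s • v := by fun_prop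
    exact this.tendsto' _ _ (by simp)
  have hg' : HasDerivAt (fun s : ℝ => inner ℝ v (z.D (q.1 + s • v, q.2)))
      (inner ℝ v (z.H q v)) 0 := by
    have h1 : HasFDerivAt (fun y => z.D (y, q.2)) (z.H q) (q.1 + (0 : ℝ) • v) := by
      simpa using hz.hH
    have h2 := h1.comp_hasDerivAt (0 : ℝ) (hline 0)
    exact ((innerSL ℝ v).hasFDerivAt.comp_hasDerivAt (0 : ℝ) h2)
  have hslope : ∀ᶠ s in 𝓝[>] (0 : ℝ), 0 < inner ℝ v (z.D (q.1 + s • v, q.2)) := by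
    have h1 := (hasDerivAt_iff_tendsto_slope.1 hg').eventually (lt_mem_nhds hpos)
    have h2 : ∀ᶠ s in 𝓝[>] (0 : ℝ), 0 < slope (fun s : ℝ =>
        inner ℝ v (z.D (q.1 + s • v, q.2))) 0 s :=
      h1.filter_mono (nhdsWithin_mono _ fun s hs => (ne_of_gt hs))
    filter_upwards [h2, self_mem_nhdsWithin] with s hs hs0
    rw [slope_def_field] at hs
    have hs0' : (0 : ℝ) < s := hs0
    rw [sub_zero, zero_smul, add_zero, hD0, inner_zero_right, sub_zero] at hs
    exact (div_pos_iff_of_pos_right hs0').1 hs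
  have hat : ∀ᶠ s in 𝓝 (0 : ℝ), z.At (q.1 + s • v, q.2) ∧
      z.val (q.1 + s • v, q.2) ≤ z.val (q.1, q.2) := ht0.eventually (hev.and hm)
  obtain ⟨δ, hδ, hball⟩ := Metric.eventually_nhds_iff.1 hat
  obtain ⟨δ', hδ', hpos'⟩ := mem_nhdsGT_iff_exists_Ioo_subset.1 hslope
  have hδ'0 : (0 : ℝ) < δ' := hδ'
  set e := min δ δ' / 2 with he
  have he0 : 0 < e := by positivity
  have heδ : e < δ := by have := min_le_left δ δ'; linarith
  have heδ' : e < δ' := by have := min_le_right δ δ'; linarith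
  have hd : ∀ s ∈ Icc (0 : ℝ) e, HasDerivAt (fun s => z.val (q.1 + s • v, q.2))
      (inner ℝ v (z.D (q.1 + s • v, q.2))) s := by
    intro s hs
    have hs' : dist s 0 < δ := by
      rw [dist_zero_right, Real.norm_of_nonneg hs.1]
      exact hs.2.trans_lt heδ
    have := (hball hs').1.hD.comp_hasDerivAt s (hline s)
    refine HasDerivAt.congr_deriv this ?_
    simp [real_inner_comm]
  obtain ⟨c, hc, hce⟩ := exists_hasDerivAt_eq_slope (fun s => z.val (q.1 + s • v, q.2)) _ he0
    (fun s hs => (hd s hs).continuousAt.continuousWithinAt)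
    (fun s hs => hd s (Ioo_subset_Icc_self hs))
  have hcpos : 0 < inner ℝ v (z.D (q.1 + c • v, q.2)) :=
    hpos' ⟨hc.1, hc.2.trans heδ'⟩
  rw [hce, sub_zero] at hcpos
  have h3 := (div_pos_iff_of_pos_right he0).1 hcpos
  have h4 := (hball (y := e) (by rw [dist_zero_right, Real.norm_of_nonneg he0.le]; exact heδ)).2
  simp only [zero_smul, add_zero] at h3
  linarith

theorem dt_nonpos_of_max (hz : z.At q)
    (hm : ∀ᶠ s in 𝓝[>] q.2, z.val (q.1, s) ≤ z.val q) : z.dt q ≤ 0 := by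
  have h1 : Tendsto (slope (fun s => z.val (q.1, s)) q.2) (𝓝[>] q.2) (𝓝 (z.dt q)) :=
    (hasDerivAt_iff_tendsto_slope.1 hz.ht).mono_left
      (nhdsWithin_mono q.2 fun s (hs : q.2 < s) => ne_of_gt hs)
  refine le_of_tendsto h1 ?_
  filter_upwards [hm, self_mem_nhdsWithin] with s hs hs0
  have hs0' : q.2 < s := hs0
  rw [slope_def_field]
  exact div_nonpos_of_nonpos_of_nonneg (sub_nonpos.2 hs) (by linarith)

end Jet

namespace Coef

variable {N : ℕ} (C : Coef N)

/-- The parabolic operator `∂ₜ + ½ tr(a D²)` on jets. -/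
def op (z : Jet N) (q : Euc N × ℝ) : ℝ := z.dt q + 1 / 2 * C.tr q (z.H q)

variable {C} {z w : Jet N} {q : Euc N × ℝ}

theorem op_addSmul (c : ℝ) : C.op (z.addSmul c w) q = C.op z q + c * C.op w q := by
  simp only [op, Jet.addSmul, map_add, map_smul, smul_eq_mul]
  ring

theorem op_mul : C.op (z.mul w) q = z.val q * C.op w q + w.val q * C.op z q +
    1 / 2 * C.tr q (symTensor N (z.D q) (w.D q)) := by
  simp only [op, Jet.mul, map_add, map_smul, smul_eq_mul]
  ring

theorem op_nonpos_of_max (hz : z.At q) (hev : ∀ᶠ y in 𝓝 q.1, z.At (y, q.2))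
    (hm : IsLocalMax (fun y => z.val (y, q.2)) q.1)
    (hm' : ∀ᶠ s in 𝓝[>] q.2, z.val (q.1, s) ≤ z.val q) : C.op z q ≤ 0 := by
  have h1 := z.dt_nonpos_of_max hz hm'
  have h2 := C.tr_nonpos q (z.H q) (z.H_nonpos_of_max hz hev hm)
  unfold op
  linarith

/-- The jet of `‖x‖² + t² + c`. -/
def _root_.Jet.quad (N : ℕ) (c : ℝ) : Jet N where
  val q := ‖q.1‖ ^ 2 + q.2 ^ 2 + c
  D q := (2 : ℝ) • q.1
  H _ := (2 : ℝ) • ContinuousLinearMap.id ℝ (Euc N)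
  dt q := 2 * q.2

theorem _root_.Jet.quad_at (c : ℝ) (q : Euc N × ℝ) : (Jet.quad N c).At q where
  hD := by
    have h := ((hasStrictFDerivAt_norm_sq q.1).hasFDerivAt.add_const (q.2 ^ 2)).add_const c
    refine HasFDerivAt.congr_fderiv h ?_
    ext v
    simp [Jet.quad, inner_smul_left]
  hH := by
    have h := (hasFDerivAt_id (𝕜 := ℝ) q.1).fun_const_smul (2 : ℝ)
    exact h
  ht := by
    have h := ((hasDerivAt_pow 2 q.2).const_add (‖q.1‖ ^ 2)).add_const c
    refine HasDerivAt.congr_deriv h ?_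
    simp [Jet.quad]

/-- Maximum principle on the whole space-time for bounded-above functions. -/
theorem max_univ {l S : ℝ} (hl : 0 < l) (hw : ∀ q, w.At q) (hc : Continuous w.val)
    (hS : ∀ q, w.val q ≤ S) (hop : ∀ q, 0 ≤ C.op w q - l * w.val q) (q) : w.val q ≤ 0 := by
  set c : ℝ := (C.Λ * ‖ContinuousLinearMap.id ℝ (Euc N)‖ + 1 / l + 1) / l with hcdef
  have hΛ := C.Λ_pos
  have hc0 : 0 < c := by positivity
  have hψ : ∀ q, C.op (Jet.quad N c) q < l * (Jet.quad N c).val q := by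
    intro q
    have h1 : C.tr q (ContinuousLinearMap.id ℝ (Euc N)) ≤
        C.Λ * ‖ContinuousLinearMap.id ℝ (Euc N)‖ :=
      (le_abs_self _).trans ((C.tr q).le_of_opNorm_le (C.tr_le q) _)
    have h2 : l * c = C.Λ * ‖ContinuousLinearMap.id ℝ (Euc N)‖ + 1 / l + 1 := by
      rw [hcdef]
      field_simp
    have h3 : 2 * q.2 ≤ l * q.2 ^ 2 + 1 / l := by
      have : l * q.2 ^ 2 + 1 / l - 2 * q.2 = (l * q.2 - 1) ^ 2 / l := by
        field_simp
        ring
      have h4 : 0 ≤ (l * q.2 - 1) ^ 2 / l := by positivity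
      linarith
    have h5 : 0 ≤ l * ‖q.1‖ ^ 2 := by positivity
    simp only [op, Jet.quad, map_smul, smul_eq_mul, mul_add]
    linarith
  have key : ∀ ε, 0 < ε → w.val q ≤ ε * (Jet.quad N c).val q := by
    intro ε hε
    by_contra! hcon
    set φ := w.addSmul (-ε) (Jet.quad N c) with hφ
    have hval : ∀ p, φ.val p = w.val p - ε * (‖p.1‖ ^ 2 + p.2 ^ 2 + c) := fun p => by
      simp only [hφ, Jet.addSmul, Jet.quad]
      ring
    have hφq : 0 < φ.val q := by
      simp only [hφ, Jet.addSmul]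
      linarith
    have hφc : Continuous φ.val := by
      have : φ.val = fun p => w.val p - ε * (‖p.1‖ ^ 2 + p.2 ^ 2 + c) := funext hval
      rw [this]
      fun_prop
    set R := max ‖q‖ (√(|S| / ε) + 1) with hR
    obtain ⟨p, hp, hpm⟩ := (isCompact_closedBall (0 : Euc N × ℝ) R).exists_isMaxOn
      ⟨q, by rw [mem_closedBall_zero_iff]; exact le_max_left _ _⟩ hφc.continuousOn
    have hpq : 0 < φ.val p := hφq.trans_le
      (hpm (by rw [mem_closedBall_zero_iff]; exact le_max_left _ _))
    have hmax : ∀ p', φ.val p' ≤ φ.val p := by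
      intro p'
      by_cases hp' : p' ∈ Metric.closedBall (0 : Euc N × ℝ) R
      · exact hpm hp'
      · rw [mem_closedBall_zero_iff, not_le] at hp'
        refine le_trans ?_ hpq.le
        rw [hval]
        have h1 : √(|S| / ε) < ‖p'‖ := by
          have := le_max_right ‖q‖ (√(|S| / ε) + 1)
          linarith
        have h2 : |S| / ε < ‖p'‖ ^ 2 := (Real.sqrt_lt' ((Real.sqrt_nonneg _).trans_lt h1)).1 h1
        have h3 : ‖p'‖ ^ 2 ≤ ‖p'.1‖ ^ 2 + p'.2 ^ 2 := by
          rw [Prod.norm_def]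
          rcases max_choice ‖p'.1‖ ‖p'.2‖ with h | h
          · rw [h]; nlinarith [sq_nonneg p'.2]
          · rw [h, Real.norm_eq_abs, sq_abs]; nlinarith [sq_nonneg ‖p'.1‖]
        have h4 : |S| < ε * (‖p'.1‖ ^ 2 + p'.2 ^ 2) := by
          rw [div_lt_iff₀ hε] at h2
          nlinarith
        have h5 := hS p'
        have h6 := le_abs_self S
        nlinarith [mul_pos hε hc0]
    have hat : ∀ p, φ.At p := fun p => (hw p).addSmul _ (Jet.quad_at c p)
    have hle := C.op_nonpos_of_max (hat p) (Eventually.of_forall fun y => hat _)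
      (Eventually.of_forall fun y => hmax _) (Eventually.of_forall fun y => hmax _)
    rw [hφ, op_addSmul] at hle
    have h1 := hop p
    have h2 := mul_lt_mul_of_pos_left (hψ p) hε
    have h3 : φ.val p = w.val p + -ε * (Jet.quad N c).val p := rfl
    nlinarith [mul_pos hl hpq]
  have hlim : Tendsto (fun ε : ℝ => ε * (Jet.quad N c).val q) (𝓝[>] 0) (𝓝 0) := by
    have : Continuous fun ε : ℝ => ε * (Jet.quad N c).val q := by fun_prop
    exact (this.tendsto' 0 0 (by simp)).mono_left nhdsWithin_le_nhds
  exact ge_of_tendsto hlim (by filter_upwards [self_mem_nhdsWithin] with ε hε using key ε hε)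

variable (C) in
/-- The jet of a potential. -/
def potJet (l : ℝ) (f : Euc N × ℝ → ℝ) : Jet N where
  val := C.Pot l f
  D := C.DPot l f
  H := C.D2Pot l f
  dt q := l * C.Pot l f q - 1 / 2 * C.tr q (C.D2Pot l f q) + C.KPot l f q - f q

theorem potJet_at {l : ℝ} {f : Euc N × ℝ → ℝ} (hl : 0 < l) (hf : Continuous f)
    (hh : Hol univ f) (q) : (C.potJet l f).At q := by
  obtain ⟨B, hb, hh⟩ := exists_holder_bound hh
  exact ⟨C.hasFDerivAt_Pot hl hf hb q.1 q.2, C.hasFDerivAt_DPot hl hf hb hh q.1 q.2,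
    C.hasDerivAt_Pot hl hf hb hh q.1 q.2⟩

theorem op_potJet {l : ℝ} {f : Euc N × ℝ → ℝ} (q) :
    C.op (C.potJet l f) q = l * C.Pot l f q + C.KPot l f q - f q := by
  simp only [op, potJet]
  ring

theorem hol_of_resolvent {l B : ℝ} {f g : Euc N × ℝ → ℝ} (hl : 1 ≤ l) (hf : Continuous f)
    (hb : ∀ q, |f q| ≤ B) (hg : Hol univ g) (hfg : ∀ q, f q = C.KPot l f q + g q) :
    Hol univ f :=
  ((C.hol_KPot hl hf hb).add hg).congr fun q _ => hfg q

/-- Bounded solutions of the linear equation are potentials. -/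
theorem rep {l A S : ℝ} {g : Euc N × ℝ → ℝ} (hl : 1 ≤ l) (hl2 : 2 * C.c1 ≤ √l)
    (hw : ∀ q, w.At q) (hc : Continuous w.val) (hS : ∀ q, |w.val q| ≤ S) (hg : Continuous g)
    (hgA : ∀ q, |g q| ≤ A) (hgh : Hol univ g) (hop : ∀ q, C.op w q - l * w.val q = -g q) :
    ∃ f : Euc N × ℝ → ℝ, Continuous f ∧ (∀ q, |f q| ≤ 2 * A) ∧
      (∀ q, f q = C.KPot l f q + g q) ∧ (∀ q, w.val q = C.Pot l f q) ∧
      ∀ q, w.D q = C.DPot l f q := by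
  have hl0 : 0 < l := by linarith
  obtain ⟨f, hf, hb, hfg⟩ := C.exists_resolvent hl hl2 hg hgA
  have hfh := hol_of_resolvent hl hf hb hgh hfg
  have hpot := potJet_at (C := C) hl0 hf hfh
  have hpc := C.continuous_Pot hl0 hf hb
  have hpb := C.abs_Pot_le hl0 hf hb
  have hval : ∀ q, w.val q = C.Pot l f q := by
    intro q
    have h1 := max_univ (C := C) (w := w.addSmul (-1) (C.potJet l f))
      (S := S + 2 * A * C.c1 * (1 / l)) hl0
      (fun q => (hw q).addSmul _ (hpot q)) (by
        simp only [Jet.addSmul, potJet]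
        fun_prop) (fun q => by
        simp only [Jet.addSmul, potJet]
        have := abs_le.1 (hS q)
        have := abs_le.1 (hpb q)
        linarith) (fun q => by
        rw [op_addSmul, op_potJet]
        simp only [Jet.addSmul, potJet]
        have := hop q
        have := hfg q
        nlinarith) q
    have h2 := max_univ (C := C) (w := (C.potJet l f).addSmul (-1) w)
      (S := S + 2 * A * C.c1 * (1 / l)) hl0
      (fun q => (hpot q).addSmul _ (hw q)) (by
        simp only [Jet.addSmul, potJet]
        fun_prop) (fun q => by
        simp only [Jet.addSmul, potJet]
        have := abs_le.1 (hS q)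
        have := abs_le.1 (hpb q)
        linarith) (fun q => by
        rw [op_addSmul, op_potJet]
        simp only [Jet.addSmul, potJet]
        have := hop q
        have := hfg q
        nlinarith) q
    simp only [Jet.addSmul, potJet] at h1 h2
    linarith
  refine ⟨f, hf, hb, hfg, hval, fun q => ?_⟩
  have h1 := (hw q).hD
  have h2 := (hpot q).hD
  simp only [potJet, hval] at h1 h2
  have h3 := h1.unique h2
  have h4 : ‖innerSL ℝ (w.D q - C.DPot l f q)‖ = 0 := by
    rw [map_sub, h3, sub_self, norm_zero]
  rwa [innerSL_apply_norm, norm_eq_zero, sub_eq_zero] at h4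

end Coef

/-! ### Cutoffs -/

section Cutoff

variable {N : ℕ}

theorem Hol.of_contDiff {F : Type*} [NormedAddCommGroup F] [NormedSpace ℝ F]
    {φ : Euc N × ℝ → F} (h : ContDiff ℝ 1 φ) (hc : HasCompactSupport φ) : Hol univ φ := by
  obtain ⟨K₁, hK₁⟩ := h.continuous.bounded_above_of_compact_support hc
  obtain ⟨K₂, hK₂⟩ := h.lipschitzWith_of_hasCompactSupport hc one_ne_zero
  refine Hol.of_lip (K₂ := K₂) (fun q _ => hK₁ q) fun x x' t _ _ => ?_
  have := hK₂.norm_sub_le (x, t) (x', t)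
  simpa [Prod.norm_def] using this

theorem Hol.clm {F G : Type*} [NormedAddCommGroup F] [NormedSpace ℝ F] [NormedAddCommGroup G]
    [NormedSpace ℝ G] {U : Set (Euc N × ℝ)} {φ : Euc N × ℝ → F} (L : F →L[ℝ] G) (h : Hol U φ) :
    Hol U fun q => L (φ q) :=
  Hol.bilin (ContinuousLinearMap.id ℝ (F →L[ℝ] G)) (Hol.const L) h

theorem Hol.comp_clm {E F G : Type*} [NormedAddCommGroup E] [NormedSpace ℝ E]
    [NormedAddCommGroup F] [NormedSpace ℝ F] [NormedAddCommGroup G] [NormedSpace ℝ G]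
    {U : Set (Euc N × ℝ)} {φ : Euc N × ℝ → G →L[ℝ] ℝ} {ψ : Euc N × ℝ → E}
    (L : E →L[ℝ] F →L[ℝ] G) (hφ : Hol U φ) (hψ : Hol U ψ) :
    Hol U fun q => (φ q).comp (L (ψ q)) :=
  Hol.bilin (ContinuousLinearMap.compL ℝ F G ℝ) hφ (Hol.clm L hψ)

theorem contDiff_clm_diag {X E F : Type*} [NormedAddCommGroup X] [NormedSpace ℝ X]
    [NormedAddCommGroup E] [NormedSpace ℝ E] [NormedAddCommGroup F] [NormedSpace ℝ F]
    {n : WithTop ℕ∞} (L : E →L[ℝ] E →L[ℝ] F) {f : X → E} (hf : ContDiff ℝ n f) :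
    ContDiff ℝ n fun q => L (f q) (f q) :=
  (L.contDiff.comp hf).clm_apply hf

/-- A regular cutoff jet vanishing off the closed set `K`. -/
structure IsCutoff (ζ : Jet N) (K : Set (Euc N × ℝ)) : Prop where
  at' : ∀ q, ζ.At q
  cval : Continuous ζ.val
  cD : Continuous ζ.D
  cH : Continuous ζ.H
  cdt : Continuous ζ.dt
  hval : Hol univ ζ.val
  hD : Hol univ ζ.D
  hH : Hol univ ζ.H
  hdt : Hol univ ζ.dt
  closed : IsClosed K
  zero : ∀ q, q ∉ K → ζ.val q = 0 ∧ ζ.D q = 0 ∧ ζ.H q = 0 ∧ ζ.dt q = 0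

theorem continuous_of_cover {X Y : Type*} [TopologicalSpace X] [TopologicalSpace Y] [Zero Y]
    {φ : X → Y} {U K : Set X} (hU : IsOpen U) (hK : IsClosed K) (hKU : K ⊆ U)
    (h : ContinuousOn φ U) (h0 : ∀ q, q ∉ K → φ q = 0) : Continuous φ := by
  rw [continuous_iff_continuousAt]
  intro q
  by_cases hq : q ∈ U
  · exact h.continuousAt (hU.mem_nhds hq)
  · have hq' : q ∈ Kᶜ := fun h => hq (hKU h)
    refine (continuousAt_const (y := (0 : Y))).congr ?_
    filter_upwards [hK.isOpen_compl.mem_nhds hq'] with p hp using (h0 p hp).symm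

theorem Coef.hol_tr (C : Coef N) : Hol univ C.tr :=
  Hol.of_lip (fun q _ => C.tr_le q) fun x x' t _ _ => by
    have := C.tr_lip (x, t) (x', t)
    simpa [Prod.norm_def] using this

/-- The forcing in the equation of the product `ζ z`, where `A` stands for `op z`, `u` for the
value and `p` for the gradient of `z`. -/
def Coef.cutG (C : Coef N) (l : ℝ) (ζ : Jet N) (A u : Euc N × ℝ → ℝ) (p : Euc N × ℝ → Euc N)
    (q : Euc N × ℝ) : ℝ :=
  l * (ζ.val q * u q) -
    (ζ.val q * A q + C.op ζ q * u q + 1 / 2 * C.tr q (symTensor N (ζ.D q) (p q)))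

variable {C : Coef N} {ζ z : Jet N} {K U : Set (Euc N × ℝ)} {A u : Euc N × ℝ → ℝ}
  {p : Euc N × ℝ → Euc N} {l : ℝ}

theorem IsCutoff.op_zero (h : IsCutoff ζ K) {q} (hq : q ∉ K) : C.op ζ q = 0 := by
  obtain ⟨-, -, h1, h2⟩ := h.zero q hq
  simp [Coef.op, h1, h2]

theorem IsCutoff.cutG_zero (h : IsCutoff ζ K) {q} (hq : q ∉ K) : C.cutG l ζ A u p q = 0 := by
  obtain ⟨h1, h2, -, -⟩ := h.zero q hq
  simp [Coef.cutG, h1, h2, h.op_zero hq]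

theorem IsCutoff.continuous_cutG (h : IsCutoff ζ K) (hU : IsOpen U) (hKU : K ⊆ U)
    (hA : ContinuousOn A U) (hu : ContinuousOn u U) (hp : ContinuousOn p U) :
    Continuous (C.cutG l ζ A u p) := by
  refine continuous_of_cover hU h.closed hKU ?_ fun q hq => h.cutG_zero hq
  have h1 := h.cval.continuousOn (s := U)
  have h2 := h.cD.continuousOn (s := U)
  have h3 := h.cH.continuousOn (s := U)
  have h4 := h.cdt.continuousOn (s := U)
  have h5 := C.continuous_tr.continuousOn (s := U)
  unfold Coef.cutG Coef.op
  fun_prop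

theorem IsCutoff.hol_op (h : IsCutoff ζ K) : Hol univ (C.op ζ) := by
  have h1 : Hol univ fun q => C.tr q (ζ.H q) :=
    Hol.bilin (ContinuousLinearMap.id ℝ ((Euc N →L[ℝ] Euc N) →L[ℝ] ℝ)) C.hol_tr h.hH
  exact h.hdt.add (Hol.bilin (ContinuousLinearMap.mul ℝ ℝ) (Hol.const (1 / 2)) h1)

theorem IsCutoff.hol_cutG (h : IsCutoff ζ K) (hKU : K ⊆ U)
    (hA : Hol U A) (hu : Hol U u) (hp : Hol U p) : Hol univ (C.cutG l ζ A u p) := by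
  have hm : ∀ {φ ψ : Euc N × ℝ → ℝ}, Hol univ φ → (∀ q, q ∉ U → φ q = 0) → Hol U ψ →
      Hol univ fun q => φ q * ψ q := fun h1 h2 h3 =>
    Hol.bilin_cutoff (ContinuousLinearMap.mul ℝ ℝ) h1 h2 h3
  have hz : ∀ q, q ∉ U → ζ.val q = 0 := fun q hq => (h.zero q fun hK => hq (hKU hK)).1
  have h1 := hm h.hval hz hA
  have h2 := hm h.hval hz hu
  have h3 := hm (h.hol_op (C := C)) (fun q hq => h.op_zero fun hK => hq (hKU hK)) hu
  have h4 : Hol univ fun q => (C.tr q).comp (symTensor N (ζ.D q)) :=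
    Hol.comp_clm (symTensor N) C.hol_tr h.hD
  have h5 : Hol univ fun q => C.tr q (symTensor N (ζ.D q) (p q)) :=
    Hol.bilin_cutoff (ContinuousLinearMap.id ℝ (Euc N →L[ℝ] ℝ)) h4 (fun q hq => by
      rw [(h.zero q fun hK => hq (hKU hK)).2.1, map_zero]
      ext
      simp) hp
  have hc : ∀ (c : ℝ) {φ : Euc N × ℝ → ℝ}, Hol univ φ → Hol univ fun q => c * φ q :=
    fun c _ hφ => Hol.bilin (ContinuousLinearMap.mul ℝ ℝ) (Hol.const c) hφ
  exact (hc l h2).sub ((h1.add h3).add (hc (1 / 2) h5))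

theorem IsCutoff.mul_at (h : IsCutoff ζ K) (hKU : K ⊆ U) (hz : ∀ q ∈ U, z.At q) (q) :
    (ζ.mul z).At q := by
  by_cases hq : q ∈ U
  · exact (h.at' q).mul (hz q hq)
  · have hq' : q ∉ K := fun h => hq (hKU h)
    obtain ⟨h1, h2, h3, h4⟩ := h.zero q hq'
    refine Jet.At.of_eventually_zero ?_ ?_ (by simp [Jet.mul, h1, h4])
    rotate_left
    · ext v : 1
      simp [Jet.mul, h1, h2, h3]
    filter_upwards [h.closed.isOpen_compl.mem_nhds hq'] with p hp
    obtain ⟨h1, h2, -, -⟩ := h.zero p hp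
    simp [Jet.mul, h1, h2]

/-- A localized solution is a potential. -/
theorem IsCutoff.rep (h : IsCutoff ζ K) (hU : IsOpen U) (hKU : K ⊆ U) (hz : ∀ q ∈ U, z.At q)
    (hzA : ∀ q ∈ U, C.op z q = A q) (cA : ContinuousOn A U) (cz : ContinuousOn z.val U)
    (cD : ContinuousOn z.D U) (hA : Hol U A) (hzv : Hol U z.val) (hzD : Hol U z.D)
    (hl : 1 ≤ l) (hl2 : 2 * C.c1 ≤ √l) {G : ℝ} (hG : ∀ q, |C.cutG l ζ A z.val z.D q| ≤ G) :
    ∃ f : Euc N × ℝ → ℝ, Continuous f ∧ (∀ q, |f q| ≤ 2 * G) ∧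
      (∀ q, f q = C.KPot l f q + C.cutG l ζ A z.val z.D q) ∧
      (∀ q, ζ.val q * z.val q = C.Pot l f q) ∧
      ∀ q, ζ.val q • z.D q + z.val q • ζ.D q = C.DPot l f q := by
  have hc : Continuous (ζ.mul z).val :=
    continuous_of_cover hU h.closed hKU (h.cval.continuousOn.mul cz) fun q hq => by
      simp [Jet.mul, (h.zero q hq).1]
  obtain ⟨S, hS, -⟩ : Hol univ fun q => ζ.val q * z.val q :=
    Hol.bilin_cutoff (ContinuousLinearMap.mul ℝ ℝ) h.hval
      (fun q hq => (h.zero q fun hK => hq (hKU hK)).1) hzv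
  refine C.rep (w := ζ.mul z) hl hl2 (h.mul_at hKU hz) hc (fun q => hS q (mem_univ _))
    (h.continuous_cutG hU hKU cA cz cD) hG (h.hol_cutG hKU hA hzv hzD) fun q => ?_
  rw [Coef.op_mul]
  by_cases hq : q ∈ U
  · rw [hzA q hq]
    simp only [Jet.mul, Coef.cutG]
    ring
  · have hq' : q ∉ K := fun h => hq (hKU h)
    obtain ⟨h1, h2, -, -⟩ := h.zero q hq'
    simp [h.cutG_zero hq', h.op_zero hq', h1, h2, Jet.mul]

/-- A smooth profile: one on `(-∞, 1]`, zero on `[2, ∞)`. -/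
def profile (s : ℝ) : ℝ := Real.smoothTransition (2 - s)

theorem contDiff_profile {n : ℕ∞} : ContDiff ℝ n profile :=
  Real.smoothTransition.contDiff.comp (contDiff_const.sub contDiff_id)

theorem contDiff_deriv_profile {n : ℕ∞} : ContDiff ℝ n (deriv profile) :=
  ((contDiff_succ_iff_deriv (n := (n : WithTop ℕ∞))).1 (contDiff_profile (n := n + 1))).2.2

theorem contDiff_deriv2_profile {n : ℕ∞} : ContDiff ℝ n (deriv (deriv profile)) :=
  ((contDiff_succ_iff_deriv (n := (n : WithTop ℕ∞))).1 (contDiff_deriv_profile (n := n + 1))).2.2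

theorem profile_eq_zero {s : ℝ} (hs : 2 ≤ s) : profile s = 0 :=
  Real.smoothTransition.zero_of_nonpos (by linarith)

theorem profile_eq_one {s : ℝ} (hs : s ≤ 1) : profile s = 1 :=
  Real.smoothTransition.one_of_one_le (by linarith)

theorem deriv_profile_eq_zero {s : ℝ} (hs : 2 < s ∨ s < 1) : deriv profile s = 0 := by
  rcases hs with hs | hs
  · have : profile =ᶠ[𝓝 s] fun _ => 0 := by
      filter_upwards [Ioi_mem_nhds hs] with x hx using profile_eq_zero (le_of_lt hx)
    rw [this.deriv_eq, deriv_const]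
  · have : profile =ᶠ[𝓝 s] fun _ => 1 := by
      filter_upwards [Iio_mem_nhds hs] with x hx using profile_eq_one (le_of_lt hx)
    rw [this.deriv_eq, deriv_const]

theorem deriv2_profile_eq_zero {s : ℝ} (hs : 2 < s ∨ s < 1) : deriv (deriv profile) s = 0 := by
  have : deriv profile =ᶠ[𝓝 s] fun _ => 0 := by
    rcases hs with hs | hs
    · filter_upwards [Ioi_mem_nhds hs] with x hx using deriv_profile_eq_zero (Or.inl hx)
    · filter_upwards [Iio_mem_nhds hs] with x hx using deriv_profile_eq_zero (Or.inr hx)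
  rw [this.deriv_eq, deriv_const]

theorem exists_profile_bound : ∃ M, 0 ≤ M ∧ ∀ s,
    |deriv profile s| ≤ M ∧ |deriv (deriv profile) s| ≤ M := by
  obtain ⟨M₁, h1⟩ := (isCompact_Icc (a := (1 : ℝ)) (b := 2)).exists_bound_of_continuousOn
    (contDiff_deriv_profile (n := 0)).continuous.continuousOn
  obtain ⟨M₂, h2⟩ := (isCompact_Icc (a := (1 : ℝ)) (b := 2)).exists_bound_of_continuousOn
    (contDiff_deriv2_profile (n := 0)).continuous.continuousOn
  refine ⟨max (max M₁ M₂) 0, le_max_right _ _, fun s => ?_⟩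
  by_cases hs : s ∈ Icc (1 : ℝ) 2
  · exact ⟨(h1 s hs).trans ((le_max_left _ _).trans (le_max_left _ _)),
      (h2 s hs).trans ((le_max_right _ _).trans (le_max_left _ _))⟩
  · have hs' : 2 < s ∨ s < 1 := by
      by_contra! h
      exact hs ⟨h.2, h.1⟩
    rw [deriv_profile_eq_zero hs', deriv2_profile_eq_zero hs', abs_zero]
    exact ⟨le_max_right _ _, le_max_right _ _⟩

/-- Squared scaled distance to the point `c`. -/
def sqDist (c : Euc N × ℝ) (r : ℝ) (q : Euc N × ℝ) : ℝ :=
  (‖q.1 - c.1‖ ^ 2 + (q.2 - c.2) ^ 2) / r ^ 2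

/-- The radial cutoff jet of radius comparable to `r` around `c`. -/
def cutJet (c : Euc N × ℝ) (r : ℝ) : Jet N where
  val q := profile (sqDist c r q)
  D q := (deriv profile (sqDist c r q) * (2 / r ^ 2)) • (q.1 - c.1)
  H q := (deriv profile (sqDist c r q) * (2 / r ^ 2)) • ContinuousLinearMap.id ℝ (Euc N) +
    (deriv (deriv profile) (sqDist c r q) * (2 / r ^ 2) ^ 2 / 2) •
      symTensor N (q.1 - c.1) (q.1 - c.1)
  dt q := deriv profile (sqDist c r q) * (2 / r ^ 2 * (q.2 - c.2))

variable {c : Euc N × ℝ} {r : ℝ}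

theorem contDiff_sqDist {n : ℕ∞} : ContDiff ℝ n (sqDist c r) := by
  have h : ContDiff ℝ n fun q : Euc N × ℝ => ‖q.1 - c.1‖ ^ 2 :=
    (contDiff_fst.sub contDiff_const).norm_sq ℝ
  unfold sqDist
  exact (h.add ((contDiff_snd.sub contDiff_const).pow 2)).div_const _

theorem norm_le_of_sqDist (hr : 0 < r) {q : Euc N × ℝ} (h : sqDist c r q ≤ 2) :
    ‖q.1 - c.1‖ ≤ 3 / 2 * r ∧ |q.2 - c.2| ≤ 3 / 2 * r := by
  unfold sqDist at h
  rw [div_le_iff₀ (by positivity)] at h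
  have h1 : ‖q.1 - c.1‖ ^ 2 ≤ (3 / 2 * r) ^ 2 := by nlinarith [sq_nonneg (q.2 - c.2)]
  have h2 : |q.2 - c.2| ^ 2 ≤ (3 / 2 * r) ^ 2 := by
    rw [sq_abs]
    nlinarith [sq_nonneg ‖q.1 - c.1‖]
  exact ⟨(abs_le_of_sq_le_sq' h1 (by positivity)).2, (abs_le_of_sq_le_sq' h2 (by positivity)).2⟩

theorem sqDist_gt (hr : 0 < r) {q : Euc N × ℝ} (hq : q ∉ Metric.closedBall c (3 / 2 * r)) :
    2 < sqDist c r q := by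
  by_contra! h
  obtain ⟨h1, h2⟩ := norm_le_of_sqDist hr h
  refine hq ?_
  rw [mem_closedBall_iff_norm, Prod.norm_def]
  exact max_le h1 h2

theorem sqDist_lt (hr : 0 < r) {q : Euc N × ℝ} (hq : q ∈ Metric.ball c (r / 2)) :
    sqDist c r q < 1 := by
  rw [mem_ball_iff_norm, Prod.norm_def, max_lt_iff] at hq
  obtain ⟨h1, h2⟩ := hq
  simp only [Prod.fst_sub, Prod.snd_sub, Real.norm_eq_abs] at h1 h2
  unfold sqDist
  rw [div_lt_one (by positivity), ← sq_abs (q.2 - c.2)]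
  nlinarith [norm_nonneg (q.1 - c.1), abs_nonneg (q.2 - c.2)]

theorem cutJet_zero (hr : 0 < r) (q) (hq : q ∉ Metric.closedBall c (3 / 2 * r)) :
    (cutJet c r).val q = 0 ∧ (cutJet c r).D q = 0 ∧ (cutJet c r).H q = 0 ∧
      (cutJet c r).dt q = 0 := by
  have h := sqDist_gt hr hq
  have h1 := deriv_profile_eq_zero (Or.inl h)
  have h2 := deriv2_profile_eq_zero (Or.inl h)
  have h3 := profile_eq_zero h.le
  refine ⟨h3, by simp [cutJet, h1], ?_, by simp [cutJet, h1]⟩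
  ext v : 1
  simp [cutJet, h1, h2]

theorem cutJet_one (hr : 0 < r) {q} (hq : q ∈ Metric.ball c (r / 2)) :
    (cutJet c r).val q = 1 ∧ (cutJet c r).D q = 0 ∧ (cutJet c r).H q = 0 ∧
      (cutJet c r).dt q = 0 := by
  have h := sqDist_lt hr hq
  have h1 := deriv_profile_eq_zero (Or.inr h)
  have h2 := deriv2_profile_eq_zero (Or.inr h)
  have h3 := profile_eq_one h.le
  refine ⟨h3, by simp [cutJet, h1], ?_, by simp [cutJet, h1]⟩
  ext v : 1
  simp [cutJet, h1, h2]

theorem cutJet_at (c : Euc N × ℝ) (r : ℝ) (q) : (cutJet c r).At q := by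
  have hp : ∀ s, HasDerivAt profile (deriv profile s) s := fun s =>
    ((contDiff_profile (n := 1)).differentiable one_ne_zero s).hasDerivAt
  have hp' : ∀ s, HasDerivAt (deriv profile) (deriv (deriv profile) s) s := fun s =>
    ((contDiff_deriv_profile (n := 1)).differentiable one_ne_zero s).hasDerivAt
  have hs : HasFDerivAt (fun y => sqDist c r (y, q.2))
      ((2 / r ^ 2) • innerSL ℝ (q.1 - c.1)) q.1 := by
    have h1 : HasFDerivAt (fun y : Euc N => ‖y - c.1‖ ^ 2) ((2 : ℝ) • innerSL ℝ (q.1 - c.1)) q.1 := by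
      have := ((hasFDerivAt_id (𝕜 := ℝ) q.1).sub_const c.1).norm_sq
      refine this.congr_fderiv ?_
      ext v
      simp
    have h2 := (h1.add_const ((q.2 - c.2) ^ 2)).mul_const (r ^ 2)⁻¹
    refine HasFDerivAt.congr_fderiv (f' := (r ^ 2)⁻¹ • (2 : ℝ) • innerSL ℝ (q.1 - c.1)) ?_ ?_
    · simpa only [sqDist, div_eq_mul_inv] using h2
    · rw [smul_smul]
      congr 1
      ring
  refine ⟨?_, ?_, ?_⟩
  · have := (hp (sqDist c r q)).comp_hasFDerivAt q.1 hs
    refine this.congr_fderiv ?_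
    ext v
    simp [cutJet, inner_smul_left]
    ring
  · have h1 := ((hp' (sqDist c r q)).comp_hasFDerivAt q.1 hs).mul_const (2 / r ^ 2)
    have h2 := h1.fun_smul ((hasFDerivAt_id (𝕜 := ℝ) q.1).sub_const c.1)
    refine h2.congr_fderiv ?_
    ext1 v
    simp only [cutJet, symTensor_apply, _root_.add_apply, ContinuousLinearMap.smul_apply,
      ContinuousLinearMap.smulRight_apply, ContinuousLinearMap.id_apply, innerSL_apply_apply,
      smul_eq_mul, Function.comp_apply, id_eq, smul_smul, ← add_smul]
    congr 2
    ring
  · have h1 : HasDerivAt (fun s => sqDist c r (q.1, s)) (2 / r ^ 2 * (q.2 - c.2)) q.2 := by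
      have := ((((hasDerivAt_id q.2).sub_const c.2).pow 2).const_add (‖q.1 - c.1‖ ^ 2)).div_const
        (r ^ 2)
      refine HasDerivAt.congr_deriv this ?_
      simp
      ring
    exact (hp (sqDist c r q)).comp q.2 h1

theorem isCutoff_cutJet (hr : 0 < r) :
    IsCutoff (cutJet c r) (Metric.closedBall c (3 / 2 * r)) := by
  have hs := contDiff_sqDist (c := c) (r := r) (n := 1)
  have h0 : ContDiff ℝ 1 (cutJet c r).val := (contDiff_profile (n := 1)).comp hs
  have h1' : ContDiff ℝ 1 fun q => deriv profile (sqDist c r q) :=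
    (contDiff_deriv_profile (n := 1)).comp hs
  have h2' : ContDiff ℝ 1 fun q => deriv (deriv profile) (sqDist c r q) :=
    (contDiff_deriv2_profile (n := 1)).comp hs
  have hx : ContDiff ℝ 1 fun q : Euc N × ℝ => q.1 - c.1 := contDiff_fst.sub contDiff_const
  have hT : ContDiff ℝ 1 fun q : Euc N × ℝ => symTensor N (q.1 - c.1) (q.1 - c.1) :=
    contDiff_clm_diag (symTensor N) hx
  have h1 : ContDiff ℝ 1 (cutJet c r).D := (h1'.mul contDiff_const).smul hx
  have h2 : ContDiff ℝ 1 (cutJet c r).H :=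
    ((h1'.mul contDiff_const).smul contDiff_const).add
      (((h2'.mul contDiff_const).div_const 2).smul
        hT)
  have h3 : ContDiff ℝ 1 (cutJet c r).dt :=
    h1'.mul (contDiff_const.mul (contDiff_snd.sub contDiff_const))
  have hK := isCompact_closedBall c (3 / 2 * r)
  have hz := cutJet_zero (c := c) hr
  exact ⟨cutJet_at c r, h0.continuous, h1.continuous, h2.continuous, h3.continuous,
    Hol.of_contDiff h0 (HasCompactSupport.intro hK fun q hq => (hz q hq).1),
    Hol.of_contDiff h1 (HasCompactSupport.intro hK fun q hq => (hz q hq).2.1),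
    Hol.of_contDiff h2 (HasCompactSupport.intro hK fun q hq => (hz q hq).2.2.1),
    Hol.of_contDiff h3 (HasCompactSupport.intro hK fun q hq => (hz q hq).2.2.2),
    Metric.isClosed_closedBall, hz⟩

theorem abs_cutJet_val_le (q) : |(cutJet c r).val q| ≤ 1 :=
  abs_le.2 ⟨by linarith [Real.smoothTransition.nonneg (2 - sqDist c r q)
      , show (cutJet c r).val q = Real.smoothTransition (2 - sqDist c r q) from rfl],
    Real.smoothTransition.le_one _⟩

variable (N) in
theorem exists_cutJet_bound : ∃ M, 0 ≤ M ∧ ∀ (c : Euc N × ℝ) (r : ℝ), 0 < r → ∀ q,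
    ‖(cutJet c r).D q‖ ≤ M / r ∧ ‖(cutJet c r).H q‖ ≤ M / r ^ 2 ∧
      |(cutJet c r).dt q| ≤ M / r := by
  obtain ⟨M, hM, hb⟩ := exists_profile_bound
  refine ⟨11 * M, by positivity, fun c r hr q => ?_⟩
  by_cases hq : q ∈ Metric.closedBall c (3 / 2 * r)
  · rw [mem_closedBall_iff_norm, Prod.norm_def, max_le_iff] at hq
    obtain ⟨hx, ht⟩ := hq
    simp only [Prod.fst_sub, Prod.snd_sub, Real.norm_eq_abs] at hx ht
    obtain ⟨h1, h2⟩ := hb (sqDist c r q)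
    refine ⟨?_, ?_, ?_⟩
    · simp only [cutJet, norm_smul, norm_mul, Real.norm_eq_abs]
      rw [abs_of_pos (by positivity : 0 < 2 / r ^ 2)]
      calc _ ≤ M * (2 / r ^ 2) * (3 / 2 * r) := by gcongr
        _ = 3 * M / r := by field_simp
        _ ≤ 11 * M / r := by gcongr; norm_num
    · have h4 : ‖symTensor N (q.1 - c.1) (q.1 - c.1)‖ ≤ 2 * (3 / 2 * r) * (3 / 2 * r) :=
        (norm_symTensor_le _ _).trans (by gcongr)
      simp only [cutJet]
      refine (norm_add_le _ _).trans ?_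
      rw [mul_div_assoc]
      simp only [norm_smul, norm_mul, Real.norm_eq_abs]
      rw [abs_of_pos (by positivity : 0 < 2 / r ^ 2),
        abs_of_pos (by positivity : 0 < (2 / r ^ 2) ^ 2 / 2), ← mul_div_assoc]
      calc _ ≤ M * (2 / r ^ 2) * 1 + M * (2 / r ^ 2) ^ 2 / 2 * (2 * (3 / 2 * r) * (3 / 2 * r)) := by
            refine add_le_add (mul_le_mul ?_ ContinuousLinearMap.norm_id_le (norm_nonneg _)
              (by positivity)) (mul_le_mul ?_ h4 (norm_nonneg _) (by positivity))
            · rw [mul_div_assoc]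
              gcongr
            · rw [mul_div_assoc M]
              gcongr
        _ = 11 * M / r ^ 2 := by
            field_simp
            ring
    · simp only [cutJet, abs_mul]
      rw [abs_of_pos (by positivity : 0 < 2 / r ^ 2)]
      calc _ ≤ M * (2 / r ^ 2 * (3 / 2 * r)) := by gcongr
        _ = 3 * M / r := by field_simp
        _ ≤ 11 * M / r := by gcongr; norm_num
  · obtain ⟨-, h1, h2, h3⟩ := cutJet_zero hr q hq
    rw [h1, h2, h3, norm_zero, norm_zero, abs_zero]
    exact ⟨by positivity, by positivity, by positivity⟩

end Cutoff

/-! ### Interior estimates and limits -/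

section Interior

variable {N : ℕ}

/-- On `U` the jet `z` is the jet of a function with `op z = A`, and the data are regular. -/
structure Coef.Solves (C : Coef N) (z : Jet N) (A : Euc N × ℝ → ℝ) (U : Set (Euc N × ℝ)) :
    Prop where
  at' : ∀ q ∈ U, z.At q
  op_eq : ∀ q ∈ U, C.op z q = A q
  cA : ContinuousOn A U
  cval : ContinuousOn z.val U
  cD : ContinuousOn z.D U
  hA : Hol U A
  hval : Hol U z.val
  hD : Hol U z.D

variable {C : Coef N}

theorem Coef.Solves.mono {z : Jet N} {A : Euc N × ℝ → ℝ} {U V : Set (Euc N × ℝ)}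
    (h : C.Solves z A U) (hVU : V ⊆ U) : C.Solves z A V :=
  ⟨fun q hq => h.at' q (hVU hq), fun q hq => h.op_eq q (hVU hq), h.cA.mono hVU, h.cval.mono hVU,
    h.cD.mono hVU, h.hA.mono hVU, h.hval.mono hVU, h.hD.mono hVU⟩

theorem Coef.abs_tr_le (C : Coef N) (q) (M : Euc N →L[ℝ] Euc N) : |C.tr q M| ≤ C.Λ * ‖M‖ :=
  (C.tr q).le_of_opNorm_le (C.tr_le q) M

theorem Coef.abs_tr_symTensor_le (C : Coef N) (q) (p p' : Euc N) :
    |C.tr q (symTensor N p p')| ≤ C.Λ * (2 * ‖p‖ * ‖p'‖) :=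
  (C.abs_tr_le q _).trans
    (mul_le_mul_of_nonneg_left (norm_symTensor_le _ _) C.Λ_pos.le)

/-- The pointwise bound on the forcing of a localized equation. -/
theorem Coef.abs_cutG_le {l : ℝ} {ζ : Jet N} {A u : Euc N × ℝ → ℝ} {p : Euc N × ℝ → Euc N}
    {q : Euc N × ℝ} {M : ℝ} (hl : 0 ≤ l) (h1 : |ζ.val q| ≤ 1) (h2 : |C.op ζ q| ≤ M)
    {a S P Z : ℝ} (hA : |A q| ≤ a) (hu : |u q| ≤ S) (hp : ‖p q‖ ≤ P) (hZ : ‖ζ.D q‖ ≤ Z) :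
    |C.cutG l ζ A u p q| ≤ l * S + a + M * S + C.Λ * Z * P := by
  have e1 : |l * (ζ.val q * u q)| ≤ l * (1 * S) := by
    rw [abs_mul, abs_mul, abs_of_nonneg hl]
    gcongr
  have e2 : |ζ.val q * A q| ≤ 1 * a := by
    rw [abs_mul]
    gcongr
  have hM := (abs_nonneg _).trans h2
  have hZ' := (norm_nonneg _).trans hZ
  have hΛ := C.Λ_pos
  have e3 : |C.op ζ q * u q| ≤ M * S := by
    rw [abs_mul]
    gcongr
  have e4 : |1 / 2 * C.tr q (symTensor N (ζ.D q) (p q))| ≤ 1 / 2 * (C.Λ * (2 * Z * P)) := by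
    rw [abs_mul, abs_of_pos (by norm_num : (0 : ℝ) < 1 / 2)]
    have := C.abs_tr_symTensor_le q (ζ.D q) (p q)
    refine mul_le_mul_of_nonneg_left (this.trans ?_) (by norm_num)
    gcongr
  unfold Coef.cutG
  refine (abs_sub _ _).trans ?_
  have e5 := abs_add_le (ζ.val q * A q + C.op ζ q * u q)
    (1 / 2 * C.tr q (symTensor N (ζ.D q) (p q)))
  have e6 := abs_add_le (ζ.val q * A q) (C.op ζ q * u q)
  linarith

theorem Coef.abs_op_cutJet_le {M : ℝ} {c : Euc N × ℝ} {r : ℝ} {q : Euc N × ℝ}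
    (h2 : ‖(cutJet c r).H q‖ ≤ M / r ^ 2) (h3 : |(cutJet c r).dt q| ≤ M / r) :
    |C.op (cutJet c r) q| ≤ M / r + C.Λ * (M / r ^ 2) := by
  unfold Coef.op
  have h4 := C.abs_tr_le q ((cutJet c r).H q)
  have h5 := mul_le_mul_of_nonneg_left h2 C.Λ_pos.le
  have h6 := abs_add_le ((cutJet c r).dt q) (1 / 2 * C.tr q ((cutJet c r).H q))
  rw [abs_mul, abs_of_pos (by norm_num : (0 : ℝ) < 1 / 2)] at h6
  have h7 := abs_nonneg (C.tr q ((cutJet c r).H q))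
  linarith

theorem closedBall_subset_ball' {X : Type*} [PseudoMetricSpace X] {x y : X} {s R : ℝ}
    (h : s + dist x y < R) : Metric.closedBall x s ⊆ Metric.ball y R := fun _ hq =>
  Metric.mem_ball.2 ((dist_triangle _ x _).trans_lt
    ((add_le_add_left (Metric.mem_closedBall.1 hq) _).trans_lt h))

variable (C) in
/-- Interior gradient estimate. -/
theorem Coef.interior_grad {M : ℝ} (hM : 0 ≤ M) : ∃ K, 0 ≤ K ∧ ∀ (c : Euc N × ℝ) (R : ℝ)
    (z : Jet N) (A : Euc N × ℝ → ℝ) (S : ℝ), 0 < R → R ≤ 1 → C.Solves z A (Metric.ball c R) →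
    (∀ q ∈ Metric.ball c R, |z.val q| ≤ S) →
    (∀ q ∈ Metric.ball c R, |A q| ≤ M * (S + ‖z.D q‖)) →
    ∀ q ∈ Metric.ball c R, (R - dist q c) * ‖z.D q‖ ≤ K * S := by
  obtain ⟨Kc, hKc, hcut⟩ := exists_cutJet_bound N
  have hΛ := C.Λ_pos
  have hc1 := C.c1_nonneg
  set a : ℝ := M + (1 + C.Λ) * Kc with ha
  have ha0 : 0 ≤ a := by positivity
  set s : ℝ := 1 + 2 * C.c1 + 16 * C.c1 * a with hs
  have hs1 : 1 ≤ s := by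
    have : 0 ≤ 16 * C.c1 * a := by positivity
    linarith
  have hs2 : 2 * C.c1 ≤ s := by
    have : 0 ≤ 16 * C.c1 * a := by positivity
    linarith
  have hs3 : 8 * C.c1 / s * a ≤ 1 / 2 := by
    rw [div_mul_eq_mul_div, div_le_iff₀ (by linarith)]
    linarith
  refine ⟨2 * (8 * C.c1 / s * (s ^ 2 + a)), by positivity,
    fun c R z A S hR hR1 hz hS hA => ?_⟩
  set U := Metric.ball c R with hU
  set d : Euc N × ℝ → ℝ := fun q => R - dist q c with hd
  obtain ⟨K₀, hK₀, hD₀, -⟩ := hz.hD.exists_nonneg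
  have hS0 : 0 ≤ S := (abs_nonneg _).trans (hS c (Metric.mem_ball_self hR))
  have hbdd : BddAbove ((fun q => d q * ‖z.D q‖) '' U) := by
    refine ⟨R * K₀, ?_⟩
    rintro _ ⟨q, hq, rfl⟩
    have h1 := hD₀ q hq
    have h2 : d q ≤ R := by simp [hd]
    dsimp only
    gcongr
  set A₀ := sSup ((fun q => d q * ‖z.D q‖) '' U) with hA₀
  have hle : ∀ q ∈ U, d q * ‖z.D q‖ ≤ A₀ := fun q hq => le_csSup hbdd ⟨q, hq, rfl⟩
  have hA₀0 : 0 ≤ A₀ := by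
    refine le_trans ?_ (hle c (Metric.mem_ball_self hR))
    have : 0 ≤ d c := by simp [hd, hR.le]
    positivity
  have key : ∀ q ∈ U, d q * ‖z.D q‖ ≤ 1 / 2 * A₀ + 8 * C.c1 / s * (s ^ 2 + a) * S := by
    intro q₀ hq₀
    have hd0 : 0 < d q₀ := sub_pos.2 (Metric.mem_ball.1 hq₀)
    have hdR : d q₀ ≤ 1 := by
      have : 0 ≤ dist q₀ c := dist_nonneg
      simp only [hd]
      linarith
    obtain ⟨r, hr⟩ : ∃ r, r = d q₀ / 4 := ⟨_, rfl⟩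
    have hr0 : 0 < r := by linarith
    have hr1 : r ≤ 1 := by linarith
    have hdist : dist q₀ c = R - 4 * r := by
      rw [hr]
      simp only [hd]
      ring
    have hKU : Metric.closedBall q₀ (3 / 2 * r) ⊆ U :=
      closedBall_subset_ball' (by rw [hdist]; linarith)
    have hDK : ∀ q ∈ Metric.closedBall q₀ (3 / 2 * r), ‖z.D q‖ ≤ A₀ / (2 * r) := by
      intro q hq
      have h1 := hle q (hKU hq)
      have h2 : 2 * r ≤ d q := by
        have := dist_triangle q q₀ c
        have := Metric.mem_closedBall.1 hq
        simp only [hd]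
        linarith
      rw [le_div_iff₀ (by linarith), mul_comm]
      exact (mul_le_mul_of_nonneg_right h2 (norm_nonneg _)).trans h1
    have hcutoff := isCutoff_cutJet (c := q₀) hr0
    have hl : 1 ≤ (s / r) ^ 2 := by
      have : 1 ≤ s / r := by
        rw [le_div_iff₀ hr0]
        linarith
      nlinarith
    have hsq : √((s / r) ^ 2) = s / r := Real.sqrt_sq (by positivity)
    have hl2 : 2 * C.c1 ≤ √((s / r) ^ 2) := by
      rw [hsq]
      refine hs2.trans ?_
      rw [le_div_iff₀ hr0]
      nlinarith
    have hG : ∀ q, |C.cutG ((s / r) ^ 2) (cutJet q₀ r) A z.val z.D q| ≤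
        ((s ^ 2 + a) * S + a * A₀) / r ^ 2 := by
      intro q
      by_cases hq : q ∈ Metric.closedBall q₀ (3 / 2 * r)
      · obtain ⟨b1, b2, b3⟩ := hcut q₀ r hr0 q
        have hqU := hKU hq
        have hA' : |A q| ≤ M * (S + A₀ / (2 * r)) :=
          (hA q hqU).trans (mul_le_mul_of_nonneg_left (by linarith [hDK q hq]) hM)
        refine (C.abs_cutG_le (sq_nonneg _) (abs_cutJet_val_le q) (C.abs_op_cutJet_le b2 b3)
          hA' (hS q hqU) (hDK q hq) b1).trans ?_
        rw [le_div_iff₀ (by positivity)]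
        have e1 : ((s / r) ^ 2 * S + M * (S + A₀ / (2 * r)) + (Kc / r + C.Λ * (Kc / r ^ 2)) * S +
            C.Λ * (Kc / r) * (A₀ / (2 * r))) * r ^ 2 =
            s ^ 2 * S + M * (S * r ^ 2 + A₀ * r / 2) + (Kc * r + C.Λ * Kc) * S +
            C.Λ * Kc * A₀ / 2 := by
          field_simp
        rw [e1, ha]
        have e2 : r ^ 2 ≤ 1 := pow_le_one₀ hr0.le hr1
        have e3 : M * (S * r ^ 2 + A₀ * r / 2) ≤ M * (S * 1 + A₀ * 1 / 1) := by
          gcongr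
          norm_num
        have e4 : (Kc * r + C.Λ * Kc) * S ≤ (Kc * 1 + C.Λ * Kc) * S := by gcongr
        have e5 : 0 ≤ C.Λ * Kc * A₀ := by positivity
        have e6 : 0 ≤ Kc * A₀ := by positivity
        linarith
      · rw [hcutoff.cutG_zero hq, abs_zero]
        positivity
    obtain ⟨f, hf, hfb, -, -, hfD⟩ := hcutoff.rep Metric.isOpen_ball hKU hz.at' hz.op_eq hz.cA
      hz.cval hz.cD hz.hA hz.hval hz.hD hl hl2 hG
    have h1 := hfD q₀
    obtain ⟨e1, e2, -, -⟩ := cutJet_one (c := q₀) hr0 (Metric.mem_ball_self (by linarith))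
    rw [e1, e2, one_smul, smul_zero, add_zero] at h1
    have h2 := C.norm_DPot_le (l := (s / r) ^ 2) (by linarith) hf hfb q₀
    rw [← h1, hsq] at h2
    have h3 : d q₀ = 4 * r := by linarith
    rw [h3]
    calc 4 * r * ‖z.D q₀‖ ≤ 4 * r * (2 * (((s ^ 2 + a) * S + a * A₀) / r ^ 2) * C.c1 *
          (1 / (s / r))) := by gcongr
      _ = 8 * C.c1 / s * a * A₀ + 8 * C.c1 / s * (s ^ 2 + a) * S := by
          field_simp
          ring
      _ ≤ _ := by gcongr
  have hfin : A₀ ≤ 1 / 2 * A₀ + 8 * C.c1 / s * (s ^ 2 + a) * S := by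
    refine csSup_le ⟨_, c, Metric.mem_ball_self hR, rfl⟩ ?_
    rintro _ ⟨q, hq, rfl⟩
    exact key q hq
  intro q hq
  have := hle q hq
  linarith

theorem Coef.cutG_sub (C : Coef N) (l : ℝ) (ζ : Jet N) (A u A' u' : Euc N × ℝ → ℝ)
    (p p' : Euc N × ℝ → Euc N) (q : Euc N × ℝ) :
    C.cutG l ζ A u p q - C.cutG l ζ A' u' p' q =
      C.cutG l ζ (fun q => A q - A' q) (fun q => u q - u' q) (fun q => p q - p' q) q := by
  simp only [Coef.cutG, map_sub]
  ring

/-- A localized uniform limit of solutions is a potential. -/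
theorem Coef.limit_rep {U : Set (Euc N × ℝ)} (hU : IsOpen U) {z : ℕ → Jet N}
    {An : ℕ → Euc N × ℝ → ℝ} (hz : ∀ᶠ n in atTop, C.Solves (z n) (An n) U)
    {u A : Euc N × ℝ → ℝ} {p : Euc N × ℝ → Euc N}
    (hu : TendstoUniformlyOn (fun n => (z n).val) u atTop U)
    (hp : TendstoUniformlyOn (fun n => (z n).D) p atTop U)
    (hA : TendstoUniformlyOn An A atTop U)
    {c : Euc N × ℝ} {r : ℝ} (hr : 0 < r) (hcU : Metric.closedBall c (3 / 2 * r) ⊆ U) :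
    ∃ l B : ℝ, 1 ≤ l ∧ ∃ f : Euc N × ℝ → ℝ, Continuous f ∧ (∀ q, |f q| ≤ B) ∧
      (∀ q, f q = C.KPot l f q + C.cutG l (cutJet c r) A u p q) ∧
      ∀ q ∈ Metric.ball c (r / 2), u q = C.Pot l f q ∧ p q = C.DPot l f q := by
  obtain ⟨l, hl, hl2⟩ : ∃ l : ℝ, 1 ≤ l ∧ 2 * C.c1 ≤ √l := by
    have hc1 := C.c1_nonneg
    refine ⟨(1 + 2 * C.c1) ^ 2, by nlinarith, ?_⟩
    rw [Real.sqrt_sq (by positivity)]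
    linarith
  have hl0 : 0 < l := by linarith
  have hζ := isCutoff_cutJet (c := c) hr
  set ζ := cutJet c r with hζdef
  have cu : ContinuousOn u U := hu.continuousOn (hz.mono fun n h => h.cval).frequently
  have cp : ContinuousOn p U := hp.continuousOn (hz.mono fun n h => h.cD).frequently
  have cA : ContinuousOn A U := hA.continuousOn (hz.mono fun n h => h.cA).frequently
  have cg := hζ.continuous_cutG (C := C) (l := l) hU hcU cA cu cp
  have hbd : ∀ {g : Euc N × ℝ → ℝ}, Continuous g →
      (∀ q, q ∉ Metric.closedBall c (3 / 2 * r) → g q = 0) → ∃ G, ∀ q, |g q| ≤ G :=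
    fun h h0 => h.bounded_above_of_compact_support
      (HasCompactSupport.intro (isCompact_closedBall _ _) h0)
  obtain ⟨G, hG⟩ := hbd cg fun q hq => hζ.cutG_zero hq
  obtain ⟨f, hf, hfb, hfg⟩ := C.exists_resolvent hl hl2 cg hG
  obtain ⟨M₁, hM₁, hM₁', -⟩ := (hζ.hol_op (C := C)).exists_nonneg
  obtain ⟨M₂, hM₂, hM₂', -⟩ := hζ.hD.exists_nonneg
  have hΛ := C.Λ_pos
  have hdiff : ∀ ε > 0, ∀ᶠ n in atTop, ∃ fn : Euc N × ℝ → ℝ, Continuous fn ∧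
      (∃ B, ∀ q, |fn q| ≤ B) ∧
      (∀ q, |fn q - f q| ≤ 2 * ((l + 1 + M₁ + C.Λ * M₂) * ε)) ∧
      (∀ q, ζ.val q * (z n).val q = C.Pot l fn q) ∧
      ∀ q, ζ.val q • (z n).D q + (z n).val q • ζ.D q = C.DPot l fn q := by
    intro ε hε
    filter_upwards [hz, Metric.tendstoUniformlyOn_iff.1 hu ε hε,
      Metric.tendstoUniformlyOn_iff.1 hp ε hε, Metric.tendstoUniformlyOn_iff.1 hA ε hε]
      with n hn h1 h2 h3
    have cn := hζ.continuous_cutG (C := C) (l := l) hU hcU hn.cA hn.cval hn.cD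
    obtain ⟨Gn, hGn⟩ := hbd cn fun q hq => hζ.cutG_zero hq
    obtain ⟨fn, hfn, hfnb, hfng, e1, e2⟩ := hζ.rep hU hcU hn.at' hn.op_eq hn.cA hn.cval hn.cD hn.hA
      hn.hval hn.hD hl hl2 hGn
    refine ⟨fn, hfn, ⟨_, hfnb⟩, ?_, e1, e2⟩
    refine C.resolvent_bound hl hl2 (B := 2 * Gn + 2 * G) (hfn.sub hf)
      (fun q => (abs_sub _ _).trans (add_le_add (hfnb q) (hfb q)))
      (g := fun q => C.cutG l ζ (An n) (z n).val (z n).D q - C.cutG l ζ A u p q)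
      (fun q => ?_) fun q => ?_
    · by_cases hq : q ∈ Metric.closedBall c (3 / 2 * r)
      · have hqU := hcU hq
        rw [C.cutG_sub]
        refine (C.abs_cutG_le hl0.le (abs_cutJet_val_le q) (hM₁' q (mem_univ _)) (a := ε) (S := ε)
          (P := ε) ?_ ?_ ?_ (hM₂' q (mem_univ _))).trans (by linarith)
        · rw [abs_sub_comm]
          exact (h3 q hqU).le
        · rw [abs_sub_comm]
          exact (h1 q hqU).le
        · rw [← dist_eq_norm, dist_comm]
          exact (h2 q hqU).le
      · rw [hζ.cutG_zero hq, hζ.cutG_zero hq, sub_zero, abs_zero]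
        positivity
    · rw [C.KPot_sub hl0 hfn hfnb hf hfb, hfng q, hfg q]
      ring
  refine ⟨l, 2 * G, hl, f, hf, hfb, hfg, fun q hq => ?_⟩
  obtain ⟨e1, e2, -, -⟩ := cutJet_one (c := c) hr hq
  have hqU : q ∈ U := hcU (Metric.closedBall_subset_closedBall (by linarith)
    (Metric.ball_subset_closedBall hq))
  have hκ : 0 < l + 1 + M₁ + C.Λ * M₂ := by positivity
  have hto : ∀ (b : ℝ) {a : ℝ}, 0 ≤ b → (∀ ε > 0, a ≤ 2 * ((l + 1 + M₁ + C.Λ * M₂) * ε) * b) →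
      a ≤ 0 := by
    intro b a hb h
    refine le_of_forall_pos_le_add fun δ hδ => ?_
    have h1 := h (δ / (2 * (l + 1 + M₁ + C.Λ * M₂) * (b + 1))) (by positivity)
    have h2 : 2 * ((l + 1 + M₁ + C.Λ * M₂) * (δ / (2 * (l + 1 + M₁ + C.Λ * M₂) * (b + 1)))) * b
        = δ * (b / (b + 1)) := by field_simp
    have h3 : b / (b + 1) ≤ 1 := by
      rw [div_le_one (by linarith)]
      linarith
    rw [h2] at h1
    nlinarith
  constructor
  · have h1 : Tendsto (fun n => (z n).val q) atTop (𝓝 (u q)) := hu.tendsto_at hqU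
    have h2 : Tendsto (fun n => |(z n).val q - C.Pot l f q|) atTop (𝓝 |u q - C.Pot l f q|) :=
      (h1.sub_const _).abs
    refine sub_eq_zero.1 (abs_eq_zero.1 (le_antisymm ?_ (abs_nonneg _)))
    refine hto (C.c1 * (1 / l)) (mul_nonneg C.c1_nonneg (by positivity)) fun ε hε => ?_
    refine le_of_tendsto h2 ((hdiff ε hε).mono fun n hn => ?_)
    obtain ⟨fn, hfn, ⟨B, hB⟩, h3, h4, -⟩ := hn
    have h5 := h4 q
    rw [e1, one_mul] at h5
    rw [h5, ← C.Pot_sub hl0 hfn hB hf hfb, ← mul_assoc]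
    exact C.abs_Pot_le hl0 (hfn.sub hf) h3 q
  · have h1 : Tendsto (fun n => (z n).D q) atTop (𝓝 (p q)) := hp.tendsto_at hqU
    have h2 : Tendsto (fun n => ‖(z n).D q - C.DPot l f q‖) atTop (𝓝 ‖p q - C.DPot l f q‖) :=
      (h1.sub_const _).norm
    refine sub_eq_zero.1 (norm_eq_zero.1 (le_antisymm ?_ (norm_nonneg _)))
    refine hto (C.c1 * (1 / √l)) (mul_nonneg C.c1_nonneg (by positivity)) fun ε hε => ?_
    refine le_of_tendsto h2 ((hdiff ε hε).mono fun n hn => ?_)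
    obtain ⟨fn, hfn, ⟨B, hB⟩, h3, -, h4⟩ := hn
    have h5 := h4 q
    rw [e1, e2, one_smul, smul_zero, add_zero] at h5
    rw [h5, ← C.DPot_sub hl0 hfn hB hf hfb, ← mul_assoc]
    exact C.norm_DPot_le hl0 (hfn.sub hf) h3 q

/-- A local uniform limit of solutions is a classical solution. -/
theorem Coef.limit_local {c : Euc N × ℝ} {R : ℝ} (hR : 0 < R) {z : ℕ → Jet N}
    {An : ℕ → Euc N × ℝ → ℝ} (hz : ∀ᶠ n in atTop, C.Solves (z n) (An n) (Metric.ball c R))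
    {u A : Euc N × ℝ → ℝ} {p : Euc N × ℝ → Euc N}
    (hu : TendstoUniformlyOn (fun n => (z n).val) u atTop (Metric.ball c R))
    (hp : TendstoUniformlyOn (fun n => (z n).D) p atTop (Metric.ball c R))
    (hA : TendstoUniformlyOn An A atTop (Metric.ball c R))
    (hAh : ∀ V ⊆ Metric.ball c R, Hol V u → Hol V p → Hol V A) :
    ∃ ρ > 0, ∃ (H : Euc N × ℝ → Euc N →L[ℝ] Euc N) (dt : Euc N × ℝ → ℝ),
      Continuous H ∧ Continuous dt ∧
      ∀ q ∈ Metric.ball c ρ, (⟨u, p, H, dt⟩ : Jet N).At q ∧ C.op ⟨u, p, H, dt⟩ q = A q := by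
  obtain ⟨l, B, hl, f, hf, hfb, -, hfu⟩ := Coef.limit_rep Metric.isOpen_ball hz hu hp hA
    (half_pos hR) (Metric.closedBall_subset_ball (by linarith) : _ ⊆ Metric.ball c R)
  have hV : Metric.ball c (R / 2 / 2) ⊆ Metric.ball c R := Metric.ball_subset_ball (by linarith)
  have hul : Hol (Metric.ball c (R / 2 / 2)) u :=
    ((C.hol_Pot hl hf hfb).mono (subset_univ _)).congr fun q hq => (hfu q hq).1
  have hpl : Hol (Metric.ball c (R / 2 / 2)) p :=
    ((C.hol_DPot hl hf hfb).mono (subset_univ _)).congr fun q hq => (hfu q hq).2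
  have hAl := hAh _ hV hul hpl
  obtain ⟨r, hr⟩ : ∃ r, r = R / 8 := ⟨_, rfl⟩
  have hr0 : 0 < r := by linarith
  have hcV : Metric.closedBall c (3 / 2 * r) ⊆ Metric.ball c (R / 2 / 2) :=
    Metric.closedBall_subset_ball (by linarith)
  obtain ⟨l, B, hl, f, hf, hfb, hfg, hfu⟩ := Coef.limit_rep Metric.isOpen_ball hz hu hp hA
    hr0 (hcV.trans hV)
  have hl0 : 0 < l := by linarith
  have hg : Hol univ (C.cutG l (cutJet c r) A u p) :=
    (isCutoff_cutJet hr0).hol_cutG hcV hAl hul hpl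
  have hfh := C.hol_of_resolvent hl hf hfb hg hfg
  obtain ⟨B', hb', hh'⟩ := exists_holder_bound hfh
  have cH : Continuous (C.potJet l f).H := C.continuous_D2Pot hl0 hf hb' hh'
  have cdt : Continuous (C.potJet l f).dt := by
    have h1 := C.continuous_Pot hl0 hf hfb
    have h2 := C.continuous_KPot hl0 hf hfb
    have h3 := C.continuous_tr
    have h4 : (C.potJet l f).dt = fun q => l * C.Pot l f q + C.KPot l f q - f q -
        1 / 2 * C.tr q ((C.potJet l f).H q) := by
      ext q
      have := C.op_potJet (l := l) (f := f) q
      unfold Coef.op at this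
      linarith
    rw [h4]
    exact (((continuous_const.mul h1).add h2).sub hf).sub (continuous_const.mul (h3.clm_apply cH))
  refine ⟨r / 2, by linarith, (C.potJet l f).H, (C.potJet l f).dt, cH, cdt, fun q hq => ⟨?_, ?_⟩⟩
  · refine (C.potJet_at hl0 hf hfh q).congr ?_ rfl rfl
    filter_upwards [Metric.isOpen_ball.mem_nhds hq] with y hy using hfu y hy
  · have h1 : C.op ⟨u, p, (C.potJet l f).H, (C.potJet l f).dt⟩ q = C.op (C.potJet l f) q := rfl
    rw [h1, C.op_potJet, hfg q, ← (hfu q hq).1]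
    obtain ⟨e1, e2, e3, e4⟩ := cutJet_one (c := c) hr0 hq
    simp [Coef.cutG, Coef.op, e1, e2, e3, e4]
    ring

end Interior

/-! ### The nonlinear equation with globally Lipschitz data -/

section Nonlinear

variable {N : ℕ}

theorem Hol.nonlinear {F : Euc N × ℝ → ℝ → Euc N → ℝ} {U : Set (Euc N × ℝ)} {L₀ L₁ L₂ : ℝ}
    (h0 : ∀ q ∈ U, |F q 0 0| ≤ L₀)
    (h1 : ∀ x x' t u p, (x, t) ∈ U → (x', t) ∈ U →
      |F (x, t) u p - F (x', t) u p| ≤ L₁ * (1 + |u| + ‖p‖) * √‖x - x'‖)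
    (h2 : ∀ q ∈ U, ∀ u u' p p', |F q u p - F q u' p'| ≤ L₂ * (|u - u'| + ‖p - p'‖))
    {u : Euc N × ℝ → ℝ} {p : Euc N × ℝ → Euc N} (hu : Hol U u) (hp : Hol U p) :
    Hol U fun q => F q (u q) (p q) := by
  obtain ⟨K, hK, hu1, hu2⟩ := hu.exists_nonneg
  obtain ⟨K', hK', hp1, hp2⟩ := hp.exists_nonneg
  refine Hol.of_bounds (K₁ := L₀ + |L₂| * (K + K'))
    (K₂ := |L₁| * (1 + K + K') + |L₂| * (K + K')) (fun q hq => ?_) fun x x' t hx hx' => ?_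
  · have e1 := h2 q hq (u q) 0 (p q) 0
    rw [sub_zero, sub_zero] at e1
    have e2 : L₂ * (|u q| + ‖p q‖) ≤ |L₂| * (K + K') := by
      gcongr
      · exact le_abs_self _
      · exact hu1 q hq
      · exact hp1 q hq
    have e3 := abs_sub_abs_le_abs_sub (F q (u q) (p q)) (F q 0 0)
    have e4 := h0 q hq
    rw [Real.norm_eq_abs]
    linarith
  · have e1 := h1 x x' t (u (x, t)) (p (x, t)) hx hx'
    have e2 := h2 _ hx' (u (x, t)) (u (x', t)) (p (x, t)) (p (x', t))
    have e3 : L₁ * (1 + |u (x, t)| + ‖p (x, t)‖) * √‖x - x'‖ ≤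
        |L₁| * (1 + K + K') * √‖x - x'‖ := by
      gcongr
      · exact le_abs_self _
      · exact hu1 _ hx
      · exact hp1 _ hx
    have e4 : L₂ * (|u (x, t) - u (x', t)| + ‖p (x, t) - p (x', t)‖) ≤
        |L₂| * (K * √‖x - x'‖ + K' * √‖x - x'‖) := by
      gcongr
      · exact le_abs_self _
      · exact hu2 x x' t hx hx'
      · exact hp2 x x' t hx hx'
    have e5 := abs_sub_le (F (x, t) (u (x, t)) (p (x, t))) (F (x', t) (u (x, t)) (p (x, t)))
      (F (x', t) (u (x', t)) (p (x', t)))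
    rw [Real.norm_eq_abs]
    refine e5.trans ((add_le_add (e1.trans e3) (e2.trans e4)).trans (le_of_eq ?_))
    ring

/-- The jet of `exp (-l (t - T))`. -/
def expJet (N : ℕ) (l T : ℝ) : Jet N where
  val q := Real.exp (-l * (q.2 - T))
  D _ := 0
  H _ := 0
  dt q := -l * Real.exp (-l * (q.2 - T))

theorem expJet_at (l T : ℝ) (q) : (expJet N l T).At q where
  hD := by
    rw [show (expJet N l T).D q = 0 from rfl, map_zero]
    exact hasFDerivAt_const (Real.exp (-l * (q.2 - T))) q.1
  hH := hasFDerivAt_const (0 : Euc N) q.1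
  ht := by
    have h := ((((hasDerivAt_id q.2).sub_const T).const_mul (-l))).exp
    refine HasDerivAt.congr_deriv h ?_
    simp [expJet, mul_comm]

/-- A time cutoff: one for `t ≤ T`, zero for `t ≥ T + 1 / l`. -/
def timeCut (l T t : ℝ) : ℝ := max 0 (min 1 (1 - l * (t - T)))

theorem continuous_timeCut (l T : ℝ) : Continuous (timeCut l T) := by
  unfold timeCut
  fun_prop

theorem timeCut_nonneg (l T t : ℝ) : 0 ≤ timeCut l T t := le_max_left _ _

theorem timeCut_le_one (l T t : ℝ) : timeCut l T t ≤ 1 :=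
  max_le zero_le_one (min_le_left _ _)

theorem timeCut_eq_one {l T t : ℝ} (hl : 0 ≤ l) (ht : t ≤ T) : timeCut l T t = 1 := by
  have : l * (t - T) ≤ 0 := mul_nonpos_of_nonneg_of_nonpos hl (by linarith)
  unfold timeCut
  rw [min_eq_left (by linarith), max_eq_right zero_le_one]

theorem exp_mul_timeCut_le (l T t : ℝ) :
    Real.exp (l * (t - T)) * timeCut l T t ≤ Real.exp 1 := by
  rcases le_total (l * (t - T)) 1 with h | h
  · calc _ ≤ Real.exp 1 * 1 :=
          mul_le_mul (Real.exp_le_exp.2 h) (timeCut_le_one _ _ _) (timeCut_nonneg _ _ _)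
            (Real.exp_pos _).le
      _ = _ := mul_one _
  · have : timeCut l T t = 0 := by
      unfold timeCut
      rw [min_eq_right (by linarith), max_eq_left (by linarith)]
    rw [this, mul_zero]
    exact (Real.exp_pos _).le

/-- Solvability of the semilinear equation for all times, with small values at time `T`. -/
theorem Coef.exists_eternal (C : Coef N) {G : Euc N × ℝ → ℝ → Euc N → ℝ} {A₀ L L' δ : ℝ} (T : ℝ)
    (hG : Continuous fun p : (Euc N × ℝ) × ℝ × Euc N => G p.1 p.2.1 p.2.2)
    (hG0 : ∀ q, |G q 0 0| ≤ A₀)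
    (hGL : ∀ q u u' p p', |G q u p - G q u' p'| ≤ L * (|u - u'| + ‖p - p'‖))
    (hGh : ∀ x x' t u p, |G (x, t) u p - G (x', t) u p| ≤ L' * (1 + |u| + ‖p‖) * √‖x - x'‖)
    (hL : 0 ≤ L) (hL' : 0 ≤ L') (hδ : 0 < δ) :
    ∃ v : Jet N, (∀ q, v.At q) ∧ (∀ q, q.2 ≤ T → C.op v q = -G q (v.val q) (v.D q)) ∧
      Continuous v.val ∧ Continuous v.D ∧ (∀ x, |v.val (x, T)| ≤ δ) ∧
      ∀ s, (∃ K, ∀ q ∈ {q : Euc N × ℝ | s ≤ q.2}, |v.val q| ≤ K) ∧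
        Hol {q | s ≤ q.2} v.val ∧ Hol {q | s ≤ q.2} v.D := by
  have hA₀ : 0 ≤ A₀ := (abs_nonneg _).trans (hG0 0)
  have hc1 := C.c1_nonneg
  set m := 1 + 2 * C.c1 * (1 + 2 * L) with hm
  have hm1 : 1 ≤ m := by
    have : 0 ≤ 2 * C.c1 * (1 + 2 * L) := by positivity
    linarith
  obtain ⟨l, hl⟩ : ∃ l, l = m ^ 2 + 2 * (Real.exp 1 * A₀) * C.c1 / δ := ⟨_, rfl⟩
  have hr : 0 ≤ 2 * (Real.exp 1 * A₀) * C.c1 / δ := by positivity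
  have hl1 : 1 ≤ l := by nlinarith
  have hl0 : 0 < l := by linarith
  have hl2 : 2 * C.c1 * (1 + 2 * L) ≤ √l := by
    refine le_trans ?_ (Real.sqrt_le_sqrt (show m ^ 2 ≤ l by linarith))
    rw [Real.sqrt_sq (by linarith)]
    linarith
  have hl3 : 2 * (Real.exp 1 * A₀) * C.c1 * (1 / l) ≤ δ := by
    rw [mul_one_div, div_le_iff₀ hl0, ← div_le_iff₀' hδ]
    nlinarith
  let e : ℝ → ℝ := fun t => Real.exp (-l * (t - T))
  let E : ℝ → ℝ := fun t => Real.exp (l * (t - T)) * timeCut l T t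
  have he : ∀ t, 0 < e t := fun t => Real.exp_pos _
  have hE : ∀ t, 0 ≤ E t := fun t => mul_nonneg (Real.exp_pos _).le (timeCut_nonneg _ _ _)
  have hE1 : ∀ t, E t ≤ Real.exp 1 := fun t => exp_mul_timeCut_le l T t
  have hEe : ∀ t, E t * e t = timeCut l T t := by
    intro t
    simp only [E, e]
    rw [mul_right_comm, ← Real.exp_add]
    simp
  have hEe1 : ∀ t, E t * e t ≤ 1 := fun t => (hEe t).trans_le (timeCut_le_one _ _ _)
  have ce : Continuous e := by
    simp only [e]
    fun_prop
  have cE : Continuous E := by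
    have := continuous_timeCut l T
    simp only [E]
    fun_prop
  let F : Euc N × ℝ → ℝ → Euc N → ℝ := fun q u p => E q.2 * G q (e q.2 * u) (e q.2 • p)
  have hF : Continuous fun p : (Euc N × ℝ) × ℝ × Euc N => F p.1 p.2.1 p.2.2 := by
    have h1 : Continuous fun p : (Euc N × ℝ) × ℝ × Euc N =>
        (p.1, e p.1.2 * p.2.1, e p.1.2 • p.2.2) := by fun_prop
    have h2 : Continuous fun p : (Euc N × ℝ) × ℝ × Euc N =>
        G p.1 (e p.1.2 * p.2.1) (e p.1.2 • p.2.2) := hG.comp h1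
    have h3 : Continuous fun p : (Euc N × ℝ) × ℝ × Euc N => E p.1.2 := by fun_prop
    exact h3.mul h2
  have hF0 : ∀ q, |F q 0 0| ≤ Real.exp 1 * A₀ := by
    intro q
    simp only [F, mul_zero, smul_zero, abs_mul, abs_of_nonneg (hE _)]
    exact mul_le_mul (hE1 _) (hG0 q) (abs_nonneg _) (Real.exp_pos _).le
  have hFL : ∀ q u u' p p', |F q u p - F q u' p'| ≤ L * (|u - u'| + ‖p - p'‖) := by
    intro q u u' p p'
    simp only [F]
    rw [← mul_sub, abs_mul, abs_of_nonneg (hE _)]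
    have h1 := hGL q (e q.2 * u) (e q.2 * u') (e q.2 • p) (e q.2 • p')
    rw [← mul_sub, ← smul_sub, abs_mul, norm_smul, Real.norm_eq_abs, abs_of_pos (he _)] at h1
    calc _ ≤ E q.2 * (L * (e q.2 * |u - u'| + e q.2 * ‖p - p'‖)) := by gcongr; exact hE _
      _ = (E q.2 * e q.2) * (L * (|u - u'| + ‖p - p'‖)) := by ring
      _ ≤ 1 * (L * (|u - u'| + ‖p - p'‖)) := by gcongr; exact hEe1 _
      _ = _ := one_mul _
  have hFh : ∀ x x' t u p, |F (x, t) u p - F (x', t) u p| ≤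
      (L' * Real.exp 1) * (1 + |u| + ‖p‖) * √‖x - x'‖ := by
    intro x x' t u p
    simp only [F]
    rw [← mul_sub, abs_mul, abs_of_nonneg (hE _)]
    have h1 := hGh x x' t (e t * u) (e t • p)
    rw [abs_mul, norm_smul, Real.norm_eq_abs, abs_of_pos (he _)] at h1
    have h3 : (1 : ℝ) ≤ Real.exp 1 := Real.one_le_exp zero_le_one
    calc _ ≤ E t * (L' * (1 + e t * |u| + e t * ‖p‖) * √‖x - x'‖) := by gcongr; exact hE _
      _ = L' * (E t + E t * e t * |u| + E t * e t * ‖p‖) * √‖x - x'‖ := by ring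
      _ ≤ L' * (Real.exp 1 * 1 + Real.exp 1 * |u| + Real.exp 1 * ‖p‖) * √‖x - x'‖ := by
          have h4 := (hEe1 t).trans h3
          have h5 := hE1 t
          rw [mul_one]
          gcongr
      _ = _ := by ring
  obtain ⟨f, hf, hfb, hfe⟩ := C.exists_fixed hl1 hl2 hL hF hF0 hFL
  have hP := C.hol_Pot hl1 hf hfb
  have hDP := C.hol_DPot hl1 hf hfb
  have hfh : Hol univ f := ((C.hol_KPot hl1 hf hfb).add
    (Hol.nonlinear (fun q _ => hF0 q) (fun x x' t u p _ _ => hFh x x' t u p)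
      (fun q _ => hFL q) hP hDP)).congr fun q _ => hfe q
  have cP := C.continuous_Pot hl0 hf hfb
  have cDP := C.continuous_DPot hl0 hf hfb
  have hD : ∀ q, ((expJet N l T).mul (C.potJet l f)).D q = e q.2 • C.DPot l f q := by
    intro q
    simp [Jet.mul, expJet, Coef.potJet, e]
  have hHe : ∀ s, Hol {q : Euc N × ℝ | s ≤ q.2} fun q => e q.2 := by
    intro s
    refine Hol.of_lip (K₁ := Real.exp (-l * (s - T))) (K₂ := 0) (fun q hq => ?_) (by simp)
    rw [Real.norm_eq_abs, abs_of_pos (he _)]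
    have hq' : s ≤ q.2 := hq
    refine Real.exp_le_exp.2 ?_
    nlinarith
  have hHv : ∀ s, Hol {q : Euc N × ℝ | s ≤ q.2} ((expJet N l T).mul (C.potJet l f)).val :=
    fun s => Hol.bilin (ContinuousLinearMap.mul ℝ ℝ) (hHe s) (hP.mono (subset_univ _))
  refine ⟨(expJet N l T).mul (C.potJet l f),
    fun q => (expJet_at l T q).mul (C.potJet_at hl0 hf hfh q), fun q hq => ?_, ?_, ?_, fun x => ?_,
    fun s => ⟨?_, hHv s, ?_⟩⟩
  · rw [C.op_mul, hD, C.op_potJet, hfe q]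
    have h1 : C.op (expJet N l T) q = -l * e q.2 := by simp [Coef.op, expJet, e]
    have h2 : (expJet N l T).val q = e q.2 := rfl
    have h3 : (C.potJet l f).val q = C.Pot l f q := rfl
    have h4 : ((expJet N l T).mul (C.potJet l f)).val q = e q.2 * C.Pot l f q := rfl
    have h5 : C.tr q (symTensor N ((expJet N l T).D q) ((C.potJet l f).D q)) = 0 := by
      rw [show (expJet N l T).D q = 0 from rfl, map_zero]
      simp
    have h6 : e q.2 * E q.2 = 1 := by
      rw [mul_comm, hEe, timeCut_eq_one hl0.le hq]
    rw [h1, h2, h3, h4, h5]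
    simp only [F]
    linear_combination (-G q (e q.2 * C.Pot l f q) (e q.2 • C.DPot l f q)) * h6
  · exact (ce.comp continuous_snd).mul cP
  · have : ((expJet N l T).mul (C.potJet l f)).D = fun q => e q.2 • C.DPot l f q := funext hD
    rw [this]
    exact (ce.comp continuous_snd).smul cDP
  · have h1 : ((expJet N l T).mul (C.potJet l f)).val (x, T) = C.Pot l f (x, T) := by
      simp [Jet.mul, expJet, Coef.potJet]
    rw [h1]
    exact (C.abs_Pot_le hl0 hf hfb _).trans hl3
  · obtain ⟨K, hK, -⟩ := hHv s
    exact ⟨K, hK⟩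
  · exact (Hol.bilin (ContinuousLinearMap.lsmul ℝ ℝ) (hHe s) (hDP.mono (subset_univ _))).congr
      fun q _ => hD q

end Nonlinear

/-! ### Comparison with exponentially growing supersolutions -/

section Comparison

variable {N : ℕ} {C : Coef N}

theorem Coef.comparison {w z : Jet N} {B T ρ c τ : ℝ} {g : Euc N × ℝ → ℝ}
    (hw : ∀ q, w.At q) (cw : Continuous w.val) (hw0 : ∀ q, 0 < w.val q)
    (hwop : ∀ q : Euc N × ℝ, τ ≤ q.2 → q.2 ≤ T →
      C.op w q + B * (1 + ‖q.1‖) * (‖w.D q‖ + w.val q) + g q < 0)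
    (hg : ∀ q, 0 ≤ g q) (hz : ∀ q, z.At q) (cz : Continuous z.val) (hc : 0 ≤ c)
    (hzop : ∀ q : Euc N × ℝ, ‖q.1‖ < ρ → τ ≤ q.2 → q.2 ≤ T → 0 < z.val q →
      0 ≤ C.op z q + B * (1 + ‖q.1‖) * (‖z.D q‖ + z.val q) + c * g q)
    (hlat : ∀ q : Euc N × ℝ, ‖q.1‖ = ρ → τ ≤ q.2 → q.2 ≤ T → z.val q ≤ c * w.val q)
    (hter : ∀ x, ‖x‖ ≤ ρ → z.val (x, T) ≤ c * w.val (x, T))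
    (q : Euc N × ℝ) (h1 : ‖q.1‖ ≤ ρ) (h2 : τ ≤ q.2) (h3 : q.2 ≤ T) :
    z.val q ≤ c * w.val q := by
  by_contra! hcon
  have hcomp : IsCompact (Metric.closedBall (0 : Euc N) ρ ×ˢ Icc τ T) :=
    (isCompact_closedBall _ _).prod isCompact_Icc
  have hcont : Continuous fun q => z.val q / w.val q := cz.div cw fun q => (hw0 q).ne'
  obtain ⟨p, ⟨hp1, hp2⟩, hmax⟩ := hcomp.exists_isMaxOn
    ⟨q, by simpa using h1, h2, h3⟩ hcont.continuousOn
  rw [mem_closedBall_zero_iff] at hp1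
  set κ := z.val p / w.val p with hκ
  have hle : ∀ y ∈ Metric.closedBall (0 : Euc N) ρ ×ˢ Icc τ T, z.val y ≤ κ * w.val y :=
    fun y hy => (div_le_iff₀ (hw0 y)).1 (hmax hy)
  have hpe : z.val p = κ * w.val p := (div_mul_cancel₀ _ (hw0 p).ne').symm
  have hκc : c < κ := by
    have h4 := hle q ⟨by simpa using h1, h2, h3⟩
    exact lt_of_mul_lt_mul_right (hcon.trans_le h4) (hw0 q).le
  have hlt : c * w.val p < z.val p := by
    rw [hpe]
    exact mul_lt_mul_of_pos_right hκc (hw0 p)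
  have hpρ : ‖p.1‖ < ρ :=
    hp1.lt_of_ne fun h => (hlat p h hp2.1 hp2.2).not_gt hlt
  have hpT : p.2 < T := hp2.2.lt_of_ne fun h => by
    have := hter p.1 hp1
    rw [← h] at this
    exact this.not_gt hlt
  have hy : ∀ q, (z.addSmul (-κ) w).At q := fun q => (hz q).addSmul _ (hw q)
  have hy0 : (z.addSmul (-κ) w).val p = 0 := by
    simp only [Jet.addSmul]
    rw [hpe]
    ring
  have hyle : ∀ y ∈ Metric.closedBall (0 : Euc N) ρ ×ˢ Icc τ T, (z.addSmul (-κ) w).val y ≤ 0 := by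
    intro y hy
    have := hle y hy
    simp only [Jet.addSmul]
    linarith
  have hm : IsLocalMax (fun y => (z.addSmul (-κ) w).val (y, p.2)) p.1 := by
    have : Metric.ball (0 : Euc N) ρ ∈ 𝓝 p.1 :=
      Metric.isOpen_ball.mem_nhds (by simpa using hpρ)
    filter_upwards [this] with y hyb
    exact (hyle (y, p.2) ⟨Metric.ball_subset_closedBall hyb, hp2⟩).trans_eq hy0.symm
  have hm' : ∀ᶠ s in 𝓝[>] p.2, (z.addSmul (-κ) w).val (p.1, s) ≤ (z.addSmul (-κ) w).val p := by
    filter_upwards [Ioo_mem_nhdsGT hpT] with s hs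
    exact (hyle (p.1, s) ⟨by simpa using hp1, hp2.1.trans hs.1.le, hs.2.le⟩).trans_eq hy0.symm
  have hop := C.op_nonpos_of_max (hy p) (Eventually.of_forall fun y => hy _) hm hm'
  rw [C.op_addSmul] at hop
  have hD := Jet.D_eq_zero_of_max (hy p) hm
  have hD' : z.D p = κ • w.D p := by
    have : z.D p + (-κ) • w.D p = 0 := hD
    rw [neg_smul, ← sub_eq_add_neg] at this
    exact sub_eq_zero.1 this
  have hκ0 : 0 < κ := hc.trans_lt hκc
  have e1 := hzop p hpρ hp2.1 hp2.2 (by rw [hpe]; exact mul_pos hκ0 (hw0 p))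
  rw [hD', hpe, norm_smul, Real.norm_eq_abs, abs_of_pos hκ0] at e1
  have e2 := mul_neg_of_pos_of_neg hκ0 (hwop p hp2.1 hp2.2)
  have e3 := mul_le_mul_of_nonneg_right hκc.le (hg p)
  linarith

/-- The regularized norm `√(1 + ‖x‖²)`. -/
def jap (x : Euc N) : ℝ := √(1 + ‖x‖ ^ 2)

theorem one_le_jap (x : Euc N) : 1 ≤ jap x := by
  unfold jap
  rw [Real.one_le_sqrt]
  nlinarith [sq_nonneg ‖x‖]

theorem norm_le_jap (x : Euc N) : ‖x‖ ≤ jap x :=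
  Real.le_sqrt_of_sq_le (by linarith)

theorem continuous_jap : Continuous (jap : Euc N → ℝ) := by
  unfold jap
  fun_prop

theorem hasFDerivAt_jap (x : Euc N) : HasFDerivAt jap (innerSL ℝ ((jap x)⁻¹ • x)) x := by
  have h1 : HasFDerivAt (fun y : Euc N => 1 + ‖y‖ ^ 2) ((2 : ℝ) • innerSL ℝ x) x := by
    have := ((hasFDerivAt_id (𝕜 := ℝ) x).norm_sq).const_add 1
    refine this.congr_fderiv ?_
    ext v
    simp
  have h2 := h1.sqrt (by positivity)
  refine h2.congr_fderiv ?_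
  ext v
  simp only [ContinuousLinearMap.smul_apply, innerSL_apply_apply, smul_eq_mul, inner_smul_left, jap]
  simp
  ring

/-- The jet of `exp (μ (T - t) + κ exp (b (T - t)) √(1 + ‖x‖²))`. -/
def superJet (N : ℕ) (κ b μ T : ℝ) : Jet N where
  val q := Real.exp (μ * (T - q.2) + κ * Real.exp (b * (T - q.2)) * jap q.1)
  D q := (Real.exp (μ * (T - q.2) + κ * Real.exp (b * (T - q.2)) * jap q.1) *
    (κ * Real.exp (b * (T - q.2))) * (jap q.1)⁻¹) • q.1
  H q := (Real.exp (μ * (T - q.2) + κ * Real.exp (b * (T - q.2)) * jap q.1) *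
      (κ * Real.exp (b * (T - q.2))) * (jap q.1)⁻¹) • ContinuousLinearMap.id ℝ (Euc N) +
    (innerSL ℝ ((Real.exp (μ * (T - q.2) + κ * Real.exp (b * (T - q.2)) * jap q.1) *
      ((κ * Real.exp (b * (T - q.2))) ^ 2 * (jap q.1)⁻¹ ^ 2 -
        (κ * Real.exp (b * (T - q.2))) * (jap q.1)⁻¹ ^ 3)) • q.1)).smulRight q.1
  dt q := Real.exp (μ * (T - q.2) + κ * Real.exp (b * (T - q.2)) * jap q.1) *
    (-μ - b * (κ * Real.exp (b * (T - q.2))) * jap q.1)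

variable {κ b μ T : ℝ}

theorem superJet_at (q) : (superJet N κ b μ T).At q := by
  have hv : HasFDerivAt (fun y => (superJet N κ b μ T).val (y, q.2))
      (innerSL ℝ ((superJet N κ b μ T).D q)) q.1 := by
    have h1 := (((hasFDerivAt_jap q.1).const_mul (κ * Real.exp (b * (T - q.2)))).const_add
      (μ * (T - q.2))).exp
    refine h1.congr_fderiv ?_
    ext v
    simp [superJet, inner_smul_left]
    ring
  refine ⟨hv, ?_, ?_⟩
  · have h0 : jap q.1 ≠ 0 := (zero_lt_one.trans_le (one_le_jap q.1)).ne'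
    have h1 := (hasDerivAt_inv h0).comp_hasFDerivAt q.1 (hasFDerivAt_jap q.1)
    have h2 := (hv.mul_const (κ * Real.exp (b * (T - q.2)))).fun_mul h1
    have h3 := h2.fun_smul (hasFDerivAt_id (𝕜 := ℝ) q.1)
    refine h3.congr_fderiv ?_
    ext1 v
    simp only [superJet, _root_.add_apply, ContinuousLinearMap.smul_apply, Function.comp_apply,
      ContinuousLinearMap.smulRight_apply, ContinuousLinearMap.id_apply, innerSL_apply_apply,
      smul_eq_mul, id_eq, inner_smul_left, conj_trivial]
    congr 2
    field_simp
    ring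
  · have h1 : HasDerivAt (fun s : ℝ => T - s) (-1) q.2 := (hasDerivAt_id q.2).const_sub T
    have h2 := ((h1.const_mul μ).fun_add
      ((((h1.const_mul b).exp).const_mul κ).mul_const (jap q.1))).exp
    refine HasDerivAt.congr_deriv h2 ?_
    simp only [superJet]
    ring

theorem superJet_pos (q) : 0 < (superJet N κ b μ T).val q := Real.exp_pos _

theorem continuous_superJet : Continuous (superJet N κ b μ T).val := by
  have := continuous_jap (N := N)
  unfold superJet
  fun_prop

theorem norm_superJet_D_le (hκ : 0 ≤ κ) (q : Euc N × ℝ) : ‖(superJet N κ b μ T).D q‖ ≤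
    (superJet N κ b μ T).val q * (κ * Real.exp (b * (T - q.2))) := by
  have h1 := one_le_jap q.1
  have h2 : (jap q.1)⁻¹ * ‖q.1‖ ≤ 1 := by
    rw [inv_mul_le_iff₀ (by linarith), mul_one]
    exact norm_le_jap q.1
  simp only [superJet, norm_smul, Real.norm_eq_abs]
  rw [abs_of_nonneg (by positivity), mul_assoc]
  exact mul_le_of_le_one_right (by positivity) h2

theorem norm_superJet_H_le (hκ : 0 ≤ κ) (q : Euc N × ℝ) : ‖(superJet N κ b μ T).H q‖ ≤
    (superJet N κ b μ T).val q * ((κ * Real.exp (b * (T - q.2))) ^ 2 +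
      2 * (κ * Real.exp (b * (T - q.2)))) := by
  have h1 := one_le_jap q.1
  have h2 : (jap q.1)⁻¹ * ‖q.1‖ ≤ 1 := by
    rw [inv_mul_le_iff₀ (by linarith), mul_one]
    exact norm_le_jap q.1
  have h4 : (jap q.1)⁻¹ ≤ 1 := inv_le_one_of_one_le₀ h1
  have h5 : 0 ≤ (jap q.1)⁻¹ := by positivity
  simp only [superJet]
  set E := Real.exp (μ * (T - q.2) + κ * Real.exp (b * (T - q.2)) * jap q.1)
  set k := κ * Real.exp (b * (T - q.2))
  set j := (jap q.1)⁻¹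
  have hk : 0 ≤ k := by positivity
  have hE : 0 < E := Real.exp_pos _
  refine (norm_add_le _ _).trans ?_
  rw [norm_smul, ContinuousLinearMap.norm_smulRight_apply, innerSL_apply_norm, norm_smul,
    Real.norm_eq_abs, Real.norm_eq_abs, abs_of_nonneg (by positivity : 0 ≤ E * k * j), abs_mul,
    abs_of_pos hE]
  have h6 : |k ^ 2 * j ^ 2 - k * j ^ 3| ≤ k ^ 2 * j ^ 2 + k * j ^ 2 := by
    refine (abs_sub _ _).trans ?_
    rw [abs_of_nonneg (by positivity), abs_of_nonneg (by positivity)]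
    have : j ^ 3 ≤ j ^ 2 := pow_le_pow_of_le_one h5 h4 (by norm_num)
    gcongr
  have h7 : j ^ 2 * ‖q.1‖ ^ 2 ≤ 1 := by
    rw [← mul_pow]
    exact pow_le_one₀ (by positivity) h2
  have h8 : E * k * j * ‖ContinuousLinearMap.id ℝ (Euc N)‖ ≤ E * k * 1 * 1 := by
    refine mul_le_mul ?_ ContinuousLinearMap.norm_id_le (norm_nonneg _) (by positivity)
    gcongr
  calc _ ≤ E * k * 1 * 1 + E * (k ^ 2 * j ^ 2 + k * j ^ 2) * ‖q.1‖ * ‖q.1‖ := by gcongr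
    _ = E * k + E * ((k ^ 2 + k) * (j ^ 2 * ‖q.1‖ ^ 2)) := by ring
    _ ≤ E * k + E * ((k ^ 2 + k) * 1) := by gcongr
    _ = _ := by ring

/-- The exponential barrier is a strict supersolution for all large `μ`. -/
theorem exists_superJet {A B Λ₀ : ℝ} (N : ℕ) (T τ : ℝ) (hA : 0 ≤ A) (hB : 0 < B) (hΛ : 0 ≤ Λ₀)
    (hκ : 1 ≤ κ) (hκA : A ≤ κ) : ∃ μ₀, 0 ≤ μ₀ ∧ ∀ μ, μ₀ ≤ μ → ∀ (C : Coef N),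
    (∀ q, ‖C.tr q‖ ≤ Λ₀) → ∀ q : Euc N × ℝ, τ ≤ q.2 → q.2 ≤ T →
      C.op (superJet N κ (4 * B) μ T) q + B * (1 + ‖q.1‖) *
        (‖(superJet N κ (4 * B) μ T).D q‖ + (superJet N κ (4 * B) μ T).val q) +
        B * Real.exp (A * ‖q.1‖) < 0 := by
  obtain ⟨k₁, hk₁⟩ : ∃ k, k = κ * Real.exp (4 * B * (T - τ)) := ⟨_, rfl⟩
  have hk₁0 : 0 ≤ k₁ := by
    rw [hk₁]
    positivity
  refine ⟨Λ₀ * (k₁ ^ 2 + 2 * k₁) + B + 1, by positivity, fun μ hμ C hC q hτ hT => ?_⟩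
  have hκ0 : 0 ≤ κ := by linarith
  have hD := norm_superJet_D_le (b := 4 * B) (μ := μ) (T := T) hκ0 q
  have hH := norm_superJet_H_le (b := 4 * B) (μ := μ) (T := T) hκ0 q
  have hv := superJet_pos (κ := κ) (b := 4 * B) (μ := μ) (T := T) q
  obtain ⟨k, hk⟩ : ∃ k, k = κ * Real.exp (4 * B * (T - q.2)) := ⟨_, rfl⟩
  have hdt : (superJet N κ (4 * B) μ T).dt q = (superJet N κ (4 * B) μ T).val q *
      (-μ - 4 * B * k * jap q.1) := by rw [hk]; rfl
  have hval : (superJet N κ (4 * B) μ T).val q = Real.exp (μ * (T - q.2) + k * jap q.1) := by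
    rw [hk]; rfl
  rw [← hk] at hD hH
  have he1 : 1 ≤ Real.exp (4 * B * (T - q.2)) :=
    Real.one_le_exp (mul_nonneg (by linarith) (by linarith))
  have hk1 : κ ≤ k := by
    rw [hk]
    exact le_mul_of_one_le_right hκ0 he1
  have hkk : k ≤ k₁ := by
    rw [hk, hk₁]
    gcongr
  have hj1 := one_le_jap q.1
  have hj := norm_le_jap q.1
  have hk0 : 0 ≤ k := by linarith
  set W := (superJet N κ (4 * B) μ T).val q with hW
  have hge : Real.exp (A * ‖q.1‖) ≤ W := by
    rw [hval]
    refine Real.exp_le_exp.2 ?_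
    have e1 : 0 ≤ μ * (T - q.2) := by
      have : 0 ≤ Λ₀ * (k₁ ^ 2 + 2 * k₁) := by positivity
      exact mul_nonneg (by linarith) (by linarith)
    have e2 : A * ‖q.1‖ ≤ k * jap q.1 := by
      refine mul_le_mul (hκA.trans hk1) hj (norm_nonneg _) hk0
    linarith
  have htr : C.tr q ((superJet N κ (4 * B) μ T).H q) ≤ Λ₀ * (W * (k₁ ^ 2 + 2 * k₁)) := by
    refine (le_abs_self _).trans (((C.tr q).le_of_opNorm_le (hC q) _).trans ?_)
    refine mul_le_mul_of_nonneg_left (hH.trans ?_) hΛ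
    gcongr
  have hBt : B * (1 + ‖q.1‖) * (‖(superJet N κ (4 * B) μ T).D q‖ + W) ≤
      W * (4 * B * k * jap q.1) := by
    have e1 : 1 + ‖q.1‖ ≤ 2 * jap q.1 := by linarith
    have e2 : ‖(superJet N κ (4 * B) μ T).D q‖ + W ≤ W * (2 * k) := by
      have : W ≤ W * k := le_mul_of_one_le_right hv.le (by linarith)
      linarith
    calc _ ≤ B * (2 * jap q.1) * (W * (2 * k)) := by gcongr
      _ = _ := by ring
  have e5 : Λ₀ * (W * (k₁ ^ 2 + 2 * k₁)) = W * (Λ₀ * (k₁ ^ 2 + 2 * k₁)) := by ring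
  have e6 : 0 ≤ W * (Λ₀ * (k₁ ^ 2 + 2 * k₁)) := by positivity
  have e7 : W * (Λ₀ * (k₁ ^ 2 + 2 * k₁) + B + 1) ≤ W * μ := by gcongr
  have e8 : B * Real.exp (A * ‖q.1‖) ≤ B * W := by gcongr
  unfold Coef.op
  rw [hdt]
  linarith

end Comparison

/-! ### Local Hamiltonians and approximation -/

section Approx

variable {N : ℕ}

/-- The radial retraction onto the closed ball of radius `r`. -/
def radial (r : ℝ) (x : Euc N) : Euc N := (r / max r ‖x‖) • x

theorem continuous_radial {r : ℝ} (hr : 0 < r) : Continuous (radial r : Euc N → Euc N) := by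
  refine Continuous.smul (continuous_const.div (continuous_const.max continuous_norm)
    fun x => ?_) continuous_id
  exact (lt_of_lt_of_le hr (le_max_left _ _)).ne'

theorem radial_of_le {r : ℝ} (hr : 0 < r) {x : Euc N} (hx : ‖x‖ ≤ r) : radial r x = x := by
  rw [radial, max_eq_left hx, div_self hr.ne', one_smul]

theorem norm_radial_le {r : ℝ} (hr : 0 < r) (x : Euc N) : ‖radial r x‖ ≤ r := by
  have h := lt_of_lt_of_le hr (le_max_left r ‖x‖)
  rw [radial, norm_smul, Real.norm_of_nonneg (by positivity), div_mul_eq_mul_div, div_le_iff₀ h]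
  exact mul_le_mul_of_nonneg_left (le_max_right _ _) hr.le

theorem norm_radial_le_norm {r : ℝ} (hr : 0 < r) (x : Euc N) : ‖radial r x‖ ≤ ‖x‖ := by
  have h := lt_of_lt_of_le hr (le_max_left r ‖x‖)
  rw [radial, norm_smul, Real.norm_of_nonneg (by positivity)]
  refine mul_le_of_le_one_left (norm_nonneg _) ((div_le_one h).2 (le_max_left _ _))

theorem norm_radial_sub_le {r : ℝ} (hr : 0 < r) (x y : Euc N) :
    ‖radial r x - radial r y‖ ≤ 2 * ‖x - y‖ := by
  have hs := lt_of_lt_of_le hr (le_max_left r ‖x‖)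
  have ht := lt_of_lt_of_le hr (le_max_left r ‖y‖)
  have hst : |max r ‖y‖ - max r ‖x‖| ≤ ‖x - y‖ := by
    have h1 := abs_max_sub_max_le_abs ‖y‖ ‖x‖ r
    rw [max_comm ‖y‖, max_comm ‖x‖] at h1
    exact h1.trans ((abs_norm_sub_norm_le y x).trans_eq (norm_sub_rev _ _))
  have hyt : ‖y‖ ≤ max r ‖y‖ := le_max_right _ _
  have hrs : r ≤ max r ‖x‖ := le_max_left _ _
  unfold radial
  generalize max r ‖x‖ = s at *
  generalize max r ‖y‖ = t at *
  have e : (r / s) • x - (r / t) • y = (r / s) • (x - y) + (r / s - r / t) • y := by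
    rw [smul_sub, sub_smul]
    abel
  rw [e]
  refine (norm_add_le _ _).trans ?_
  rw [norm_smul, norm_smul, Real.norm_of_nonneg (by positivity : 0 ≤ r / s), Real.norm_eq_abs]
  have h1 : r / s * ‖x - y‖ ≤ ‖x - y‖ :=
    mul_le_of_le_one_left (norm_nonneg _) ((div_le_one hs).2 hrs)
  have h2 : |r / s - r / t| * ‖y‖ ≤ ‖x - y‖ := by
    have e2 : r / s - r / t = (r / s) * ((t - s) / t) := by
      field_simp
    rw [e2, abs_mul, abs_of_nonneg (by positivity : 0 ≤ r / s), abs_div, abs_of_pos ht, mul_assoc,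
      div_mul_eq_mul_div |t - s|]
    refine (mul_le_of_le_one_left (by positivity) ((div_le_one hs).2 hrs)).trans ?_
    rw [div_le_iff₀ ht]
    exact mul_le_mul hst hyt (norm_nonneg _) (norm_nonneg _)
  linarith

theorem norm_radial_sub_le_sqrt {r : ℝ} (hr : 0 < r) (x y : Euc N) :
    ‖radial r x - radial r y‖ ≤ 2 * √r * √‖x - y‖ := by
  have h1 := norm_radial_sub_le hr x y
  have h2 : ‖radial r x - radial r y‖ ≤ 2 * r :=
    (norm_sub_le _ _).trans (by linarith [norm_radial_le hr x, norm_radial_le hr y])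
  have h3 : ‖radial r x - radial r y‖ ^ 2 ≤ (2 * √r * √‖x - y‖) ^ 2 := by
    rw [mul_pow, mul_pow, Real.sq_sqrt hr.le, Real.sq_sqrt (norm_nonneg _)]
    nlinarith [mul_le_mul h1 h2 (norm_nonneg _) (by positivity)]
  exact le_of_sq_le_sq h3 (by positivity)

/-- Structural conditions on a Hamiltonian: local regularity, exponential growth and a one-sided
linear growth condition. -/
structure IsHam (A B : ℝ) (H : Euc N × ℝ → ℝ → Euc N → ℝ) : Prop where
  cont : Continuous fun p : (Euc N × ℝ) × ℝ × Euc N => H p.1 p.2.1 p.2.2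
  hol : ∀ r, ∃ L, 0 ≤ L ∧ ∀ x x' t u p, ‖x‖ ≤ r → ‖x'‖ ≤ r →
    |H (x, t) u p - H (x', t) u p| ≤ L * (1 + |u| + ‖p‖) * ‖x - x'‖
  lip : ∀ r, ∃ M, 0 ≤ M ∧ ∀ q : Euc N × ℝ, ‖q.1‖ ≤ r → ∀ u u' p p',
    |H q u p - H q u' p'| ≤ M * (|u - u'| + ‖p - p'‖)
  growth : ∀ q, |H q 0 0| ≤ B * Real.exp (A * ‖q.1‖)
  one_sided : ∀ q u u' p p', u' ≤ u →
    H q u p - H q u' p' ≤ B * (1 + ‖q.1‖) * (‖p - p'‖ + (u - u'))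

theorem euc_eq_sum (x : Euc N) : x = ∑ i, x i • EuclideanSpace.single i (1 : ℝ) := by
  ext j
  simp [Finset.sum_apply, Pi.single_apply]

/-- The linear map sending a functional to the vector representing it. -/
def rieszMap (N : ℕ) : (Euc N →L[ℝ] ℝ) →L[ℝ] Euc N :=
  ∑ i, (ContinuousLinearMap.apply ℝ ℝ (EuclideanSpace.single i (1 : ℝ))).smulRight
    (EuclideanSpace.single i (1 : ℝ))

theorem innerSL_rieszMap (l : Euc N →L[ℝ] ℝ) : innerSL ℝ (rieszMap N l) = l := by
  ext v
  conv_rhs => rw [euc_eq_sum v]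
  simp [rieszMap, sum_inner, inner_smul_left, EuclideanSpace.inner_single_left, mul_comm]

theorem Hol.of_contDiff_space {F : Type*} [NormedAddCommGroup F] [NormedSpace ℝ F]
    {φ : Euc N → F} (h : ContDiff ℝ 1 φ) (hc : HasCompactSupport φ) :
    Hol univ fun q : Euc N × ℝ => φ q.1 := by
  obtain ⟨K₁, hK₁⟩ := h.continuous.bounded_above_of_compact_support hc
  obtain ⟨K₂, hK₂⟩ := h.lipschitzWith_of_hasCompactSupport hc one_ne_zero
  exact Hol.of_lip (K₂ := K₂) (fun q _ => hK₁ q.1) fun x x' t _ _ => hK₂.norm_sub_le x x'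

/-- A smooth compactly supported function of the space variable, as a jet. -/
theorem exists_smooth_jet {g : Euc N → ℝ} (hg : ContDiff ℝ 3 g) (hc : HasCompactSupport g) :
    ∃ b : Jet N, (∀ q, b.val q = g q.1) ∧ (∀ q, b.At q) ∧ (∀ q, b.dt q = 0) ∧
      Continuous b.val ∧ Continuous b.D ∧ Continuous b.H ∧
      Hol univ b.val ∧ Hol univ b.D ∧ Hol univ b.H := by
  have h1 : ContDiff ℝ 2 fun x => rieszMap N (fderiv ℝ g x) :=
    (rieszMap N).contDiff.comp (hg.fderiv_right (by norm_num))
  have c1 : HasCompactSupport fun x => rieszMap N (fderiv ℝ g x) :=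
    (hc.fderiv ℝ).comp_left (map_zero _)
  have h2 : ContDiff ℝ 1 (fderiv ℝ fun x => rieszMap N (fderiv ℝ g x)) :=
    h1.fderiv_right (by norm_num)
  have c2 := c1.fderiv ℝ
  refine ⟨⟨fun q => g q.1, fun q => rieszMap N (fderiv ℝ g q.1),
    fun q => fderiv ℝ (fun x => rieszMap N (fderiv ℝ g x)) q.1, fun _ => 0⟩, fun _ => rfl,
    fun q => ⟨?_, ?_, hasDerivAt_const q.2 (g q.1)⟩, fun _ => rfl, hg.continuous.comp continuous_fst,
    h1.continuous.comp continuous_fst, h2.continuous.comp continuous_fst,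
    Hol.of_contDiff_space (hg.of_le (by norm_num)) hc,
    Hol.of_contDiff_space (h1.of_le (by norm_num)) c1, Hol.of_contDiff_space h2 c2⟩
  · show HasFDerivAt g (innerSL ℝ (rieszMap N (fderiv ℝ g q.1))) q.1
    rw [innerSL_rieszMap]
    exact (hg.differentiable (by norm_num) q.1).hasFDerivAt
  · exact (h1.differentiable (by norm_num) q.1).hasFDerivAt

/-- Smooth compactly supported approximation on a ball, with control outside. -/
theorem exists_smooth_approx {β : Euc N → ℝ} (hβ : Continuous β) {r ε : ℝ} (hr : 0 < r)
    (hε : 0 < ε) : ∃ g : Euc N → ℝ, ContDiff ℝ 3 g ∧ HasCompactSupport g ∧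
      (∀ x, ‖x‖ ≤ r → |g x - β x| ≤ ε) ∧ ∀ x, |g x| ≤ |β x| + ε := by
  let χ : ContDiffBump (0 : Euc N) := ⟨r, r + 1, hr, by linarith⟩
  have hu : UniformContinuous fun x => χ x * β x :=
    χ.hasCompactSupport.mul_right.uniformContinuous_of_continuous (χ.continuous.mul hβ)
  obtain ⟨g, hg, hgβ⟩ := hu.exists_contDiff_dist_le hε
  refine ⟨fun x => χ x * g x, (χ.contDiff.mul hg).of_le (WithTop.coe_le_coe.2 (le_top : (3 : ℕ∞) ≤ ⊤)),
    χ.hasCompactSupport.mul_right, fun x hx => ?_, fun x => ?_⟩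
  · have h1 := (hgβ x).le
    rw [Real.dist_eq] at h1
    have h2 : χ x = 1 := χ.one_of_mem_closedBall (by simpa [χ] using hx)
    simpa [h2] using h1
  · have h1 := (hgβ x).le
    rw [Real.dist_eq] at h1
    have h0 : |χ x| ≤ 1 := by rw [abs_of_nonneg χ.nonneg]; exact χ.le_one
    have h2 : |g x| ≤ |χ x * β x| + ε := by
      have := abs_sub_abs_le_abs_sub (g x) (χ x * β x)
      linarith
    rw [abs_mul] at h2 ⊢
    have h3 := mul_le_of_le_one_left (abs_nonneg (g x)) h0
    have h4 := mul_le_of_le_one_left (abs_nonneg (β x)) h0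
    linarith

/-- Solutions for a Hamiltonian with globally controlled regularity, with smooth terminal data
attained approximately. -/
theorem Coef.exists_approx (C : Coef N) {F : Euc N × ℝ → ℝ → Euc N → ℝ} {A₀ M L δ : ℝ} (T : ℝ)
    (hF : Continuous fun p : (Euc N × ℝ) × ℝ × Euc N => F p.1 p.2.1 p.2.2)
    (hF0 : ∀ q, |F q 0 0| ≤ A₀)
    (hFL : ∀ q u u' p p', |F q u p - F q u' p'| ≤ M * (|u - u'| + ‖p - p'‖))
    (hFh : ∀ x x' t u p, |F (x, t) u p - F (x', t) u p| ≤ L * (1 + |u| + ‖p‖) * √‖x - x'‖)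
    (hM : 0 ≤ M) (hL : 0 ≤ L) (hδ : 0 < δ) {b : Jet N} (hb : ∀ q, b.At q) (hbt : ∀ q, b.dt q = 0)
    (cb : Continuous b.val) (cbD : Continuous b.D) (cbH : Continuous b.H)
    (hbv : Hol univ b.val) (hbD : Hol univ b.D) (hbH : Hol univ b.H) :
    ∃ z : Jet N, (∀ q, z.At q) ∧ (∀ q, q.2 ≤ T → C.op z q = -F q (z.val q) (z.D q)) ∧
      Continuous z.val ∧ Continuous z.D ∧ (∀ x, |z.val (x, T) - b.val (x, T)| ≤ δ) ∧
      ∀ s, (∃ K, ∀ q ∈ {q : Euc N × ℝ | s ≤ q.2}, |z.val q| ≤ K) ∧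
        Hol {q | s ≤ q.2} z.val ∧ Hol {q | s ≤ q.2} z.D ∧
        Hol {q | s ≤ q.2} fun q => -F q (z.val q) (z.D q) := by
  have htr : Hol univ fun q => C.tr q (b.H q) :=
    Hol.bilin (ContinuousLinearMap.id ℝ ((Euc N →L[ℝ] Euc N) →L[ℝ] ℝ)) C.hol_tr hbH
  obtain ⟨K₁, hK₁, hv0, hv1⟩ := hbv.exists_nonneg
  obtain ⟨K₂, hK₂, hD0, hD1⟩ := hbD.exists_nonneg
  obtain ⟨K₃, hK₃, ht0, ht1⟩ := htr.exists_nonneg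
  simp only [mem_univ, true_implies, Real.norm_eq_abs] at hv0 hv1 hD0 hD1 ht0 ht1
  refine Exists.elim (C.exists_eternal
    (G := fun q u p => F q (b.val q + u) (b.D q + p) + 1 / 2 * C.tr q (b.H q))
    (A₀ := A₀ + M * (K₁ + K₂) + 1 / 2 * K₃) (L := M)
    (L' := L * (1 + K₁ + K₂) + M * (K₁ + K₂) + 1 / 2 * K₃) (δ := δ) T ?_ ?_ ?_ ?_ hM ?_ hδ) ?_
  · refine (Continuous.comp (g := fun p : (Euc N × ℝ) × ℝ × Euc N => F p.1 p.2.1 p.2.2)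
      (f := fun p : (Euc N × ℝ) × ℝ × Euc N => (p.1, b.val p.1 + p.2.1, b.D p.1 + p.2.2)) hF
      ?_).add ?_
    · exact continuous_fst.prodMk (((cb.comp continuous_fst).add
        (continuous_fst.comp continuous_snd)).prodMk ((cbD.comp continuous_fst).add
        (continuous_snd.comp continuous_snd)))
    · exact continuous_const.mul ((C.continuous_tr.comp continuous_fst).clm_apply
        (cbH.comp continuous_fst))
  · intro q
    have e1 := hFL q (b.val q + 0) 0 (b.D q + 0) 0
    have e2 := hF0 q
    have e3 := ht0 q
    have e4 := hv0 q
    have e5 := hD0 q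
    simp only [add_zero, sub_zero] at e1 ⊢
    have e6 : M * (|b.val q| + ‖b.D q‖) ≤ M * (K₁ + K₂) := by gcongr
    rw [abs_le] at *
    constructor <;> linarith
  · intro q u u' p p'
    have := hFL q (b.val q + u) (b.val q + u') (b.D q + p) (b.D q + p')
    simpa using this
  · intro x x' t u p
    have e1 := hFh x x' t (b.val (x, t) + u) (b.D (x, t) + p)
    have e2 := hFL (x', t) (b.val (x, t) + u) (b.val (x', t) + u) (b.D (x, t) + p)
      (b.D (x', t) + p)
    rw [add_sub_add_right_eq_sub, add_sub_add_right_eq_sub] at e2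
    have e3 := ht1 x x' t
    have e4 : M * (|b.val (x, t) - b.val (x', t)| + ‖b.D (x, t) - b.D (x', t)‖) ≤
        M * (K₁ * √‖x - x'‖ + K₂ * √‖x - x'‖) := by
      gcongr
      · exact hv1 x x' t
      · exact hD1 x x' t
    have e5 : L * (1 + |b.val (x, t) + u| + ‖b.D (x, t) + p‖) * √‖x - x'‖ ≤
        L * ((1 + K₁ + K₂) * (1 + |u| + ‖p‖)) * √‖x - x'‖ := by
      gcongr
      have f1 := (abs_add_le (b.val (x, t)) u).trans (add_le_add_left (hv0 (x, t)) _)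
      have f2 := (norm_add_le (b.D (x, t)) p).trans (add_le_add_left (hD0 (x, t)) _)
      have f3 : 0 ≤ (K₁ + K₂) * (|u| + ‖p‖) := by positivity
      nlinarith
    have e6 : (M * (K₁ + K₂) + 1 / 2 * K₃) * √‖x - x'‖ ≤
        (M * (K₁ + K₂) + 1 / 2 * K₃) * (1 + |u| + ‖p‖) * √‖x - x'‖ := by
      gcongr
      refine le_mul_of_one_le_right (by positivity) ?_
      linarith [abs_nonneg u, norm_nonneg p]
    have e7 : (L * (1 + K₁ + K₂) + M * (K₁ + K₂) + 1 / 2 * K₃) * (1 + |u| + ‖p‖) * √‖x - x'‖ =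
        L * ((1 + K₁ + K₂) * (1 + |u| + ‖p‖)) * √‖x - x'‖ +
        (M * (K₁ + K₂) + 1 / 2 * K₃) * (1 + |u| + ‖p‖) * √‖x - x'‖ := by ring
    rw [e7]
    simp only [abs_le] at *
    constructor <;> linarith
  · positivity
  rintro v ⟨hv, hvop, cv, cvD, hvT, hvs⟩
  refine ⟨b.addSmul 1 v, fun q => (hb q).addSmul 1 (hv q), fun q hq => ?_, ?_, ?_, fun x => ?_,
    fun s => ?_⟩
  · rw [Coef.op_addSmul, hvop q hq]
    simp only [Coef.op, hbt, Jet.addSmul, one_mul, one_smul]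
    ring
  · simpa only [Jet.addSmul, one_mul] using cb.fun_add cv
  · simpa only [Jet.addSmul, one_smul] using cbD.fun_add cvD
  · simpa [Jet.addSmul] using hvT x
  · obtain ⟨⟨K, hK⟩, h1, h2⟩ := hvs s
    have g1 : Hol {q | s ≤ q.2} (b.addSmul 1 v).val := by
      simpa only [Jet.addSmul, one_mul] using (hbv.mono (subset_univ _)).add h1
    have g2 : Hol {q | s ≤ q.2} (b.addSmul 1 v).D := by
      simpa only [Jet.addSmul, one_smul] using (hbD.mono (subset_univ _)).add h2
    obtain ⟨K', hK', -⟩ := g1.exists_nonneg.imp fun _ h => h.2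
    exact ⟨⟨K', hK'⟩, g1, g2, (Hol.nonlinear (fun q _ => hF0 q)
      (fun x x' t u p _ _ => hFh x x' t u p) (fun q _ => hFL q) g1 g2).neg⟩

/-- Truncating a Hamiltonian makes its regularity global. -/
theorem IsHam.trunc {A B : ℝ} {H : Euc N × ℝ → ℝ → Euc N → ℝ} (hH : IsHam A B H) (hA : 0 ≤ A)
    (hB : 0 ≤ B) {r : ℝ} (hr : 0 < r) :
    (Continuous fun p : (Euc N × ℝ) × ℝ × Euc N => H (radial r p.1.1, p.1.2) p.2.1 p.2.2) ∧
    (∃ M, 0 ≤ M ∧ ∀ (q : Euc N × ℝ) u u' p p',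
      |H (radial r q.1, q.2) u p - H (radial r q.1, q.2) u' p'| ≤ M * (|u - u'| + ‖p - p'‖)) ∧
    (∃ L, 0 ≤ L ∧ ∀ x x' (t : ℝ) u p, |H (radial r x, t) u p - H (radial r x', t) u p| ≤
      L * (1 + |u| + ‖p‖) * √‖x - x'‖) ∧
    (∀ q : Euc N × ℝ, |H (radial r q.1, q.2) 0 0| ≤ B * Real.exp (A * r)) ∧
    (∀ q : Euc N × ℝ, |H (radial r q.1, q.2) 0 0| ≤ B * Real.exp (A * ‖q.1‖)) ∧
    ∀ (q : Euc N × ℝ) u u' p p', u' ≤ u → H (radial r q.1, q.2) u p - H (radial r q.1, q.2) u' p' ≤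
      B * (1 + ‖q.1‖) * (‖p - p'‖ + (u - u')) := by
  obtain ⟨L, hL, hL'⟩ := hH.hol r
  obtain ⟨M, hM, hM'⟩ := hH.lip r
  refine ⟨?_, ⟨M, hM, fun q => hM' _ (norm_radial_le hr _)⟩,
    ⟨L * (2 * √r), by positivity, fun x x' t u p => ?_⟩, fun q => ?_, fun q => ?_,
    fun q u u' p p' h => ?_⟩
  · exact Continuous.comp (g := fun p : (Euc N × ℝ) × ℝ × Euc N => H p.1 p.2.1 p.2.2)
      (f := fun p : (Euc N × ℝ) × ℝ × Euc N => ((radial r p.1.1, p.1.2), p.2)) hH.cont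
      ((((continuous_radial hr).comp (continuous_fst.comp continuous_fst)).prodMk
        (continuous_snd.comp continuous_fst)).prodMk continuous_snd)
  · refine (hL' _ _ t u p (norm_radial_le hr x) (norm_radial_le hr x')).trans ?_
    have := mul_le_mul_of_nonneg_left (norm_radial_sub_le_sqrt hr x x')
      (by positivity : 0 ≤ L * (1 + |u| + ‖p‖))
    linarith
  · refine (hH.growth _).trans ?_
    gcongr
    exact norm_radial_le hr _
  · refine (hH.growth _).trans ?_
    gcongr
    exact norm_radial_le_norm hr _
  · refine (hH.one_sided _ u u' p p' h).trans ?_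
    have := norm_radial_le_norm hr q.1
    have : 0 ≤ u - u' := by linarith
    gcongr

end Approx

/-! ### Convergence of the approximations -/

section Convergence

variable {N : ℕ}

/-- Approximate solutions of the terminal value problem, for the Hamiltonian truncated at
radius `r`. -/
structure IsApprox (C : Coef N) (H : Euc N × ℝ → ℝ → Euc N → ℝ) (β : Euc N → ℝ) (A B T r : ℝ)
    (z : Jet N) : Prop where
  at' : ∀ q, z.At q
  op_eq : ∀ q, q.2 ≤ T → C.op z q = -H (radial r q.1, q.2) (z.val q) (z.D q)
  cval : Continuous z.val
  cD : Continuous z.D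
  ter_le : ∀ x, |z.val (x, T)| ≤ B * Real.exp (A * ‖x‖) + 2
  ter_near : ∀ x, ‖x‖ ≤ r → |z.val (x, T) - β x| ≤ 2 / r
  bdd : ∃ K, ∀ q : Euc N × ℝ, -1 ≤ q.2 → |z.val q| ≤ K
  hval : Hol {q | -1 ≤ q.2} z.val
  hD : Hol {q | -1 ≤ q.2} z.D
  hA : Hol {q | -1 ≤ q.2} fun q => -H (radial r q.1, q.2) (z.val q) (z.D q)

variable {A B T r : ℝ} {H : Euc N × ℝ → ℝ → Euc N → ℝ} {β : Euc N → ℝ} {C : Coef N}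

theorem exists_isApprox (hH : IsHam A B H) (hA : 0 ≤ A) (hB : 0 ≤ B) (hβ : Continuous β)
    (hβB : ∀ x, |β x| ≤ B * Real.exp (A * ‖x‖)) (C : Coef N) (T : ℝ) (hr : 1 ≤ r) :
    ∃ z, IsApprox C H β A B T r z := by
  have hr0 : 0 < r := by linarith
  have hr1 : 1 / r ≤ 1 := (div_le_one hr0).2 hr
  obtain ⟨hF, ⟨M, hM, hFL⟩, ⟨L, hL, hFh⟩, hF0, -, -⟩ := hH.trunc hA hB hr0
  obtain ⟨g, hg, hgc, hg1, hg2⟩ := exists_smooth_approx hβ hr0 (by positivity : 0 < 1 / r)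
  obtain ⟨b, hbg, hb, hbt, cb, cbD, cbH, hbv, hbD, hbH⟩ := exists_smooth_jet hg hgc
  obtain ⟨z, hz, hop, cz, czD, hzT, hzs⟩ := C.exists_approx
    (F := fun q u p => H (radial r q.1, q.2) u p) T hF hF0 hFL hFh hM hL
    (by positivity : 0 < 1 / r) hb hbt cb cbD cbH hbv hbD hbH
  simp only [hbg] at hzT
  obtain ⟨⟨K, hK⟩, h1, h2, h3⟩ := hzs (-1)
  refine ⟨z, hz, hop, cz, czD, fun x => ?_, fun x hx => ?_, ⟨K, fun q hq => hK q hq⟩, h1, h2, h3⟩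
  · have e1 := hzT x
    have e2 := hg2 x
    have e3 := hβB x
    have e4 := abs_sub_abs_le_abs_sub (z.val (x, T)) (g x)
    linarith
  · have e1 := hzT x
    have e2 := hg1 x hx
    have e3 := abs_sub_le (z.val (x, T)) (g x) (β x)
    have e4 : 2 / r = 1 / r + 1 / r := by ring
    linarith

theorem exp_le_superJet {κ b μ : ℝ} (hκ : 0 ≤ κ) (hb : 0 ≤ b) (hμ : 0 ≤ μ) {q : Euc N × ℝ}
    (hq : q.2 ≤ T) : Real.exp (κ * ‖q.1‖) ≤ (superJet N κ b μ T).val q := by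
  refine Real.exp_le_exp.2 ?_
  have h1 : 1 ≤ Real.exp (b * (T - q.2)) := Real.one_le_exp (mul_nonneg hb (by linarith))
  have h2 := norm_le_jap q.1
  have h3 : 0 ≤ μ * (T - q.2) := mul_nonneg hμ (by linarith)
  have h4 : κ * 1 * ‖q.1‖ ≤ κ * Real.exp (b * (T - q.2)) * jap q.1 := by gcongr
  linarith

theorem one_le_superJet {κ b μ : ℝ} (hκ : 0 ≤ κ) (hb : 0 ≤ b) (hμ : 0 ≤ μ) {q : Euc N × ℝ}
    (hq : q.2 ≤ T) : 1 ≤ (superJet N κ b μ T).val q :=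
  (Real.one_le_exp (by positivity)).trans (exp_le_superJet hκ hb hμ hq)

theorem superJet_mul_exp_le {κ b μ : ℝ} (hκ : 1 ≤ κ) (hb : 0 ≤ b) {q : Euc N × ℝ}
    (hq : q.2 ≤ T) : (superJet N κ b μ T).val q ≤
      Real.exp (-‖q.1‖) * (superJet N (2 * κ) b μ T).val q := by
  simp only [superJet]
  rw [← Real.exp_add]
  refine Real.exp_le_exp.2 ?_
  have h1 : 1 ≤ Real.exp (b * (T - q.2)) := Real.one_le_exp (mul_nonneg hb (by linarith))
  have h2 := norm_le_jap q.1
  have h4 : 1 * 1 * ‖q.1‖ ≤ κ * Real.exp (b * (T - q.2)) * jap q.1 := by gcongr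
  linarith

theorem Jet.zero_at (q) : (⟨0, 0, 0, 0⟩ : Jet N).At q where
  hD := by simpa using hasFDerivAt_const (0 : ℝ) q.1
  hH := hasFDerivAt_const (0 : Euc N) q.1
  ht := hasDerivAt_const q.2 (0 : ℝ)

/-- The comparison function `superJet` is a strict supersolution. -/
def IsSuper (C : Coef N) (A B κ μ T : ℝ) : Prop :=
  ∀ q : Euc N × ℝ, -1 ≤ q.2 → q.2 ≤ T →
    C.op (superJet N κ (4 * B) μ T) q + B * (1 + ‖q.1‖) *
      (‖(superJet N κ (4 * B) μ T).D q‖ + (superJet N κ (4 * B) μ T).val q) +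
      B * Real.exp (A * ‖q.1‖) < 0

theorem IsApprox.abs_le {z : Jet N} (hz : IsApprox C H β A B T r z) (hH : IsHam A B H)
    (hA : 0 ≤ A) (hB : 0 < B) (hr : 0 < r) {κ μ : ℝ} (hκ : 1 ≤ κ) (hκA : A ≤ κ) (hμ : 0 ≤ μ)
    (hs : IsSuper C A B κ μ T) {q : Euc N × ℝ} (h1 : -1 ≤ q.2) (h2 : q.2 ≤ T) :
    |z.val q| ≤ (B + 2) * (superJet N κ (4 * B) μ T).val q := by
  obtain ⟨-, -, -, -, hg, hone⟩ := hH.trunc hA hB.le hr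
  obtain ⟨K, hK⟩ := hz.bdd
  have hκ0 : 0 ≤ κ := by linarith
  have hb : 0 ≤ 4 * B := by positivity
  have hlat : ∀ p : Euc N × ℝ, ‖p.1‖ = max ‖q.1‖ K → -1 ≤ p.2 → p.2 ≤ T →
      |z.val p| ≤ (B + 2) * (superJet N κ (4 * B) μ T).val p := by
    intro p hp h1 h2
    have e1 := exp_le_superJet hκ0 hb hμ h2
    have e2 : K ≤ ‖p.1‖ := hp ▸ le_max_right _ _
    have e3 : ‖p.1‖ ≤ κ * ‖p.1‖ := le_mul_of_one_le_left (norm_nonneg _) hκ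
    have e4 := Real.add_one_le_exp (κ * ‖p.1‖)
    have e5 := hK p h1
    have e6 := superJet_pos (κ := κ) (b := 4 * B) (μ := μ) (T := T) p
    nlinarith
  have hter : ∀ x, |z.val (x, T)| ≤ (B + 2) * (superJet N κ (4 * B) μ T).val (x, T) := by
    intro x
    have e1 := exp_le_superJet (N := N) hκ0 hb hμ (q := (x, T)) le_rfl
    have e2 := one_le_superJet (N := N) hκ0 hb hμ (q := (x, T)) le_rfl
    have e3 : Real.exp (A * ‖x‖) ≤ Real.exp (κ * ‖x‖) := by gcongr
    have e4 := hz.ter_le x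
    have e5 := mul_le_mul_of_nonneg_left (e3.trans e1) hB.le
    linarith
  have hgw : ∀ p : Euc N × ℝ, B * Real.exp (A * ‖p.1‖) ≤
      (B + 2) * (B * Real.exp (A * ‖p.1‖)) := fun p =>
    le_mul_of_one_le_left (by positivity) (by linarith)
  rw [abs_le']
  constructor
  · refine Coef.comparison (C := C) (B := B) (g := fun q => B * Real.exp (A * ‖q.1‖)) superJet_at
      continuous_superJet superJet_pos hs (fun q => by positivity) hz.at' hz.cval (by positivity)
      (ρ := max ‖q.1‖ K) (fun p _ h1 h2 h3 => ?_)
      (fun p hp h1 h2 => (le_abs_self _).trans (hlat p hp h1 h2))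
      (fun x _ => (le_abs_self _).trans (hter x)) q (le_max_left _ _) h1 h2
    rw [hz.op_eq p h2]
    have e1 := hone p (z.val p) 0 (z.D p) 0 h3.le
    have e2 := (le_abs_self _).trans (hg p)
    have e3 := hgw p
    simp only [sub_zero] at e1
    linarith
  · have key := Coef.comparison (C := C) (B := B) (z := (⟨0, 0, 0, 0⟩ : Jet N).addSmul (-1) z)
      (g := fun q => B * Real.exp (A * ‖q.1‖)) superJet_at
      continuous_superJet superJet_pos hs (fun q => by positivity)
      (fun p => (Jet.zero_at p).addSmul _ (hz.at' p))
      (by simpa only [Jet.addSmul, Pi.zero_apply, zero_add] using continuous_const.fun_mul hz.cval)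
      (by positivity : 0 ≤ B + 2)
      (ρ := max ‖q.1‖ K) (fun p _ h1 h2 h3 => ?_)
      (fun p hp h1 h2 => ?_) (fun x _ => ?_) q (le_max_left _ _) h1 h2
    · simpa [Jet.addSmul] using key
    · rw [Coef.op_addSmul, hz.op_eq p h2]
      simp only [Jet.addSmul, Pi.zero_apply, zero_add, neg_mul, one_mul, neg_smul, one_smul,
        norm_neg, Coef.op, map_zero] at h3 ⊢
      have e1 := hone p 0 (z.val p) 0 (z.D p) (by linarith)
      have e2 := (neg_le_abs _).trans (hg p)
      have e3 := hgw p
      simp only [zero_sub, norm_neg] at e1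
      linarith
    · simpa [Jet.addSmul] using (neg_le_abs _).trans (hlat p hp h1 h2)
    · simpa [Jet.addSmul] using (neg_le_abs _).trans (hter x)

theorem IsApprox.sub_le {C' : Coef N} {z z' : Jet N} {r' : ℝ} (hz : IsApprox C H β A B T r z)
    (hz' : IsApprox C' H β A B T r' z') (hH : IsHam A B H) (hA : 0 ≤ A) (hB : 0 < B)
    {k κ μ : ℝ} (hk : 0 < k) (hkr : k ≤ r) (hkr' : k ≤ r')
    (hCC : ∀ q : Euc N × ℝ, ‖q.1‖ ≤ k → C'.tr q = C.tr q) (hκ : 1 ≤ κ) (hκA : A ≤ κ) (hμ : 0 ≤ μ)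
    (hs : IsSuper C A B κ μ T) (hs' : IsSuper C' A B κ μ T) (hs2 : IsSuper C A B (2 * κ) μ T)
    {q : Euc N × ℝ} (h0 : ‖q.1‖ ≤ k) (h1 : -1 ≤ q.2) (h2 : q.2 ≤ T) :
    z.val q - z'.val q ≤ (4 / k + 2 * (B + 2) * Real.exp (-k)) *
      (superJet N (2 * κ) (4 * B) μ T).val q := by
  have hb : 0 ≤ 4 * B := by positivity
  have hr : 0 < r := hk.trans_le hkr
  have hr' : 0 < r' := hk.trans_le hkr'
  have key := Coef.comparison (C := C) (B := B) (z := z.addSmul (-1) z')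
    (g := fun q => B * Real.exp (A * ‖q.1‖)) superJet_at
    continuous_superJet superJet_pos hs2 (fun q => by positivity)
    (fun p => (hz.at' p).addSmul _ (hz'.at' p))
    (by simpa only [Jet.addSmul] using hz.cval.fun_add (continuous_const.fun_mul hz'.cval))
    (by positivity : 0 ≤ 4 / k + 2 * (B + 2) * Real.exp (-k))
    (ρ := k) (fun p h0 h1 h2 h3 => ?_) (fun p hp h1 h2 => ?_) (fun x hx => ?_) q h0 h1 h2
  · simpa [Jet.addSmul, sub_eq_add_neg] using key
  · have e0 : C.op z' p = C'.op z' p := by rw [Coef.op, Coef.op, hCC p h0.le]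
    rw [Coef.op_addSmul, e0, hz.op_eq p h2, hz'.op_eq p h2, radial_of_le hr (h0.le.trans hkr),
      radial_of_le hr' (h0.le.trans hkr')]
    simp only [Jet.addSmul, neg_mul, one_mul, neg_smul, one_smul, ← sub_eq_add_neg] at h3 ⊢
    have e1 := hH.one_sided p (z.val p) (z'.val p) (z.D p) (z'.D p) (by linarith)
    have e2 : 0 ≤ (4 / k + 2 * (B + 2) * Real.exp (-k)) * (B * Real.exp (A * ‖p.1‖)) := by
      positivity
    simp only [Prod.mk.eta] at *
    linarith
  · have e1 := hz.abs_le hH hA hB hr hκ hκA hμ hs h1 h2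
    have e2 := hz'.abs_le hH hA hB hr' hκ hκA hμ hs' h1 h2
    have e3 := superJet_mul_exp_le (N := N) (μ := μ) hκ hb h2
    rw [hp] at e3
    have e4 := mul_le_mul_of_nonneg_left e3 (by positivity : 0 ≤ 2 * (B + 2))
    have e5 : 0 ≤ 4 / k * (superJet N (2 * κ) (4 * B) μ T).val p :=
      mul_nonneg (by positivity) (superJet_pos p).le
    simp only [Jet.addSmul, neg_mul, one_mul, ← sub_eq_add_neg]
    rw [_root_.abs_le] at e1 e2
    linarith
  · have e1 := hz.ter_near x (hx.trans hkr)
    have e2 := hz'.ter_near x (hx.trans hkr')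
    have e3 : 2 / r ≤ 2 / k := by gcongr
    have e4 : 2 / r' ≤ 2 / k := by gcongr
    have e5 := one_le_superJet (N := N) (κ := 2 * κ) (by linarith) hb hμ (q := (x, T)) le_rfl
    have e6 : 4 / k ≤ 4 / k + 2 * (B + 2) * Real.exp (-k) := le_add_of_nonneg_right (by positivity)
    have e7 := le_mul_of_one_le_right (by positivity : 0 ≤ 4 / k + 2 * (B + 2) * Real.exp (-k)) e5
    have e8 : 4 / k = 2 / k + 2 / k := by ring
    simp only [Jet.addSmul, neg_mul, one_mul, ← sub_eq_add_neg]
    rw [_root_.abs_le] at e1 e2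
    linarith

end Convergence

/-! ### The limit of the approximations -/

section Limit

variable {N : ℕ} {A B T Λ₀ : ℝ} {H : Euc N × ℝ → ℝ → Euc N → ℝ} {β : Euc N → ℝ}
  {C : ℕ → Coef N} {z : ℕ → Jet N}

theorem exists_modulus (hH : IsHam A B H) (hA : 0 ≤ A) (hB : 0 < B)
    (hCC : ∀ (m n : ℕ) (q : Euc N × ℝ), m ≤ n → ‖q.1‖ ≤ m + 1 → (C n).tr q = (C m).tr q)
    (hΛ : ∀ n q, ‖(C n).tr q‖ ≤ Λ₀) (hz : ∀ n : ℕ, IsApprox (C n) H β A B T (n + 1) (z n)) :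
    ∃ (W : Euc N × ℝ → ℝ) (δ : ℕ → ℝ), Continuous W ∧ (∀ q, 0 < W q) ∧ (∀ k, 0 < δ k) ∧
      Tendsto δ atTop (𝓝 0) ∧ ∀ (k n m : ℕ) (q : Euc N × ℝ), k ≤ n → k ≤ m → ‖q.1‖ ≤ k + 1 →
        -1 ≤ q.2 → q.2 ≤ T → |(z n).val q - (z m).val q| ≤ δ k * W q := by
  have hΛ₀ : 0 ≤ Λ₀ := (norm_nonneg ((C 0).tr 0)).trans (hΛ 0 0)
  obtain ⟨μ₁, h1, hμ₁⟩ := exists_superJet (κ := A + 1) N T (-1) hA hB hΛ₀ (by linarith)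
    (by linarith)
  obtain ⟨μ₂, h2, hμ₂⟩ := exists_superJet (κ := 2 * (A + 1)) N T (-1) hA hB hΛ₀ (by linarith)
    (by linarith)
  have hs1 : ∀ n, IsSuper (C n) A B (A + 1) (max μ₁ μ₂) T := fun n =>
    hμ₁ _ (le_max_left _ _) (C n) (hΛ n)
  have hs2 : ∀ n, IsSuper (C n) A B (2 * (A + 1)) (max μ₁ μ₂) T := fun n =>
    hμ₂ _ (le_max_right _ _) (C n) (hΛ n)
  refine ⟨(superJet N (2 * (A + 1)) (4 * B) (max μ₁ μ₂) T).val,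
    fun k => 4 / (k + 1 : ℝ) + 2 * (B + 2) * Real.exp (-(k + 1 : ℝ)), continuous_superJet,
    superJet_pos, fun k => by positivity, ?_, ?_⟩
  · have t1 : Tendsto (fun k : ℕ => (k : ℝ) + 1) atTop atTop :=
      tendsto_atTop_add_const_right _ _ tendsto_natCast_atTop_atTop
    have t2 := (Real.tendsto_exp_neg_atTop_nhds_zero.comp t1).const_mul (2 * (B + 2))
    simpa using (t1.const_div_atTop 4).add t2
  · intro k n m q hn hm hq hq1 hq2
    have hn' : (k : ℝ) + 1 ≤ n + 1 := by exact_mod_cast Nat.succ_le_succ hn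
    have hm' : (k : ℝ) + 1 ≤ m + 1 := by exact_mod_cast Nat.succ_le_succ hm
    have hk : (0 : ℝ) < k + 1 := by positivity
    rw [abs_sub_le_iff]
    constructor
    · exact (hz n).sub_le (hz m) hH hA hB hk hn' hm'
        (fun p hp => (hCC k m p hm hp).trans (hCC k n p hn hp).symm) (by linarith) (by linarith)
        (h1.trans (le_max_left _ _)) (hs1 n) (hs1 m) (hs2 n) hq hq1 hq2
    · exact (hz m).sub_le (hz n) hH hA hB hk hm' hn'
        (fun p hp => (hCC k n p hn hp).trans (hCC k m p hm hp).symm) (by linarith) (by linarith)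
        (h1.trans (le_max_left _ _)) (hs1 m) (hs1 n) (hs2 m) hq hq1 hq2

theorem uniformCauchySeqOn_of_bound {X E : Type*} [NormedAddCommGroup E] {f : ℕ → X → E}
    {s : Set X} {δ : ℕ → ℝ} (hδ : Tendsto δ atTop (𝓝 0)) (k₀ : ℕ)
    (h : ∀ k n m, k₀ ≤ k → k ≤ n → k ≤ m → ∀ x ∈ s, ‖f n x - f m x‖ ≤ δ k) :
    UniformCauchySeqOn f atTop s := by
  rw [Metric.uniformCauchySeqOn_iff]
  intro ε hε
  obtain ⟨k, hk, hk'⟩ := ((hδ.eventually_lt_const hε).and (eventually_ge_atTop k₀)).exists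
  exact ⟨k, fun m hm n hn x hx => by
    rw [dist_eq_norm]
    exact (h k m n hk' hm hn x hx).trans_lt hk⟩

theorem IsHam.tendstoUniformlyOn (hH : IsHam A B H) {s : Set (Euc N × ℝ)} {R : ℝ}
    (hs : ∀ q ∈ s, ‖q.1‖ ≤ R) {u : Euc N × ℝ → ℝ} {p : Euc N × ℝ → Euc N}
    (hu : TendstoUniformlyOn (fun n => (z n).val) u atTop s)
    (hp : TendstoUniformlyOn (fun n => (z n).D) p atTop s) :
    TendstoUniformlyOn (fun n q => -H q ((z n).val q) ((z n).D q)) (fun q => -H q (u q) (p q))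
      atTop s := by
  obtain ⟨M, hM, hM'⟩ := hH.lip R
  rw [Metric.tendstoUniformlyOn_iff] at *
  intro ε hε
  have hε' : 0 < ε / (2 * (M + 1)) := by positivity
  filter_upwards [hu _ hε', hp _ hε'] with n h1 h2 q hq
  have e1 := h1 q hq
  have e2 := h2 q hq
  rw [Real.dist_eq] at e1 ⊢
  rw [dist_eq_norm] at e2
  have e3 := hM' q (hs q hq) (u q) ((z n).val q) (p q) ((z n).D q)
  rw [neg_sub_neg, abs_sub_comm]
  have e4 : ε / (2 * (M + 1)) * (2 * (M + 1)) = ε := div_mul_cancel₀ _ (by positivity)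
  have e5 : M * (|u q - (z n).val q| + ‖p q - (z n).D q‖) ≤
      M * (ε / (2 * (M + 1)) + ε / (2 * (M + 1))) := by gcongr
  nlinarith

theorem IsHam.hol_comp (hH : IsHam A B H) (hA : 0 ≤ A) (hB : 0 ≤ B) {V : Set (Euc N × ℝ)}
    {R : ℝ} (hV : ∀ q ∈ V, ‖q.1‖ ≤ R) {u : Euc N × ℝ → ℝ} {p : Euc N × ℝ → Euc N}
    (hu : Hol V u) (hp : Hol V p) : Hol V fun q => -H q (u q) (p q) := by
  obtain ⟨M, hM, hM'⟩ := hH.lip R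
  obtain ⟨L, hL, hL'⟩ := hH.hol R
  refine (Hol.nonlinear (L₀ := B * Real.exp (A * R)) (L₁ := L * √(2 * R)) (fun q hq => ?_)
    (fun x x' t u p hx hx' => ?_) (fun q hq => hM' q (hV q hq)) hu hp).neg
  · refine (hH.growth q).trans ?_
    have := hV q hq
    gcongr
  · have hx1 : ‖x‖ ≤ R := hV (x, t) hx
    have hx1' : ‖x'‖ ≤ R := hV (x', t) hx'
    refine (hL' x x' t u p hx1 hx1').trans ?_
    have e : ‖x - x'‖ ≤ √(2 * R) * √‖x - x'‖ := by
      have h1 : ‖x - x'‖ ≤ 2 * R := (norm_sub_le _ _).trans (by linarith)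
      calc ‖x - x'‖ = √‖x - x'‖ * √‖x - x'‖ := (Real.mul_self_sqrt (norm_nonneg _)).symm
        _ ≤ _ := by gcongr
    have := mul_le_mul_of_nonneg_left e (by positivity : 0 ≤ L * (1 + |u| + ‖p‖))
    linarith

theorem IsApprox.solves {C₀ C' : Coef N} {w : Jet N} {r : ℝ} (hw : IsApprox C' H β A B T r w)
    (hr : 0 < r) {U : Set (Euc N × ℝ)} (hU : ∀ q ∈ U, ‖q.1‖ ≤ r ∧ -1 ≤ q.2 ∧ q.2 ≤ T)
    (hCC : ∀ q ∈ U, C'.tr q = C₀.tr q) (hH : IsHam A B H) :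
    C₀.Solves w (fun q => -H q (w.val q) (w.D q)) U := by
  have hsub : U ⊆ {q | -1 ≤ q.2} := fun q hq => (hU q hq).2.1
  have he : ∀ q ∈ U, -H q (w.val q) (w.D q) = -H (radial r q.1, q.2) (w.val q) (w.D q) :=
    fun q hq => by rw [radial_of_le hr (hU q hq).1]
  refine ⟨fun q _ => hw.at' q, fun q hq => ?_, ?_, hw.cval.continuousOn, hw.cD.continuousOn,
    (hw.hA.mono hsub).congr he, hw.hval.mono hsub, hw.hD.mono hsub⟩
  · rw [he q hq, ← hw.op_eq q (hU q hq).2.2, Coef.op, Coef.op, hCC q hq]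
  · exact (Continuous.comp (g := fun p : (Euc N × ℝ) × ℝ × Euc N => H p.1 p.2.1 p.2.2)
      (f := fun q : Euc N × ℝ => (q, w.val q, w.D q)) hH.cont
      (continuous_id.prodMk (hw.cval.prodMk hw.cD))).neg.continuousOn

/-- Solutions of one equation with a Lipschitz right-hand side: the gradients of differences are
controlled by the differences. -/
theorem Coef.grad_sub_le {C₀ : Coef N} (hH : IsHam A B H) (R₀ : ℝ) : ∃ K, 0 ≤ K ∧
    ∀ (c : Euc N × ℝ) (R : ℝ) (w w' : Jet N) (S : ℝ), 0 < R → R ≤ 1 →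
      (∀ q ∈ Metric.ball c R, ‖q.1‖ ≤ R₀) →
      C₀.Solves w (fun q => -H q (w.val q) (w.D q)) (Metric.ball c R) →
      C₀.Solves w' (fun q => -H q (w'.val q) (w'.D q)) (Metric.ball c R) →
      (∀ q ∈ Metric.ball c R, |w.val q - w'.val q| ≤ S) →
      ∀ q ∈ Metric.ball c (R / 2), ‖w.D q - w'.D q‖ ≤ K / R * S := by
  obtain ⟨M, hM, hM'⟩ := hH.lip R₀
  obtain ⟨K, hK, hK'⟩ := C₀.interior_grad hM
  refine ⟨2 * K, by positivity, fun c R w w' S hR hR1 hcR hw hw' hS q hq => ?_⟩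
  have hsol : C₀.Solves (w.addSmul (-1) w')
      (fun q => -H q (w.val q) (w.D q) - -H q (w'.val q) (w'.D q)) (Metric.ball c R) := by
    refine ⟨fun q hq => (hw.at' q hq).addSmul _ (hw'.at' q hq), fun q hq => ?_,
      hw.cA.fun_sub hw'.cA, ?_, ?_, hw.hA.sub hw'.hA, ?_, ?_⟩
    · rw [Coef.op_addSmul, hw.op_eq q hq, hw'.op_eq q hq]
      ring
    · simpa only [Jet.addSmul, neg_mul, one_mul, ← sub_eq_add_neg] using hw.cval.fun_sub hw'.cval
    · simpa only [Jet.addSmul, neg_smul, one_smul, ← sub_eq_add_neg] using hw.cD.fun_sub hw'.cD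
    · simpa only [Jet.addSmul, neg_mul, one_mul, ← sub_eq_add_neg] using hw.hval.sub hw'.hval
    · simpa only [Jet.addSmul, neg_smul, one_smul, ← sub_eq_add_neg] using hw.hD.sub hw'.hD
  have key := hK' c R _ _ S hR hR1 hsol (fun q hq => ?_) (fun q hq => ?_) q
    (Metric.ball_subset_ball (by linarith) hq)
  · simp only [Jet.addSmul, neg_smul, one_smul, ← sub_eq_add_neg] at key
    rw [Metric.mem_ball] at hq
    have e : R / 2 * ‖w.D q - w'.D q‖ ≤ K * S :=
      (mul_le_mul_of_nonneg_right (by linarith) (norm_nonneg _)).trans key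
    rw [div_mul_eq_mul_div, le_div_iff₀ hR]
    linarith
  · simpa only [Jet.addSmul, neg_mul, one_mul, ← sub_eq_add_neg] using hS q hq
  · simp only [Jet.addSmul, neg_smul, one_smul, ← sub_eq_add_neg]
    rw [neg_sub_neg, abs_sub_comm]
    refine (hM' q (hcR q hq) _ _ _ _).trans ?_
    have := hS q hq
    gcongr

end Limit

/-! ### Existence for structured Hamiltonians -/

section Existence

variable {N : ℕ} {A B T Λ₀ : ℝ} {H : Euc N × ℝ → ℝ → Euc N → ℝ} {β : Euc N → ℝ}
  {C : ℕ → Coef N} {z : ℕ → Jet N}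

theorem exists_pointwise_limit {X E : Type*} [NormedAddCommGroup E] [CompleteSpace E]
    {f : ℕ → X → E} {S : Set X} (h : ∀ x ∈ S, ∃ s, x ∈ s ∧ UniformCauchySeqOn f atTop s) :
    ∃ g : X → E, (∀ x ∈ S, Tendsto (fun n => f n x) atTop (𝓝 (g x))) ∧
      ∀ s, s ⊆ S → UniformCauchySeqOn f atTop s → TendstoUniformlyOn f g atTop s := by
  have h1 : ∀ x, ∃ y, x ∈ S → Tendsto (fun n => f n x) atTop (𝓝 y) := by
    intro x
    by_cases hx : x ∈ S
    · obtain ⟨s, hxs, hs⟩ := h x hx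
      obtain ⟨y, hy⟩ := cauchySeq_tendsto_of_complete (hs.cauchySeq hxs)
      exact ⟨y, fun _ => hy⟩
    · exact ⟨0, fun h => (hx h).elim⟩
  choose g hg using h1
  exact ⟨g, hg, fun s hs hc => hc.tendstoUniformlyOn_of_tendsto fun x hx => hg x (hs hx)⟩

/-- Existence for the terminal value problem with a structured Hamiltonian. -/
theorem exists_local_solution (hH : IsHam A B H) (hA : 0 ≤ A) (hB : 0 < B) (hβ : Continuous β)
    (hβB : ∀ x, |β x| ≤ B * Real.exp (A * ‖x‖)) (hT : 0 < T)
    (hCC : ∀ (m n : ℕ) (q : Euc N × ℝ), m ≤ n → ‖q.1‖ ≤ m + 1 → (C n).tr q = (C m).tr q)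
    (hΛ : ∀ n q, ‖(C n).tr q‖ ≤ Λ₀) :
    ∃ (u : Euc N × ℝ → ℝ) (p : Euc N × ℝ → Euc N),
      ContinuousOn u (univ ×ˢ Icc (-1) T) ∧ (∀ x, u (x, T) = β x) ∧
      ∀ c : Euc N × ℝ, -1 < c.2 → c.2 < T → ContinuousAt p c ∧
        ∃ k : ℕ, ‖c.1‖ ≤ k ∧ ∃ ρ > 0, ∃ (D2 : Euc N × ℝ → Euc N →L[ℝ] Euc N)
          (dt : Euc N × ℝ → ℝ), Continuous D2 ∧ Continuous dt ∧ ∀ q ∈ Metric.ball c ρ,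
            (⟨u, p, D2, dt⟩ : Jet N).At q ∧ (C k).op ⟨u, p, D2, dt⟩ q = -H q (u q) (p q) := by
  choose z hz using fun n : ℕ => exists_isApprox (r := (n : ℝ) + 1) hH hA hB.le hβ hβB (C n) T
    (by linarith [Nat.cast_nonneg (α := ℝ) n])
  obtain ⟨W, δ, cW, hW, hδ, hδ0, hmod⟩ := exists_modulus hH hA hB hCC hΛ hz
  -- uniform Cauchy property of the values
  have hcauchy : ∀ k₀ : ℕ, UniformCauchySeqOn (fun n => (z n).val) atTop
      (Metric.closedBall (0 : Euc N) (k₀ + 1) ×ˢ Icc (-1) T) := by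
    intro k₀
    obtain ⟨K, hK⟩ := ((isCompact_closedBall (0 : Euc N) ((k₀ : ℝ) + 1)).prod
      (isCompact_Icc (a := (-1 : ℝ)) (b := T))).exists_bound_of_continuousOn cW.continuousOn
    refine uniformCauchySeqOn_of_bound (δ := fun k => δ k * K) (by simpa using hδ0.mul_const K) k₀
      fun k n m hk hn hm q hq => ?_
    have hq1 : ‖q.1‖ ≤ k + 1 := by
      have h1 : ‖q.1‖ ≤ k₀ + 1 := by simpa using hq.1
      have h2 : (k₀ : ℝ) ≤ k := by exact_mod_cast hk
      linarith
    refine (hmod k n m q hn hm hq1 hq.2.1 hq.2.2).trans ?_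
    have h3 : W q ≤ K := (le_abs_self _).trans (hK q hq)
    have := (hδ k).le
    gcongr
  have hball : ∀ c : Euc N × ℝ, ∃ k : ℕ, ‖c.1‖ ≤ k := fun c => exists_nat_ge _
  obtain ⟨u, hu, huu⟩ := exists_pointwise_limit (f := fun n => (z n).val)
    (S := (univ : Set (Euc N)) ×ˢ Icc (-1) T) fun q hq => by
      obtain ⟨k, hk⟩ := hball q
      exact ⟨Metric.closedBall (0 : Euc N) (k + 1) ×ˢ Icc (-1) T,
        ⟨by rw [mem_closedBall_zero_iff]; linarith, hq.2⟩, hcauchy k⟩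
  -- small balls inside the strip
  have hsub : ∀ c : Euc N × ℝ, -1 < c.2 → c.2 < T → ∃ k : ℕ, ‖c.1‖ ≤ k ∧ ∃ R, 0 < R ∧ R ≤ 1 ∧
      (∀ q ∈ Metric.ball c R, ‖q.1‖ ≤ k + 1 ∧ -1 ≤ q.2 ∧ q.2 ≤ T) ∧
      ∀ q ∈ Metric.ball c R, -1 < q.2 ∧ q.2 < T := by
    intro c h1 h2
    obtain ⟨k, hk⟩ := hball c
    have key : ∀ q ∈ Metric.ball c (min 1 (min (c.2 + 1) (T - c.2))),
        ‖q.1‖ ≤ k + 1 ∧ -1 < q.2 ∧ q.2 < T := by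
      intro q hq
      rw [Metric.mem_ball, Prod.dist_eq, max_lt_iff, lt_min_iff, lt_min_iff, lt_min_iff,
        lt_min_iff, Real.dist_eq, dist_eq_norm] at hq
      obtain ⟨⟨e1, -⟩, -, e2, e3⟩ := hq
      have e4 := norm_sub_norm_le q.1 c.1
      rw [abs_lt] at e2 e3
      refine ⟨?_, ?_, ?_⟩ <;> linarith
    exact ⟨k, hk, min 1 (min (c.2 + 1) (T - c.2)), by
      refine lt_min one_pos (lt_min ?_ ?_) <;> linarith, min_le_left _ _,
      fun q hq => ⟨(key q hq).1, (key q hq).2.1.le, (key q hq).2.2.le⟩, fun q hq => (key q hq).2⟩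
  have hsolves : ∀ (c : Euc N × ℝ) (k : ℕ) (R : ℝ),
      (∀ q ∈ Metric.ball c R, ‖q.1‖ ≤ k + 1 ∧ -1 ≤ q.2 ∧ q.2 ≤ T) → ∀ n : ℕ, k ≤ n →
      (C k).Solves (z n) (fun q => -H q ((z n).val q) ((z n).D q)) (Metric.ball c R) := by
    intro c k R hR n hn
    have hn' : (k : ℝ) + 1 ≤ n + 1 := by exact_mod_cast Nat.succ_le_succ hn
    exact (hz n).solves (by positivity) (fun q hq => ⟨(hR q hq).1.trans hn', (hR q hq).2⟩)
      (fun q hq => hCC k n q hn (hR q hq).1) hH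
  have hgrad : ∀ (c : Euc N × ℝ) (k : ℕ) (R : ℝ), 0 < R → R ≤ 1 →
      (∀ q ∈ Metric.ball c R, ‖q.1‖ ≤ k + 1 ∧ -1 ≤ q.2 ∧ q.2 ≤ T) →
      UniformCauchySeqOn (fun n => (z n).D) atTop (Metric.ball c (R / 2)) := by
    intro c k R hR hR1 hcR
    obtain ⟨K, hK, hKK⟩ := (C k).grad_sub_le hH (k + 1)
    obtain ⟨S, hS⟩ := (isCompact_closedBall c R).exists_bound_of_continuousOn cW.continuousOn
    refine uniformCauchySeqOn_of_bound (δ := fun j => K / R * (δ j * S))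
      (by simpa using (hδ0.mul_const S).const_mul (K / R)) k fun j n m hj hn hm q hq => ?_
    refine hKK c R (z n) (z m) _ hR hR1 (fun q hq => (hcR q hq).1)
      (hsolves c k R hcR n (hj.trans hn)) (hsolves c k R hcR m (hj.trans hm)) (fun q hq => ?_) q hq
    have hj' : (k : ℝ) ≤ j := by exact_mod_cast hj
    obtain ⟨e1, e2, e3⟩ := hcR q hq
    refine (hmod j n m q hn hm (by linarith) e2 e3).trans ?_
    have h3 : W q ≤ S := (le_abs_self _).trans (hS q (Metric.ball_subset_closedBall hq))
    have := (hδ j).le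
    gcongr
  obtain ⟨p, hp, hpp⟩ := exists_pointwise_limit (f := fun n => (z n).D)
    (S := {q : Euc N × ℝ | -1 < q.2 ∧ q.2 < T}) fun q hq => by
      obtain ⟨k, -, R, hR, hR1, hcR, -⟩ := hsub q hq.1 hq.2
      exact ⟨Metric.ball q (R / 2), Metric.mem_ball_self (half_pos hR), hgrad q k R hR hR1 hcR⟩
  refine ⟨u, p, fun c hc => ?_, fun x => ?_, fun c h1 h2 => ?_⟩
  · obtain ⟨k, hk⟩ := hball c
    have hcont : ContinuousOn u (Metric.closedBall (0 : Euc N) (k + 1) ×ˢ Icc (-1) T) :=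
      (huu _ (prod_mono (subset_univ _) subset_rfl) (hcauchy k)).continuousOn
        (Frequently.of_forall fun n => (hz n).cval.continuousOn)
    refine (hcont c ⟨by rw [mem_closedBall_zero_iff]; linarith, hc.2⟩).mono_of_mem_nhdsWithin ?_
    have hopen : IsOpen {q : Euc N × ℝ | ‖q.1‖ < k + 1} :=
      isOpen_lt (continuous_norm.comp continuous_fst) continuous_const
    filter_upwards [self_mem_nhdsWithin,
      mem_nhdsWithin_of_mem_nhds (hopen.mem_nhds (show ‖c.1‖ < k + 1 by linarith))] with q hq hq'
    exact ⟨by rw [mem_closedBall_zero_iff]; exact le_of_lt hq', hq.2⟩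
  · have e1 := hu (x, T) ⟨mem_univ _, by linarith, le_rfl⟩
    refine tendsto_nhds_unique e1 ?_
    rw [tendsto_iff_norm_sub_tendsto_zero]
    have t1 : Tendsto (fun n : ℕ => (n : ℝ) + 1) atTop atTop :=
      tendsto_atTop_add_const_right _ _ tendsto_natCast_atTop_atTop
    refine tendsto_of_tendsto_of_tendsto_of_le_of_le' tendsto_const_nhds (t1.const_div_atTop 2)
      (Eventually.of_forall fun n => norm_nonneg _) ?_
    filter_upwards [t1.eventually_ge_atTop ‖x‖] with n hn
    exact (hz n).ter_near x hn
  · obtain ⟨k, hk, R, hR, hR1, hcR, hcS⟩ := hsub c h1 h2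
    have hR2 : ∀ q ∈ Metric.ball c (R / 2), q ∈ Metric.ball c R := fun q hq =>
      Metric.ball_subset_ball (by linarith) hq
    have hstrip : Metric.ball c (R / 2) ⊆ {q : Euc N × ℝ | -1 < q.2 ∧ q.2 < T} :=
      fun q hq => hcS q (hR2 q hq)
    have hpu := hpp _ hstrip (hgrad c k R hR hR1 hcR)
    have huu' : TendstoUniformlyOn (fun n => (z n).val) u atTop (Metric.ball c (R / 2)) :=
      (huu _ (prod_mono (subset_univ _) subset_rfl) (hcauchy k)).mono fun q hq => by
        obtain ⟨e1, e2, e3⟩ := hcR q (hR2 q hq)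
        exact ⟨by rwa [mem_closedBall_zero_iff], e2, e3⟩
    have hle : ∀ q ∈ Metric.ball c (R / 2), ‖q.1‖ ≤ k + 1 := fun q hq => (hcR q (hR2 q hq)).1
    refine ⟨?_, k, hk, ?_⟩
    · exact (hpu.continuousOn (Frequently.of_forall fun n => (hz n).cD.continuousOn)).continuousAt
        (Metric.ball_mem_nhds c (half_pos hR))
    · refine Coef.limit_local (half_pos hR) (z := z)
        (An := fun n q => -H q ((z n).val q) ((z n).D q)) ?_ huu' hpu
        (hH.tendstoUniformlyOn hle huu' hpu) fun V hV hVu hVp =>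
          hH.hol_comp hA hB.le (fun q hq => hle q (hV hq)) hVu hVp
      filter_upwards [eventually_ge_atTop k] with n hn
      exact (hsolves c k R hcR n hn).mono hR2

end Existence

/-! ### Coefficients given by the columns of a square root -/

section Columns

variable {N : ℕ}

/-- The functional `M ↦ ⟪v, M v⟫`. -/
def quadForm (v : Euc N) : (Euc N →L[ℝ] Euc N) →L[ℝ] ℝ :=
  (innerSL ℝ v).comp (ContinuousLinearMap.apply ℝ (Euc N) v)

theorem quadForm_apply (v : Euc N) (M : Euc N →L[ℝ] Euc N) :
    quadForm v M = inner ℝ v (M v) := rfl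

theorem norm_quadForm_le (v : Euc N) : ‖quadForm v‖ ≤ ‖v‖ ^ 2 := by
  refine ContinuousLinearMap.opNorm_le_bound _ (by positivity) fun M => ?_
  rw [quadForm_apply, sq, mul_assoc, mul_comm ‖v‖ ‖M‖]
  exact (norm_inner_le_norm _ _).trans (mul_le_mul_of_nonneg_left (M.le_opNorm v) (norm_nonneg v))

theorem norm_quadForm_sub_le (v w : Euc N) :
    ‖quadForm v - quadForm w‖ ≤ (‖v‖ + ‖w‖) * ‖v - w‖ := by
  refine ContinuousLinearMap.opNorm_le_bound _ (by positivity) fun M => ?_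
  have e : (quadForm v - quadForm w) M = inner ℝ v (M (v - w)) + inner ℝ (v - w) (M w) := by
    rw [_root_.sub_apply, quadForm_apply, quadForm_apply, map_sub, inner_sub_right, inner_sub_left]
    ring
  rw [e]
  have h1 : |inner ℝ v (M (v - w))| ≤ ‖v‖ * (‖M‖ * ‖v - w‖) :=
    (abs_real_inner_le_norm _ _).trans
      (mul_le_mul_of_nonneg_left (M.le_opNorm _) (norm_nonneg v))
  have h2 : |inner ℝ (v - w) (M w)| ≤ ‖v - w‖ * (‖M‖ * ‖w‖) :=
    (abs_real_inner_le_norm _ _).trans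
      (mul_le_mul_of_nonneg_left (M.le_opNorm _) (norm_nonneg _))
  refine (_root_.abs_add_le _ _).trans ((add_le_add h1 h2).trans_eq ?_)
  ring

theorem norm_rankOne_sub_le (v w : Euc N) :
    ‖InnerProductSpace.rankOne ℝ v v - InnerProductSpace.rankOne ℝ w w‖ ≤
      (‖v‖ + ‖w‖) * ‖v - w‖ := by
  have e : InnerProductSpace.rankOne ℝ v v - InnerProductSpace.rankOne ℝ w w =
      InnerProductSpace.rankOne ℝ v (v - w) + InnerProductSpace.rankOne ℝ (v - w) w := by
    ext1 z
    simp only [_root_.sub_apply, _root_.add_apply, InnerProductSpace.rankOne_apply,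
      inner_sub_left, sub_smul, smul_sub]
    abel
  rw [e]
  refine (norm_add_le _ _).trans_eq ?_
  rw [InnerProductSpace.norm_rankOne, InnerProductSpace.norm_rankOne]
  ring

/-- The matrix `∑ₖ vₖ vₖᵀ` as an operator. -/
def gramOp (v : Fin N → Euc N) : Euc N →L[ℝ] Euc N :=
  ∑ k, InnerProductSpace.rankOne ℝ (v k) (v k)

theorem gramOp_apply (v : Fin N → Euc N) (w : Euc N) : gramOp v w = ∑ k, inner ℝ (v k) w • v k := by
  simp [gramOp, _root_.sum_apply]

theorem inner_gramOp (v : Fin N → Euc N) (z w : Euc N) :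
    inner ℝ z (gramOp v w) = ∑ k, inner ℝ (v k) z * inner ℝ (v k) w := by
  rw [gramOp_apply, inner_sum]
  refine Finset.sum_congr rfl fun k _ => ?_
  rw [inner_smul_right, real_inner_comm z, mul_comm]

theorem exists_gramOp_inverse {v : Fin N → Euc N} {μ : ℝ} (hμ : 0 < μ)
    (hell : ∀ w, μ * ‖w‖ ^ 2 ≤ ∑ k, inner ℝ (v k) w ^ 2) :
    ∃ Q : Euc N →L[ℝ] Euc N, (∀ z, gramOp v (Q z) = z) ∧ ∀ z, Q (gramOp v z) = z := by
  have hinj : Function.Injective (gramOp v : Euc N →ₗ[ℝ] Euc N) := by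
    rw [injective_iff_map_eq_zero]
    intro w hw
    have h1 := inner_gramOp v w w
    have h2 := hell w
    have hw' : gramOp v w = 0 := hw
    rw [hw', inner_zero_right] at h1
    have h3 : ∑ k, inner ℝ (v k) w ^ 2 = 0 := by
      rw [h1]
      exact Finset.sum_congr rfl fun k _ => sq _
    rw [h3] at h2
    have h4 : ‖w‖ ^ 2 ≤ 0 := by
      by_contra h
      have := mul_pos hμ (not_le.1 h)
      linarith
    exact norm_eq_zero.1 (pow_eq_zero_iff two_ne_zero |>.1 (le_antisymm h4 (by positivity)))
  let e := LinearEquiv.ofInjectiveEndo _ hinj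
  refine ⟨LinearMap.toContinuousLinearMap (e.symm : Euc N →ₗ[ℝ] Euc N), fun z => ?_, fun z => ?_⟩
  · exact e.apply_symm_apply z
  · exact e.symm_apply_apply z

theorem sum_quadForm_inverse {v : Fin N → Euc N} {Q : Euc N →L[ℝ] Euc N}
    (hQ : ∀ z, Q (gramOp v z) = z) : ∑ k, quadForm (v k) Q = N := by
  have e : ∑ k, InnerProductSpace.rankOne ℝ (Q (v k)) (v k) =
      ContinuousLinearMap.id ℝ (Euc N) := by
    ext1 z
    conv_rhs => rw [ContinuousLinearMap.id_apply, ← hQ z, gramOp_apply, map_sum]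
    rw [_root_.sum_apply]
    refine Finset.sum_congr rfl fun k _ => ?_
    rw [InnerProductSpace.rankOne_apply, map_smul]
  have h := congrArg (fun M : Euc N →L[ℝ] Euc N => LinearMap.trace ℝ (Euc N) (M : _ →ₗ[ℝ] _)) e
  simp only [ContinuousLinearMap.toLinearMap_sum, map_sum, InnerProductSpace.trace_rankOne,
    ContinuousLinearMap.coe_id, LinearMap.trace_id] at h
  rw [show ((Module.finrank ℝ (Euc N) : ℕ) : ℝ) = N by simp] at h
  exact h

/-- Coefficients with a bounded Lipschitz square root. -/
theorem exists_coef {v : Fin N → Euc N × ℝ → Euc N} {K μ : ℝ} (hK : 0 < K) (hμ : 0 < μ)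
    (hv : ∀ k q, ‖v k q‖ ≤ K) (hvl : ∀ k q q', ‖v k q - v k q'‖ ≤ K * ‖q - q'‖)
    (hell : ∀ q w, μ * ‖w‖ ^ 2 ≤ ∑ k, inner ℝ (v k q) w ^ 2) :
    ∃ C : Coef N, ∀ q, C.tr q = ∑ k, quadForm (v k q) := by
  choose Q hQ hQ' using fun q => exists_gramOp_inverse hμ (hell q)
  have hN : (0 : ℝ) ≤ N := Nat.cast_nonneg N
  have hsymm : ∀ q z w, inner ℝ (gramOp (fun k => v k q) z) w =
      inner ℝ z (gramOp (fun k => v k q) w) := by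
    intro q z w
    rw [real_inner_comm, inner_gramOp, inner_gramOp]
    exact Finset.sum_congr rfl fun k _ => mul_comm _ _
  have hQsymm : ∀ q z w, inner ℝ (Q q z) w = inner ℝ z (Q q w) := by
    intro q z w
    conv_lhs => rw [← hQ q w]
    rw [← hsymm, hQ]
  have hquad : ∀ q z, inner ℝ z (Q q z) = ∑ k, inner ℝ (v k q) (Q q z) ^ 2 := by
    intro q z
    conv_lhs => rw [← hQ q z, hQ' q, hsymm, inner_gramOp]
    exact Finset.sum_congr rfl fun k _ => (sq _).symm
  have hQle : ∀ q, ‖Q q‖ ≤ 1 / μ := by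
    intro q
    refine ContinuousLinearMap.opNorm_le_bound _ (by positivity) fun z => ?_
    have h1 := hell q (Q q z)
    rw [← hquad] at h1
    have h2 := real_inner_le_norm z (Q q z)
    rw [div_mul_eq_mul_div, one_mul, le_div_iff₀ hμ]
    rcases (norm_nonneg (Q q z)).eq_or_lt with h | h
    · rw [← h]
      simp
    · refine le_of_mul_le_mul_right ?_ h
      linarith
  have hsub : ∀ k q q', (‖v k q‖ + ‖v k q'‖) * ‖v k q - v k q'‖ ≤ 2 * K ^ 2 * ‖q - q'‖ := by
    intro k q q'
    refine (mul_le_mul (add_le_add (hv k q) (hv k q')) (hvl k q q') (norm_nonneg _)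
      (by positivity)).trans_eq ?_
    ring
  have hsum : ∀ x : ℝ, ∑ _k : Fin N, x = N * x := fun x => by simp
  have hgl : ∀ q q', ‖gramOp (fun k => v k q) - gramOp (fun k => v k q')‖ ≤
      N * (2 * K ^ 2 * ‖q - q'‖) := by
    intro q q'
    rw [gramOp, gramOp, ← Finset.sum_sub_distrib, ← hsum]
    exact (norm_sum_le _ _).trans
      (Finset.sum_le_sum fun k _ => (norm_rankOne_sub_le _ _).trans (hsub k q q'))
  have hQpos : ∀ q z, 1 / (N * K ^ 2 + 1) * ‖z‖ ^ 2 ≤ inner ℝ z (Q q z) := by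
    intro q z
    have h0 : (0 : ℝ) < N * K ^ 2 + 1 := by positivity
    have h1 : ‖z‖ ≤ K * ∑ k, |inner ℝ (v k q) (Q q z)| := by
      conv_lhs => rw [← hQ q z, gramOp_apply]
      rw [Finset.mul_sum]
      refine (norm_sum_le _ _).trans (Finset.sum_le_sum fun k _ => ?_)
      rw [norm_smul, Real.norm_eq_abs, mul_comm]
      exact mul_le_mul_of_nonneg_right (hv k q) (abs_nonneg _)
    have h2 : (∑ k, |inner ℝ (v k q) (Q q z)|) ^ 2 ≤ N * inner ℝ z (Q q z) := by
      have := sq_sum_le_card_mul_sum_sq (s := (Finset.univ : Finset (Fin N)))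
        (f := fun k => |inner ℝ (v k q) (Q q z)|)
      simpa [hquad] using this
    have h3 : 0 ≤ inner ℝ z (Q q z) := by
      rw [hquad]
      positivity
    rw [div_mul_eq_mul_div, one_mul, div_le_iff₀ h0]
    have h4 := pow_le_pow_left₀ (norm_nonneg z) h1 2
    rw [mul_pow] at h4
    nlinarith [mul_le_mul_of_nonneg_left h2 (sq_nonneg K)]
  refine ⟨⟨Q, fun q => ∑ k, quadForm (v k q), 1 / (N * K ^ 2 + 1),
    1 / μ + 1 / μ * (N * (2 * K ^ 2)) * (1 / μ) + N * (2 * K ^ 2), by positivity, by positivity,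
    hQsymm, hQpos, fun q => ?_, fun q q' => ?_, fun q => ?_, fun q q' => ?_, fun q => ?_,
    fun q z => ?_, fun q M hM => ?_⟩, fun q => rfl⟩
  · refine (hQle q).trans ?_
    have : 0 ≤ 1 / μ * (N * (2 * K ^ 2)) * (1 / μ) + N * (2 * K ^ 2) := by positivity
    linarith
  · have e : Q q - Q q' = (Q q).comp
        ((gramOp (fun k => v k q') - gramOp (fun k => v k q)).comp (Q q')) := by
      ext1 z
      simp only [_root_.sub_apply, ContinuousLinearMap.comp_apply, map_sub, hQ, hQ']
    have h1 : ‖Q q - Q q'‖ ≤ 1 / μ * (N * (2 * K ^ 2 * ‖q - q'‖) * (1 / μ)) := by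
      rw [e]
      refine (ContinuousLinearMap.opNorm_comp_le _ _).trans
        (mul_le_mul (hQle q) ?_ (norm_nonneg _) (by positivity))
      refine (ContinuousLinearMap.opNorm_comp_le _ _).trans
        (mul_le_mul ?_ (hQle q') (norm_nonneg _) (by positivity))
      rw [norm_sub_rev]
      exact hgl q q'
    refine h1.trans ?_
    have h2 : 0 ≤ (1 / μ + N * (2 * K ^ 2)) * ‖q - q'‖ := by positivity
    nlinarith
  · have h1 : ‖∑ k, quadForm (v k q)‖ ≤ N * K ^ 2 := by
      rw [← hsum]
      exact (norm_sum_le _ fun k => quadForm (v k q)).trans (Finset.sum_le_sum fun k _ =>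
        (norm_quadForm_le _).trans (pow_le_pow_left₀ (norm_nonneg _) (hv k q) 2))
    refine h1.trans ?_
    have : 0 ≤ 1 / μ + 1 / μ * (N * (2 * K ^ 2)) * (1 / μ) + N * K ^ 2 := by positivity
    linarith
  · have h1 : ‖∑ k, quadForm (v k q) - ∑ k, quadForm (v k q')‖ ≤
        N * (2 * K ^ 2 * ‖q - q'‖) := by
      have e : ∑ k, quadForm (v k q) - ∑ k, quadForm (v k q') =
          ∑ k, (quadForm (v k q) - quadForm (v k q')) :=
        (Finset.sum_sub_distrib (fun k => quadForm (v k q)) fun k => quadForm (v k q')).symm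
      rw [e, ← hsum]
      exact (norm_sum_le _ fun k => quadForm (v k q) - quadForm (v k q')).trans
        (Finset.sum_le_sum fun k _ => (norm_quadForm_sub_le _ _).trans (hsub k q q'))
    refine h1.trans ?_
    have h2 : 0 ≤ (1 / μ + 1 / μ * (N * (2 * K ^ 2)) * (1 / μ)) * ‖q - q'‖ := by positivity
    linarith
  · rw [_root_.sum_apply]
    exact sum_quadForm_inverse (hQ' q)
  · rw [_root_.sum_apply, hquad]
    refine Finset.sum_congr rfl fun k _ => ?_
    rw [quadForm_apply, InnerProductSpace.rankOne_apply, inner_smul_right,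
      real_inner_comm (v k q) (Q q z), sq]
  · rw [_root_.sum_apply]
    exact Finset.sum_nonpos fun k _ => hM _

end Columns

/-! ### Truncated coefficients and the Isaacs Hamiltonian -/

section Data

variable {N k m : ℕ} {T A B μ : ℝ}

/-- The projection of the real line onto `[0, T]`. -/
def clamp (T t : ℝ) : ℝ := max 0 (min t T)

theorem clamp_mem (hT : 0 < T) (t : ℝ) : clamp T t ∈ Icc 0 T :=
  ⟨le_max_left _ _, max_le hT.le (min_le_right _ _)⟩

theorem clamp_of_mem {t : ℝ} (ht : t ∈ Icc 0 T) : clamp T t = t := by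
  rw [clamp, min_eq_left ht.2, max_eq_right ht.1]

theorem abs_clamp_sub_le (t t' : ℝ) : |clamp T t - clamp T t'| ≤ |t - t'| := by
  have h1 := abs_max_sub_max_le_abs (min t T) (min t' T) 0
  rw [max_comm _ 0, max_comm _ 0] at h1
  refine h1.trans ((abs_min_sub_min_le_max t T t' T).trans_eq ?_)
  simp

theorem norm_le_sum_abs (x : Euc N) : ‖x‖ ≤ ∑ i, |x i| := by
  conv_lhs => rw [euc_eq_sum x]
  refine (norm_sum_le _ _).trans_eq (Finset.sum_congr rfl fun i _ => ?_)
  rw [norm_smul, EuclideanSpace.norm_single, norm_one, mul_one, Real.norm_eq_abs]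

theorem inner_eq_sum (x y : Euc N) : inner ℝ x y = ∑ i, x i * y i := by
  rw [PiLp.inner_apply]
  exact Finset.sum_congr rfl fun i _ => by simp [mul_comm]

theorem sum_inner_col_sq (s : Matrix (Fin N) (Fin N) ℝ) (w : Euc N) :
    ∑ k, inner ℝ (WithLp.toLp 2 (fun i => s i k) : Euc N) w ^ 2 =
      ∑ i, ∑ j, (s * sᵀ) i j * w i * w j := by
  simp only [inner_eq_sum, sq, Finset.sum_mul_sum, Matrix.mul_apply, Matrix.transpose_apply,
    Finset.sum_mul]
  rw [Finset.sum_comm]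
  refine Finset.sum_congr rfl fun i _ => ?_
  rw [Finset.sum_comm]
  refine Finset.sum_congr rfl fun j _ => ?_
  rw [Finset.mul_sum]
  refine Finset.sum_congr rfl fun l _ => ?_
  ring

theorem sum_quadForm_col (s : Matrix (Fin N) (Fin N) ℝ) (M : Euc N →L[ℝ] Euc N) :
    ∑ k, quadForm (WithLp.toLp 2 (fun i => s i k) : Euc N) M =
      ∑ i, ∑ j, (s * sᵀ) i j * (M (EuclideanSpace.single j 1)) i := by
  have h1 : ∀ (v : Euc N) i, M v i = ∑ j, v j * (M (EuclideanSpace.single j 1)) i := by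
    intro v i
    conv_lhs => rw [euc_eq_sum v, map_sum]
    simp
  simp only [quadForm_apply, inner_eq_sum, Matrix.mul_apply, Matrix.transpose_apply,
    Finset.sum_mul]
  rw [Finset.sum_comm]
  refine Finset.sum_congr rfl fun i _ => ?_
  rw [Finset.sum_comm]
  refine Finset.sum_congr rfl fun l _ => ?_
  rw [h1, Finset.mul_sum]
  refine Finset.sum_congr rfl fun j _ => ?_
  ring

/-- Truncated coefficients coming from a locally Lipschitz square root. -/
theorem exists_coef_seq (hT : 0 < T) {s a : Euc N → ℝ → Matrix (Fin N) (Fin N) ℝ}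
    (ha : ∀ x t, a x t = s x t * (s x t)ᵀ)
    (hs : ∀ R : ℝ, ∃ L, ∀ (x x' : Euc N) (t t' : ℝ),
        ‖x‖ ≤ R → ‖x'‖ ≤ R → t ∈ Icc (0 : ℝ) T → t' ∈ Icc (0 : ℝ) T →
        ∀ i j, |s x t i j - s x' t' i j| ≤ L * (‖x - x'‖ + |t - t'|))
    (hμ : 0 < μ) (hell : ∀ x t, t ∈ Icc (0 : ℝ) T → ∀ ξ : Fin N → ℝ,
        μ * ∑ i, ξ i ^ 2 ≤ ∑ i, ∑ j, a x t i j * ξ i * ξ j)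
    (hB : 0 < B) (hsB : ∀ (x : Euc N) (t : ℝ), t ∈ Icc (0 : ℝ) T → ∀ i j, |s x t i j| ≤ B) :
    ∃ (C : ℕ → Coef N) (Λ₀ : ℝ),
      (∀ (m n : ℕ) (q : Euc N × ℝ), m ≤ n → ‖q.1‖ ≤ m + 1 → (C n).tr q = (C m).tr q) ∧
      (∀ n q, ‖(C n).tr q‖ ≤ Λ₀) ∧
      ∀ (n : ℕ) (q : Euc N × ℝ) M, ‖q.1‖ ≤ n + 1 → q.2 ∈ Icc 0 T → (C n).tr q M =
        ∑ i, ∑ j, a q.1 q.2 i j * (M (EuclideanSpace.single j 1)) i := by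
  have hpos : ∀ n : ℕ, (0 : ℝ) < n + 1 := fun n => by positivity
  have hsum : ∀ x : ℝ, ∑ _k : Fin N, x = N * x := fun x => by simp
  let v : ℕ → Fin N → Euc N × ℝ → Euc N := fun n k q =>
    WithLp.toLp 2 fun i => s (radial (n + 1) q.1) (clamp T q.2) i k
  have hvB : ∀ n k q, ‖v n k q‖ ≤ N * B := by
    intro n k q
    rw [← hsum]
    exact (norm_le_sum_abs _).trans (Finset.sum_le_sum fun i _ => hsB _ _ (clamp_mem hT _) _ _)
  have hC : ∀ n : ℕ, ∃ C : Coef N, ∀ q, C.tr q = ∑ k, quadForm (v n k q) := by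
    intro n
    obtain ⟨L, hL⟩ := hs (n + 1)
    refine exists_coef (K := N * B + N * (|L| * 3) + 1) (μ := μ) (by positivity) hμ
      (fun k q => (hvB n k q).trans (by nlinarith [abs_nonneg L, Nat.cast_nonneg (α := ℝ) N]))
      (fun k q q' => ?_) fun q w => ?_
    · have h1 : ‖v n k q - v n k q'‖ ≤ N * (|L| * (3 * ‖q - q'‖)) := by
        rw [← hsum]
        refine (norm_le_sum_abs _).trans (Finset.sum_le_sum fun i _ => ?_)
        refine (hL _ _ _ _ (norm_radial_le (hpos n) q.1) (norm_radial_le (hpos n) q'.1)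
          (clamp_mem hT q.2) (clamp_mem hT q'.2) i k).trans ?_
        have h2 := norm_radial_sub_le (hpos n) q.1 q'.1
        have h3 := abs_clamp_sub_le (T := T) q.2 q'.2
        have h4 : ‖q.1 - q'.1‖ ≤ ‖q - q'‖ := norm_fst_le (q - q')
        have h5 : |q.2 - q'.2| ≤ ‖q - q'‖ := norm_snd_le (q - q')
        exact mul_le_mul (le_abs_self L) (by linarith) (by positivity) (abs_nonneg L)
      refine h1.trans ?_
      have h2 : 0 ≤ (N * B + 1) * ‖q - q'‖ := by positivity
      linarith
    · rw [sum_inner_col_sq, ← ha, EuclideanSpace.real_norm_sq_eq]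
      exact hell _ _ (clamp_mem hT _) _
  choose C hC using hC
  refine ⟨C, N * (N * B) ^ 2, fun m n q hmn hq => ?_, fun n q => ?_, fun n q M hq ht => ?_⟩
  · have h1 : (m : ℝ) ≤ n := by exact_mod_cast hmn
    rw [hC, hC]
    simp only [v]
    rw [radial_of_le (hpos n) (by linarith), radial_of_le (hpos m) hq]
  · rw [hC, ← hsum]
    exact (norm_sum_le _ fun k => quadForm (v n k q)).trans (Finset.sum_le_sum fun k _ =>
      (norm_quadForm_le _).trans (pow_le_pow_left₀ (norm_nonneg _) (hvB n k q) 2))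
  · rw [hC, _root_.sum_apply, ha, ← sum_quadForm_col]
    simp only [v]
    rw [radial_of_le (hpos n) hq, clamp_of_mem ht]

theorem iSup_iInf_sub_le {ι κ : Type*} [Nonempty ι] [Nonempty κ] {g g' : ι → κ → ℝ} {c K K' : ℝ}
    (hg : ∀ i j, |g i j| ≤ K) (hg' : ∀ i j, |g' i j| ≤ K') (h : ∀ i j, g i j - g' i j ≤ c) :
    (⨆ i, ⨅ j, g i j) - (⨆ i, ⨅ j, g' i j) ≤ c := by
  have b : ∀ i, BddBelow (range (g i)) := fun i =>
    ⟨-K, by rintro _ ⟨j, rfl⟩; exact (_root_.abs_le.1 (hg i j)).1⟩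
  have b' : ∀ i, BddBelow (range (g' i)) := fun i =>
    ⟨-K', by rintro _ ⟨j, rfl⟩; exact (_root_.abs_le.1 (hg' i j)).1⟩
  have j₀ : κ := Classical.arbitrary κ
  have b'' : BddAbove (range fun i => ⨅ j, g' i j) :=
    ⟨K', by rintro _ ⟨i, rfl⟩; exact (ciInf_le (b' i) j₀).trans (_root_.abs_le.1 (hg' i j₀)).2⟩
  rw [sub_le_iff_le_add']
  refine ciSup_le fun i => ?_
  have h1 : (⨅ j, g i j) - c ≤ ⨅ j, g' i j :=
    le_ciInf fun j => by linarith [ciInf_le (b i) j, h i j]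
  linarith [le_ciSup b'' i]

theorem abs_iSup_iInf_sub_le {ι κ : Type*} [Nonempty ι] [Nonempty κ] {g g' : ι → κ → ℝ}
    {c K K' : ℝ} (hg : ∀ i j, |g i j| ≤ K) (hg' : ∀ i j, |g' i j| ≤ K')
    (h : ∀ i j, |g i j - g' i j| ≤ c) :
    |(⨆ i, ⨅ j, g i j) - (⨆ i, ⨅ j, g' i j)| ≤ c :=
  abs_sub_le_iff.2 ⟨iSup_iInf_sub_le hg hg' fun i j => (abs_sub_le_iff.1 (h i j)).1,
    iSup_iInf_sub_le hg' hg fun i j => (abs_sub_le_iff.1 (h i j)).2⟩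

theorem abs_sum_mul_le (x y : Euc N) : |∑ i, x i * y i| ≤ ‖x‖ * ‖y‖ := by
  rw [← inner_eq_sum]
  exact abs_real_inner_le_norm x y

/-- The Isaacs Hamiltonian, with time projected to `[0, T]`, satisfies the structural
conditions. -/
theorem isHam_isaacsHam (hT : 0 < T) {Dset : Set (Fin k → ℝ)} {Γset : Set (Fin m → ℝ)}
    (hD : IsCompact Dset) (hDne : Dset.Nonempty) (hΓ : IsCompact Γset) (hΓne : Γset.Nonempty)
    {iv : Euc N → ℝ → (Fin k → ℝ) → (Fin m → ℝ) → Euc N}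
    {h f : Euc N → ℝ → (Fin k → ℝ) → (Fin m → ℝ) → ℝ}
    (hh : ContinuousOn (fun q : (Euc N × ℝ) × (Fin k → ℝ) × (Fin m → ℝ) =>
          h q.1.1 q.1.2 q.2.1 q.2.2) ((univ ×ˢ Icc (0 : ℝ) T) ×ˢ Dset ×ˢ Γset))
    {L : ℕ → ℝ} (hL : ∀ n, 0 < L n)
    (hLip : ∀ (n : ℕ) (x x' : Euc N) (t t' : ℝ) (δ : Fin k → ℝ) (η : Fin m → ℝ),
        δ ∈ Dset → η ∈ Γset → ‖x‖ ≤ (n : ℝ) → ‖x'‖ ≤ (n : ℝ) →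
        t ∈ Icc (0 : ℝ) T → t' ∈ Icc (0 : ℝ) T →
        ‖iv x t δ η - iv x' t' δ η‖ ≤ L n * (‖x - x'‖ + |t - t'|) ∧
        |h x t δ η - h x' t' δ η| ≤ L n * (‖x - x'‖ + |t - t'|) ∧
        |f x t δ η - f x' t' δ η| ≤ L n * (‖x - x'‖ + |t - t'|))
    (hB : 0 < B)
    (hhB : ∀ (x : Euc N) (t : ℝ) (δ : Fin k → ℝ) (η : Fin m → ℝ),
          t ∈ Icc (0 : ℝ) T → δ ∈ Dset → η ∈ Γset → h x t δ η ≤ B * (1 + ‖x‖))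
    (hfB : ∀ (x : Euc N) (t : ℝ) (δ : Fin k → ℝ) (η : Fin m → ℝ),
        t ∈ Icc (0 : ℝ) T → δ ∈ Dset → η ∈ Γset → |f x t δ η| ≤ B * Real.exp (A * ‖x‖))
    (hiB : ∀ (x : Euc N) (t : ℝ) (δ : Fin k → ℝ) (η : Fin m → ℝ),
        t ∈ Icc (0 : ℝ) T → δ ∈ Dset → η ∈ Γset → ‖iv x t δ η‖ ≤ B * (1 + ‖x‖)) :
    IsHam A B fun (q : Euc N × ℝ) u p =>
      isaacsHam N k m Dset Γset iv h f p u q.1 (clamp T q.2) := by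
  have : Nonempty Dset := hDne.to_subtype
  have : Nonempty Γset := hΓne.to_subtype
  have hhK : ∀ r : ℝ, ∃ K, 0 ≤ K ∧ ∀ (x : Euc N) t δ η, ‖x‖ ≤ r → δ ∈ Dset → η ∈ Γset →
      |h x (clamp T t) δ η| ≤ K := by
    intro r
    obtain ⟨K, hK⟩ := (((isCompact_closedBall (0 : Euc N) r).prod
      (isCompact_Icc (a := (0 : ℝ)) (b := T))).prod (hD.prod hΓ)).exists_bound_of_continuousOn
      (hh.mono (prod_mono (prod_mono (subset_univ _) subset_rfl) subset_rfl))
    refine ⟨|K|, abs_nonneg K, fun x t δ η hx hδ hη => ?_⟩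
    exact (hK ((x, clamp T t), δ, η)
      ⟨⟨mem_closedBall_zero_iff.2 hx, clamp_mem hT t⟩, hδ, hη⟩).trans (le_abs_self K)
  let g : Euc N × ℝ → ℝ → Euc N → Dset → Γset → ℝ := fun q u p δ η =>
    (∑ i, iv q.1 (clamp T q.2) δ.1 η.1 i * p i) + h q.1 (clamp T q.2) δ.1 η.1 * u +
      f q.1 (clamp T q.2) δ.1 η.1
  have hgK : ∀ q u p, ∃ K, ∀ δ η, |g q u p δ η| ≤ K := by
    intro q u p
    obtain ⟨K, -, hK⟩ := hhK ‖q.1‖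
    refine ⟨B * (1 + ‖q.1‖) * ‖p‖ + K * |u| + B * Real.exp (A * ‖q.1‖), fun δ η => ?_⟩
    refine (abs_add_three _ _ _).trans (add_le_add (add_le_add ?_ ?_)
      (hfB _ _ _ _ (clamp_mem hT _) δ.2 η.2))
    · exact (abs_sum_mul_le _ _).trans (mul_le_mul_of_nonneg_right
        (hiB _ _ _ _ (clamp_mem hT _) δ.2 η.2) (norm_nonneg p))
    · rw [abs_mul]
      exact mul_le_mul_of_nonneg_right (hK _ _ _ _ le_rfl δ.2 η.2) (abs_nonneg u)
  have hgd : ∀ q u u' p p' δ η, g q u p δ η - g q u' p' δ η =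
      (∑ i, iv q.1 (clamp T q.2) (δ : Fin k → ℝ) (η : Fin m → ℝ) i * (p - p') i) +
        h q.1 (clamp T q.2) δ.1 η.1 * (u - u') := by
    intro q u u' p p' δ η
    simp only [g, PiLp.sub_apply, mul_sub, Finset.sum_sub_distrib]
    ring
  have hsp : ∀ r, ∃ L, 0 ≤ L ∧ ∀ (q q' : Euc N × ℝ) u p, ‖q.1‖ ≤ r → ‖q'.1‖ ≤ r →
      |(⨆ δ, ⨅ η, g q u p δ η) - (⨆ δ, ⨅ η, g q' u p δ η)| ≤
        L * (1 + |u| + ‖p‖) * (‖q.1 - q'.1‖ + |q.2 - q'.2|) := by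
    intro r
    obtain ⟨n, hn⟩ := exists_nat_ge r
    refine ⟨L n, (hL n).le, fun q q' u p hq hq' => ?_⟩
    obtain ⟨K, hK⟩ := hgK q u p
    obtain ⟨K', hK'⟩ := hgK q' u p
    refine abs_iSup_iInf_sub_le hK hK' fun δ η => ?_
    obtain ⟨e1, e2, e3⟩ := hLip n q.1 q'.1 (clamp T q.2) (clamp T q'.2) δ η δ.2 η.2 (hq.trans hn)
      (hq'.trans hn) (clamp_mem hT _) (clamp_mem hT _)
    have e4 : L n * (‖q.1 - q'.1‖ + |clamp T q.2 - clamp T q'.2|) ≤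
        L n * (‖q.1 - q'.1‖ + |q.2 - q'.2|) :=
      mul_le_mul_of_nonneg_left (by linarith [abs_clamp_sub_le (T := T) q.2 q'.2]) (hL n).le
    generalize L n * (‖q.1 - q'.1‖ + |clamp T q.2 - clamp T q'.2|) = d at e1 e2 e3 e4
    have e : g q u p δ η - g q' u p δ η =
        (∑ i, (iv q.1 (clamp T q.2) δ η - iv q'.1 (clamp T q'.2) δ η) i * p i) +
        (h q.1 (clamp T q.2) δ η - h q'.1 (clamp T q'.2) δ η) * u +
        (f q.1 (clamp T q.2) δ η - f q'.1 (clamp T q'.2) δ η) := by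
      simp only [g, PiLp.sub_apply, sub_mul, Finset.sum_sub_distrib]
      ring
    rw [e]
    have f1 := (abs_sum_mul_le (iv q.1 (clamp T q.2) δ η - iv q'.1 (clamp T q'.2) δ η) p).trans
      (mul_le_mul_of_nonneg_right (e1.trans e4) (norm_nonneg p))
    have f2 : |(h q.1 (clamp T q.2) δ η - h q'.1 (clamp T q'.2) δ η) * u| ≤
        L n * (‖q.1 - q'.1‖ + |q.2 - q'.2|) * |u| := by
      rw [abs_mul]
      exact mul_le_mul_of_nonneg_right (e2.trans e4) (abs_nonneg u)
    refine (abs_add_three _ _ _).trans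
      ((add_le_add (add_le_add f1 f2) (e3.trans e4)).trans_eq ?_)
    ring
  have hlip : ∀ r, ∃ M, 0 ≤ M ∧ ∀ q : Euc N × ℝ, ‖q.1‖ ≤ r → ∀ u u' p p',
      |(⨆ δ, ⨅ η, g q u p δ η) - (⨆ δ, ⨅ η, g q u' p' δ η)| ≤
        M * (|u - u'| + ‖p - p'‖) := by
    intro r
    obtain ⟨K, hK0, hK⟩ := hhK r
    refine ⟨K + B * (1 + |r|), by positivity, fun q hq u u' p p' => ?_⟩
    obtain ⟨K₁, hK₁⟩ := hgK q u p
    obtain ⟨K₂, hK₂⟩ := hgK q u' p'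
    refine abs_iSup_iInf_sub_le hK₁ hK₂ fun δ η => ?_
    rw [hgd]
    have e1 : ‖iv q.1 (clamp T q.2) δ η‖ ≤ B * (1 + |r|) :=
      (hiB _ _ _ _ (clamp_mem hT _) δ.2 η.2).trans
        (mul_le_mul_of_nonneg_left (by linarith [le_abs_self r]) hB.le)
    have f1 := (abs_sum_mul_le (iv q.1 (clamp T q.2) δ η) (p - p')).trans
      (mul_le_mul_of_nonneg_right e1 (norm_nonneg _))
    have f2 : |h q.1 (clamp T q.2) δ η * (u - u')| ≤ K * |u - u'| := by
      rw [abs_mul]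
      exact mul_le_mul_of_nonneg_right (hK _ _ _ _ hq δ.2 η.2) (abs_nonneg _)
    refine (_root_.abs_add_le _ _).trans ((add_le_add f1 f2).trans ?_)
    have f3 : 0 ≤ K * ‖p - p'‖ + B * (1 + |r|) * |u - u'| := by positivity
    linarith
  refine ⟨?_, fun r => ?_, hlip, fun q => ?_, fun q u u' p p' hu => ?_⟩
  · rw [continuous_iff_continuousAt]
    rintro ⟨q₀, u₀, p₀⟩
    obtain ⟨L₁, hL₁, hL₁'⟩ := hsp (‖q₀.1‖ + 1)
    obtain ⟨M, hM, hM'⟩ := hlip (‖q₀.1‖ + 1)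
    have hnear : ∀ᶠ w : (Euc N × ℝ) × ℝ × Euc N in 𝓝 (q₀, u₀, p₀), ‖w.1.1‖ < ‖q₀.1‖ + 1 :=
      (isOpen_lt (continuous_norm.comp (continuous_fst.comp continuous_fst))
        continuous_const).mem_nhds (show ‖q₀.1‖ < ‖q₀.1‖ + 1 by linarith)
    have hlim : Tendsto (fun w : (Euc N × ℝ) × ℝ × Euc N =>
        L₁ * (1 + |u₀| + ‖p₀‖) * (‖w.1.1 - q₀.1‖ + |w.1.2 - q₀.2|) +
          M * (|w.2.1 - u₀| + ‖w.2.2 - p₀‖)) (𝓝 (q₀, u₀, p₀)) (𝓝 0) := by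
      have hc : Continuous fun w : (Euc N × ℝ) × ℝ × Euc N =>
          L₁ * (1 + |u₀| + ‖p₀‖) * (‖w.1.1 - q₀.1‖ + |w.1.2 - q₀.2|) +
            M * (|w.2.1 - u₀| + ‖w.2.2 - p₀‖) := by fun_prop
      simpa using hc.tendsto (q₀, u₀, p₀)
    rw [ContinuousAt, tendsto_iff_norm_sub_tendsto_zero]
    refine tendsto_of_tendsto_of_tendsto_of_le_of_le' tendsto_const_nhds hlim
      (Eventually.of_forall fun w => norm_nonneg _) ?_
    filter_upwards [hnear] with w hw
    have f1 := hL₁' w.1 q₀ u₀ p₀ hw.le (by linarith)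
    have f2 := hM' w.1 hw.le w.2.1 u₀ w.2.2 p₀
    have f3 := _root_.abs_sub_le (⨆ δ, ⨅ η, g w.1 w.2.1 w.2.2 δ η) (⨆ δ, ⨅ η, g w.1 u₀ p₀ δ η)
      (⨆ δ, ⨅ η, g q₀ u₀ p₀ δ η)
    exact f3.trans (by linarith)
  · obtain ⟨L₁, hL₁, hL₁'⟩ := hsp r
    refine ⟨L₁, hL₁, fun x x' t u p hx hx' => ?_⟩
    have := hL₁' (x, t) (x', t) u p hx hx'
    simp only [sub_self, abs_zero, add_zero] at this
    exact this
  · have h0 : |(⨆ δ, ⨅ η, g q 0 0 δ η) - (⨆ _δ : Dset, ⨅ _η : Γset, (0 : ℝ))| ≤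
        B * Real.exp (A * ‖q.1‖) := by
      obtain ⟨K, hK⟩ := hgK q 0 0
      refine abs_iSup_iInf_sub_le hK (K' := 0) (by simp) fun δ η => ?_
      simpa [g] using hfB q.1 _ δ η (clamp_mem hT q.2) δ.2 η.2
    simp only [ciSup_const, ciInf_const, sub_zero] at h0
    exact h0
  · obtain ⟨K₁, hK₁⟩ := hgK q u p
    obtain ⟨K₂, hK₂⟩ := hgK q u' p'
    refine iSup_iInf_sub_le hK₁ hK₂ fun δ η => ?_
    rw [hgd]
    have f1 := (le_abs_self _).trans ((abs_sum_mul_le (iv q.1 (clamp T q.2) δ η) (p - p')).trans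
      (mul_le_mul_of_nonneg_right (hiB q.1 _ δ η (clamp_mem hT q.2) δ.2 η.2)
        (norm_nonneg _)))
    have f2 := mul_le_mul_of_nonneg_right (hhB q.1 _ δ η (clamp_mem hT q.2) δ.2 η.2)
      (sub_nonneg.2 hu)
    linarith

end Data

/-- under assumptions (D1)–(D4) the Isaacs terminal-value problem
admits a classical solution. -/
theorem existence_isaacs_D
    (N k m : ℕ) (hN : 1 ≤ N) (T : ℝ) (hT : 0 < T)
    (Dset : Set (Fin k → ℝ)) (Γset : Set (Fin m → ℝ))
    (hD : IsCompact Dset) (hDne : Dset.Nonempty)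
    (hΓ : IsCompact Γset) (hΓne : Γset.Nonempty)
    (σm a : Euc N → ℝ → Matrix (Fin N) (Fin N) ℝ)
    -- (D1)
    (ha : ∀ x t, a x t = σm x t * (σm x t)ᵀ)
    (hσlocLip : ∀ R : ℝ, ∃ L, ∀ (x x' : Euc N) (t t' : ℝ),
        ‖x‖ ≤ R → ‖x'‖ ≤ R → t ∈ Set.Icc (0:ℝ) T → t' ∈ Set.Icc (0:ℝ) T →
        ∀ i j, |σm x t i j - σm x' t' i j| ≤ L * (‖x - x'‖ + |t - t'|))
    (μ : ℝ) (hμ : 0 < μ)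
    (hell : ∀ x t, t ∈ Set.Icc (0:ℝ) T → ∀ ξ : Fin N → ℝ,
        μ * ∑ i, ξ i ^ 2 ≤ ∑ i, ∑ j, a x t i j * ξ i * ξ j)
    -- (D2)
    (iv : Euc N → ℝ → (Fin k → ℝ) → (Fin m → ℝ) → Euc N)
    (h f : Euc N → ℝ → (Fin k → ℝ) → (Fin m → ℝ) → ℝ)
    (hivcont : ContinuousOn
        (fun q : (Euc N × ℝ) × (Fin k → ℝ) × (Fin m → ℝ) =>
          iv q.1.1 q.1.2 q.2.1 q.2.2)
        ((Set.univ ×ˢ Set.Icc (0:ℝ) T) ×ˢ Dset ×ˢ Γset))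
    (hhcont : ContinuousOn
        (fun q : (Euc N × ℝ) × (Fin k → ℝ) × (Fin m → ℝ) =>
          h q.1.1 q.1.2 q.2.1 q.2.2)
        ((Set.univ ×ˢ Set.Icc (0:ℝ) T) ×ˢ Dset ×ˢ Γset))
    (hfcont : ContinuousOn
        (fun q : (Euc N × ℝ) × (Fin k → ℝ) × (Fin m → ℝ) =>
          f q.1.1 q.1.2 q.2.1 q.2.2)
        ((Set.univ ×ˢ Set.Icc (0:ℝ) T) ×ˢ Dset ×ˢ Γset))
    (L : ℕ → ℝ) (hLpos : ∀ n, 0 < L n)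
    (hLip : ∀ (n : ℕ) (x x' : Euc N) (t t' : ℝ) (δ : Fin k → ℝ) (η : Fin m → ℝ),
        δ ∈ Dset → η ∈ Γset → ‖x‖ ≤ (n : ℝ) → ‖x'‖ ≤ (n : ℝ) →
        t ∈ Set.Icc (0:ℝ) T → t' ∈ Set.Icc (0:ℝ) T →
        ‖iv x t δ η - iv x' t' δ η‖ ≤ L n * (‖x - x'‖ + |t - t'|) ∧
        |h x t δ η - h x' t' δ η| ≤ L n * (‖x - x'‖ + |t - t'|) ∧
        |f x t δ η - f x' t' δ η| ≤ L n * (‖x - x'‖ + |t - t'|))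
    -- (D3)
    (β : Euc N → ℝ)
    (hβLip : ∀ R : ℝ, ∃ Lβ, ∀ x y : Euc N, ‖x‖ ≤ R → ‖y‖ ≤ R →
        |β x - β y| ≤ Lβ * ‖x - y‖)
    -- (D4)
    (A B : ℝ) (hA : 0 < A) (hB : 0 < B)
    (hD4h : (∀ (x : Euc N) (t : ℝ) (δ : Fin k → ℝ) (η : Fin m → ℝ),
          t ∈ Set.Icc (0:ℝ) T → δ ∈ Dset → η ∈ Γset →
          |h x t δ η| ≤ B * (1 + ‖x‖)) ∨
        (∀ (x : Euc N) (t : ℝ) (δ : Fin k → ℝ) (η : Fin m → ℝ),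
          t ∈ Set.Icc (0:ℝ) T → δ ∈ Dset → η ∈ Γset → h x t δ η ≤ B))
    (hD4f : ∀ (x : Euc N) (t : ℝ) (δ : Fin k → ℝ) (η : Fin m → ℝ),
        t ∈ Set.Icc (0:ℝ) T → δ ∈ Dset → η ∈ Γset →
        |f x t δ η| + |β x| ≤ B * Real.exp (A * ‖x‖))
    (hD4i : ∀ (x : Euc N) (t : ℝ) (δ : Fin k → ℝ) (η : Fin m → ℝ),
        t ∈ Set.Icc (0:ℝ) T → δ ∈ Dset → η ∈ Γset →
        ‖iv x t δ η‖ ≤ B * (1 + ‖x‖))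
    (hD4σ : ∀ (x : Euc N) (t : ℝ), t ∈ Set.Icc (0:ℝ) T →
        ∀ i j, |σm x t i j| ≤ B) :
    ∃ (u : Euc N → ℝ → ℝ) (Du : Euc N → ℝ → Euc N)
      (D2u : Euc N → ℝ → (Euc N →L[ℝ] Euc N)) (ut : Euc N → ℝ → ℝ),
      IsClassicalSolution N T a (isaacsHam N k m Dset Γset iv h f) β u Du D2u ut := by
  have hβc : Continuous β := by
    rw [continuous_iff_continuousAt]
    intro x
    obtain ⟨K, hK⟩ := hβLip (‖x‖ + 1)
    rw [ContinuousAt, tendsto_iff_norm_sub_tendsto_zero]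
    have hlim : Tendsto (fun y => K * ‖y - x‖) (𝓝 x) (𝓝 0) := by
      have hc : Continuous fun y => K * ‖y - x‖ := by fun_prop
      simpa using hc.tendsto x
    refine tendsto_of_tendsto_of_tendsto_of_le_of_le' tendsto_const_nhds hlim
      (Eventually.of_forall fun y => norm_nonneg _) ?_
    have hnear : ∀ᶠ y in 𝓝 x, ‖y‖ < ‖x‖ + 1 :=
      (isOpen_lt continuous_norm continuous_const).mem_nhds (show ‖x‖ < ‖x‖ + 1 by linarith)
    filter_upwards [hnear] with y hy
    exact hK y x hy.le (by linarith)
  obtain ⟨δ₀, hδ₀⟩ := hDne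
  obtain ⟨η₀, hη₀⟩ := hΓne
  have hβB : ∀ x, |β x| ≤ B * Real.exp (A * ‖x‖) := fun x => by
    linarith [hD4f x 0 δ₀ η₀ ⟨le_rfl, hT.le⟩ hδ₀ hη₀, abs_nonneg (f x 0 δ₀ η₀)]
  have hhB : ∀ (x : Euc N) (t : ℝ) (δ : Fin k → ℝ) (η : Fin m → ℝ), t ∈ Icc (0 : ℝ) T →
      δ ∈ Dset → η ∈ Γset → h x t δ η ≤ B * (1 + ‖x‖) := by
    intro x t δ η ht hδ hη
    rcases hD4h with h1 | h1
    · exact (le_abs_self _).trans (h1 x t δ η ht hδ hη)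
    · exact (h1 x t δ η ht hδ hη).trans (by nlinarith [norm_nonneg x])
  obtain ⟨C, Λ₀, hCC, hΛ, hCa⟩ := exists_coef_seq hT ha hσlocLip hμ hell hB hD4σ
  obtain ⟨u, p, hu, huT, hloc⟩ := exists_local_solution
    (isHam_isaacsHam hT hD ⟨δ₀, hδ₀⟩ hΓ ⟨η₀, hη₀⟩ hhcont hLpos hLip hB hhB
      (fun x t δ η ht hδ hη => by linarith [hD4f x t δ η ht hδ hη, abs_nonneg (β x)]) hD4i)
    hA.le hB hβc hβB hT hCC hΛ
  have key : ∀ x t, t ∈ Ico 0 T → ContinuousAt p (x, t) ∧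
      HasGradientAt (fun y => u (y, t)) (p (x, t)) x ∧
      HasFDerivAt (fun y => p (y, t)) (fderiv ℝ (fun y => p (y, t)) x) x ∧
      HasDerivAt (fun s => u (x, s)) (deriv (fun s => u (x, s)) t) t ∧
      ContinuousAt (fun q : Euc N × ℝ => fderiv ℝ (fun y => p (y, q.2)) q.1) (x, t) ∧
      ContinuousAt (fun q : Euc N × ℝ => deriv (fun s => u (q.1, s)) q.2) (x, t) ∧
      deriv (fun s => u (x, s)) t + (1/2) * (∑ i, ∑ j, a x t i j *
        (fderiv ℝ (fun y => p (y, t)) x (EuclideanSpace.single j 1)) i) +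
        isaacsHam N k m Dset Γset iv h f (p (x, t)) (u (x, t)) x t = 0 := by
    intro x t ht
    obtain ⟨hp, n, hn, ρ, hρ, D2, dt, hD2, hdt, hq⟩ :=
      hloc (x, t) (show (-1 : ℝ) < t by linarith [ht.1]) ht.2
    have hmem := Metric.ball_mem_nhds (x, t) hρ
    have e1 : (fun q : Euc N × ℝ => fderiv ℝ (fun y => p (y, q.2)) q.1) =ᶠ[𝓝 (x, t)] D2 := by
      filter_upwards [hmem] with q hq'
      exact (hq q hq').1.hH.fderiv
    have e2 : (fun q : Euc N × ℝ => deriv (fun s => u (q.1, s)) q.2) =ᶠ[𝓝 (x, t)] dt := by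
      filter_upwards [hmem] with q hq'
      exact (hq q hq').1.ht.deriv
    obtain ⟨hAt, heq⟩ := hq (x, t) (Metric.mem_ball_self hρ)
    have hH' : HasFDerivAt (fun y => p (y, t)) (D2 (x, t)) x := hAt.hH
    have ht' : HasDerivAt (fun s => u (x, s)) (dt (x, t)) t := hAt.ht
    refine ⟨hp, ?_, hH'.differentiableAt.hasFDerivAt, ht'.differentiableAt.hasDerivAt,
      hD2.continuousAt.congr e1.symm, hdt.continuousAt.congr e2.symm, ?_⟩
    · rw [hasGradientAt_iff_hasFDerivAt]
      exact hAt.hD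
    · rw [hH'.fderiv, ht'.deriv, ← hCa n (x, t) _ (by linarith) ⟨ht.1, ht.2.le⟩]
      rw [clamp_of_mem (t := (x, t).2) ⟨ht.1, ht.2.le⟩] at heq
      have heq' : dt (x, t) + 1 / 2 * (C n).tr (x, t) (D2 (x, t)) =
          -isaacsHam N k m Dset Γset iv h f (p (x, t)) (u (x, t)) x t := heq
      linarith
  refine ⟨fun x t => u (x, t), fun x t => p (x, t), fun x t => fderiv ℝ (fun y => p (y, t)) x,
    fun x t => deriv (fun s => u (x, s)) t, hu.mono (prod_mono subset_rfl
      (Icc_subset_Icc_left (by norm_num))), fun x t ht => (key x t ht).2.1,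
    fun x t ht => (key x t ht).2.2.1, fun x t ht => (key x t ht).2.2.2.1.hasDerivWithinAt,
    fun q hq => (key q.1 q.2 hq.2).1.continuousWithinAt,
    fun q hq => (key q.1 q.2 hq.2).2.2.2.2.1.continuousWithinAt,
    fun q hq => (key q.1 q.2 hq.2).2.2.2.2.2.1.continuousWithinAt,
    fun x t ht => (key x t ht).2.2.2.2.2.2, huT⟩
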